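/- Let K ⊆ ℚ̄ be a field. If elements ξ_1, …, ξ_r of E_K are linearly dependent over ℚ̄, then they are linearly dependent over K. Equivalently, the K-algebras E_K and ℚ̄ are linearly disjoint over K, and E = E_K ⊗_K ℚ̄. -/

import Mathlib

noncomputable section

/-- The derivative `d/dz` of a formal power series over `ℂ`. -/
def psD (f : PowerSeries ℂ) : PowerSeries ℂ :=
  PowerSeries.mk fun n => ((n : ℂ) + 1) * PowerSeries.coeff (n + 1) f

/-- The Mahler operator `σ_q : f(z) ↦ f(z^q)` on formal power series over `ℂ`. -/
def psSigma (q : ℕ) (f : PowerSeries ℂ) : PowerSeries ℂ :=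
  PowerSeries.mk fun n => if q ∣ n then PowerSeries.coeff (n / q) f else 0

/-- The canonical embedding of polynomials into power series. -/
def polyPS : Polynomial ℂ →+* PowerSeries ℂ := Polynomial.coeToPowerSeries.ringHom

/-- The power series `∑ (a n / n!) zⁿ` attached to a sequence `a` of coefficients. -/
def ePS (a : ℕ → ℂ) : PowerSeries ℂ := PowerSeries.mk fun n => a n / (n.factorial : ℂ)

/-- `IsE a` : the power series `∑ (a n / n!) zⁿ` is an E-function: its coefficients are
algebraic, it satisfies a nonzero linear differential equation over `ℚ̄[z]`, and the size of
the conjugates of the `a n` as well as their common denominators grow at most geometrically. -/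
def IsE (a : ℕ → ℂ) : Prop :=
  (∀ n, IsAlgebraic ℚ (a n)) ∧
  (∃ (m : ℕ) (p : ℕ → Polynomial ℂ),
      (∀ i k, IsAlgebraic ℚ ((p i).coeff k)) ∧ (∃ i, i ≤ m ∧ p i ≠ 0) ∧
      ∑ i ∈ Finset.range (m + 1), polyPS (p i) * psD^[i] (ePS a) = 0) ∧
  (∃ C : ℝ, 0 < C ∧ ∃ d : ℕ → ℕ, ∀ n : ℕ, 1 ≤ n →
      1 ≤ d n ∧ (d n : ℝ) ≤ C ^ n ∧
      (∀ σ : (integralClosure ℚ ℂ) →+* ℂ, ∀ h : a n ∈ integralClosure ℚ ℂ,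
        ‖σ ⟨a n, h⟩‖ ≤ C ^ n) ∧
      (∀ i, 1 ≤ i → i ≤ n → IsIntegral ℤ ((d n : ℂ) * a i)))

/-- The value at `α` of the E-function with coefficient sequence `a`
(E-functions are entire, so this series converges for all `α`). -/
def evalE (a : ℕ → ℂ) (α : ℂ) : ℂ := ∑' n : ℕ, a n / (n.factorial : ℂ) * α ^ n

/-- `IsM q f` : the formal power series `f` is an M_q-function, i.e. it has algebraic
coefficients and satisfies a linear `σ_q`-difference equation over `ℚ̄[z]` with
not-all-zero polynomial coefficients. -/
def IsM (q : ℕ) (f : PowerSeries ℂ) : Prop :=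
  (∀ n, IsAlgebraic ℚ (PowerSeries.coeff n f)) ∧
  ∃ (m : ℕ) (p : ℕ → Polynomial ℂ),
    (∀ i k, IsAlgebraic ℚ ((p i).coeff k)) ∧ (∃ i, i ≤ m ∧ p i ≠ 0) ∧
    ∑ i ∈ Finset.range (m + 1), polyPS (p i) * (psSigma q)^[i] f = 0

/-- `MahlerValue f α v` : the meromorphic extension of (the sum of) the power series `f`
to the open unit disk has no pole at `α` and takes the value `v` there. -/
def MahlerValue (f : PowerSeries ℂ) (α v : ℂ) : Prop :=
  ∃ F : ℂ → ℂ, MeromorphicOn F (Metric.ball (0 : ℂ) 1) ∧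
    (∀ᶠ z in nhds (0 : ℂ), HasSum (fun n => PowerSeries.coeff n f * z ^ n) (F z)) ∧
    AnalyticAt ℂ F α ∧ F α = v

/-- The power series `f` converges (hence defines an analytic function) on the open
disk `D(0,R)`. -/
def AnOnBall (f : PowerSeries ℂ) (R : ℝ) : Prop :=
  ∀ z : ℂ, ‖z‖ < R → Summable fun n => PowerSeries.coeff n f * z ^ n

/-- The value at `z` of (the sum of) the power series `f`. -/
def psEval (f : PowerSeries ℂ) (z : ℂ) : ℂ := ∑' n : ℕ, PowerSeries.coeff n f * z ^ n

/-- `Banal fv α P` : the homogeneous algebraic relation `P` among the values at `α` of the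
power series `fv 1, …, fv r` is banal: it is the specialization at `z = α` of some
`Q ∈ ℚ̄[z, X₁, …, X_r]`, homogeneous in `X₁, …, X_r`, with `Q(z, fv 1, …, fv r) = 0`. -/
def Banal {r : ℕ} (fv : Fin r → PowerSeries ℂ) (α : ℂ) (P : MvPolynomial (Fin r) ℂ) : Prop :=
  ∃ Q : MvPolynomial (Fin r) (Polynomial ℂ),
    (∀ v k, IsAlgebraic ℚ ((MvPolynomial.coeff v Q).coeff k)) ∧
    (∃ e, Q.IsHomogeneous e) ∧
    MvPolynomial.eval₂ polyPS fv Q = 0 ∧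
    MvPolynomial.map (Polynomial.evalRingHom α) Q = P

/-- `Eset S` : the set of values at `z = 1` of all E-functions with coefficients in `S`. -/
def Eset (S : Set ℂ) : Set ℂ :=
  {x | ∃ a : ℕ → ℂ, IsE a ∧ (∀ n, a n ∈ S) ∧ x = evalE a 1}

/-- `Mset q α S` : the set of values at `α` of all M_q-functions with coefficients in `S`
having no pole at `α`. -/
def Mset (q : ℕ) (α : ℂ) (S : Set ℂ) : Set ℂ :=
  {x | ∃ f : PowerSeries ℂ, IsM q f ∧ (∀ n, PowerSeries.coeff n f ∈ S) ∧ MahlerValue f α x}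

namespace EDescent

open Finset PowerSeries

/-! ### Derivations, constants and linear independence -/

/-- Vectors killed by a connection which are independent over the constants of the base field
are independent over the whole field. -/
theorem linearIndependent_of_constants {C F V ι : Type*} [Field C] [Field F] [Algebra C F]
    [AddCommGroup V] [Module F V] [Module C V] [IsScalarTower C F V]
    (d : F →+ F) (hd : ∀ a, d a = 0 → a ∈ (algebraMap C F).range)
    (D : V →+ V) (hD : ∀ (a : F) (v : V), D (a • v) = d a • v + a • D v)
    (v : ι → V) (hv : ∀ i, D (v i) = 0) (hli : LinearIndependent C v) :
    LinearIndependent F v := by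
  classical
  rw [linearIndependent_iff'] at hli ⊢
  intro s
  induction s using Finset.induction_on with
  | empty => simp
  | insert a s ha ih =>
    intro g hg
    by_cases hga : g a = 0
    · rw [sum_insert ha, hga, zero_smul, zero_add] at hg
      intro i hi
      rcases mem_insert.1 hi with rfl | hi
      · exact hga
      · exact ih g hg i hi
    · exfalso
      set h : ι → F := fun i => (g a)⁻¹ * g i with hh
      have hha : h a = 1 := inv_mul_cancel₀ hga
      have hsum : ∑ i ∈ insert a s, h i • v i = 0 := by
        simp only [hh, mul_smul, ← smul_sum, hg, smul_zero]
      have hDs : ∑ i ∈ s, d (h i) • v i = 0 := by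
        have := congrArg D hsum
        simpa [map_sum, hD, hv, sum_insert ha, hha] using this
      have hc := ih (fun i => d (h i)) hDs
      have hc' : ∀ i ∈ insert a s, ∃ c : C, algebraMap C F c = h i := by
        intro i hi
        rcases mem_insert.1 hi with rfl | hi
        · exact ⟨1, by rw [map_one, hha]⟩
        · exact hd _ (hc i hi)
      choose! c hc' using hc'
      have h0 : ∑ i ∈ insert a s, c i • v i = 0 := by
        rw [← hsum]
        refine sum_congr rfl fun i hi => ?_
        rw [← hc' i hi, algebraMap_smul]
      have := hli _ c h0 a (mem_insert_self a s)
      have h2 := hc' a (mem_insert_self a s)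
      rw [this, map_zero, hha] at h2
      exact zero_ne_one h2

/-- Nonzero elements of a finite-dimensional space of power series have bounded order. -/
theorem exists_order_bound {K : Type*} [Field K] (V : Submodule K K⟦X⟧) [FiniteDimensional K V] :
    ∃ c : ℕ, ∀ v ∈ V, (X : K⟦X⟧) ^ c ∣ v → v = 0 := by
  let W : ℕ → Submodule K V := fun c =>
    { carrier := {v | (X : K⟦X⟧) ^ c ∣ (v : K⟦X⟧)}
      add_mem' := fun ha hb => dvd_add ha hb
      zero_mem' := dvd_zero _
      smul_mem' := fun a v hv => by
        simp only [Set.mem_ofPred_eq, Submodule.coe_smul] at hv ⊢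
        rw [PowerSeries.smul_eq_C_mul]
        exact hv.mul_left _ }
  have hW : Antitone W := fun a b hab v hv => (pow_dvd_pow _ hab).trans hv
  obtain ⟨n, hn⟩ := IsArtinian.monotone_stabilizes (R := K) (M := V) ⟨fun c => OrderDual.toDual (W c), fun a b h => hW h⟩
  refine ⟨n, fun v hv hdvd => ?_⟩
  ext m
  rw [map_zero]
  have hm : (⟨v, hv⟩ : V) ∈ W (n + m + 1) := by
    have h1 : W n = W (n + m + 1) := by
      have := hn (n + m + 1) (by omega)
      exact this
    rw [← h1]
    exact hdvd
  exact (X_pow_dvd_iff.1 hm) m (by omega)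

/-! ### The derivation on Laurent series -/

variable {K : Type*} [Field K]

theorem coeff_single_mul_coe (a : ℤ) (f : K⟦X⟧) (b : ℤ) :
    (HahnSeries.single a (1 : K) * (f : LaurentSeries K)).coeff b =
      if b < a then 0 else coeff (b - a).toNat f := by
  have h := HahnSeries.coeff_single_mul (r := (1 : K)) (x := (f : LaurentSeries K)) (a := b) (b := a)
  rw [h, one_mul, PowerSeries.coeff_coe]
  by_cases hb : b < a
  · simp [hb]
  · have : ¬ (b - a < 0) := by omega
    simp only [this, hb, if_false]
    congr 2
    omega

theorem laurent_derivative_single_mul (a : ℤ) (f : K⟦X⟧) :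
    LaurentSeries.derivative K (HahnSeries.single a (1 : K) * (f : LaurentSeries K)) =
      (a : LaurentSeries K) * (HahnSeries.single (a - 1) (1 : K) * (f : LaurentSeries K)) +
      HahnSeries.single a (1 : K) * ((d⁄dX K f : K⟦X⟧) : LaurentSeries K) := by
  have hInt : (a : LaurentSeries K) = HahnSeries.C (a : K) := by simp
  ext b
  rw [LaurentSeries.derivative_apply, LaurentSeries.hasseDeriv_coeff, HahnSeries.coeff_add, hInt,
    HahnSeries.C_apply, HahnSeries.coeff_single_zero_mul, coeff_single_mul_coe,
    coeff_single_mul_coe, coeff_single_mul_coe]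
  simp only [Nat.cast_one, Ring.choose_one_right]
  rcases lt_trichotomy (b + 1) a with h | h | h
  · rw [if_pos h, if_pos (by omega), if_pos (by omega)]; simp
  · rw [if_neg (by omega), if_neg (by omega), if_pos (by omega)]
    subst h; simp
  · rw [if_neg (by omega), if_neg (by omega), if_neg (by omega), coeff_derivative]
    obtain ⟨n, rfl⟩ : ∃ n : ℕ, b = a + n := ⟨(b - a).toNat, by omega⟩
    have e1 : (a + n + 1 - a).toNat = n + 1 := by omega
    have e2 : (a + n - (a - 1)).toNat = n + 1 := by omega
    have e3 : (a + n - a).toNat = n := by omega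
    rw [e1, e2, e3, zsmul_eq_mul]
    push_cast
    ring

theorem exists_eq_single_mul (f : LaurentSeries K) :
    ∃ (a : ℤ) (g : K⟦X⟧), f = HahnSeries.single a (1 : K) * (g : LaurentSeries K) :=
  ⟨f.order, f.powerSeriesPart, (LaurentSeries.single_order_mul_powerSeriesPart f).symm⟩

theorem laurent_derivative_mul (f g : LaurentSeries K) :
    LaurentSeries.derivative K (f * g) =
      f * LaurentSeries.derivative K g + g * LaurentSeries.derivative K f := by
  obtain ⟨a, p, rfl⟩ := exists_eq_single_mul f
  obtain ⟨b, q, rfl⟩ := exists_eq_single_mul g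
  have h : HahnSeries.single a (1 : K) * (p : LaurentSeries K) *
      (HahnSeries.single b (1 : K) * (q : LaurentSeries K)) =
      HahnSeries.single (a + b) (1 : K) * ((p * q : K⟦X⟧) : LaurentSeries K) := by
    have : HahnSeries.single (a + b) (1 : K) = HahnSeries.single a (1 : K) * HahnSeries.single b (1 : K) := by
      rw [HahnSeries.single_mul_single, one_mul]
    rw [this, PowerSeries.coe_mul]; ring
  have e1 : HahnSeries.single (a + b) (1 : K) = HahnSeries.single a (1 : K) * HahnSeries.single b (1 : K) := by
      rw [HahnSeries.single_mul_single, one_mul]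
  have e2 : HahnSeries.single (a + b - 1) (1 : K) =
      HahnSeries.single a (1 : K) * HahnSeries.single (b - 1) (1 : K) := by
      rw [HahnSeries.single_mul_single, one_mul, add_sub_assoc]
  have e3 : HahnSeries.single (a + b - 1) (1 : K) =
      HahnSeries.single (a - 1) (1 : K) * HahnSeries.single b (1 : K) := by
      rw [HahnSeries.single_mul_single, one_mul, show a - 1 + b = a + b - 1 by ring]
  rw [h, laurent_derivative_single_mul, laurent_derivative_single_mul,
    laurent_derivative_single_mul, Derivation.leibniz, smul_eq_mul, smul_eq_mul,
    PowerSeries.coe_mul, PowerSeries.coe_add, PowerSeries.coe_mul, PowerSeries.coe_mul, e1]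
  push_cast
  have e4 := e3.symm.trans e2
  rw [e2]
  linear_combination (a : LaurentSeries K) * p * q * (-e4)

theorem laurent_derivative_eq_zero [CharZero K] (f : LaurentSeries K)
    (h : LaurentSeries.derivative K f = 0) : HahnSeries.C (f.coeff 0) = f := by
  ext n
  by_cases hn : n = 0
  · subst hn; simp
  · have h1 : (LaurentSeries.derivative K f).coeff (n - 1) = 0 := by
      rw [h]; simp
    rw [LaurentSeries.derivative_apply, LaurentSeries.hasseDeriv_coeff] at h1
    simp only [Nat.cast_one, Ring.choose_one_right, sub_add_cancel, zsmul_eq_mul, mul_eq_zero,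
      Int.cast_eq_zero, hn, false_or] at h1
    rw [h1, HahnSeries.C_apply, HahnSeries.coeff_single_of_ne hn]

variable (K) in
/-- The field of Laurent series over `K`. -/
def LS : Type _ := LaurentSeries K

instance : Field (LS K) := inferInstanceAs (Field (LaurentSeries K))

instance : Algebra K (LS K) := RingHom.toAlgebra (HahnSeries.C : K →+* LaurentSeries K)

variable (K) in
/-- The embedding of power series into Laurent series. -/
def LS.ofPS : K⟦X⟧ →+* LS K := (HahnSeries.ofPowerSeries ℤ K : K⟦X⟧ →+* LaurentSeries K)

theorem LS.ofPS_injective : Function.Injective (LS.ofPS K) :=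
  HahnSeries.ofPowerSeries_injective

theorem LS.ofPS_C (a : K) : LS.ofPS K (C a) = algebraMap K (LS K) a := PowerSeries.coe_C a

theorem LS.ofPS_smul (a : K) (f : K⟦X⟧) : LS.ofPS K (a • f) = a • LS.ofPS K f := by
  rw [PowerSeries.smul_eq_C_mul, map_mul, LS.ofPS_C, Algebra.smul_def]

variable (K) in
/-- The derivation `d/dX` of the field of Laurent series. -/
def lsDeriv : Derivation ℤ (LS K) (LS K) :=
  Derivation.mk' ((LaurentSeries.derivative K).toAddMonoidHom.toIntLinearMap :
    LaurentSeries K →ₗ[ℤ] LaurentSeries K) fun f g => laurent_derivative_mul f g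

theorem lsDeriv_ofPS (f : K⟦X⟧) :
    lsDeriv K (LS.ofPS K f) = LS.ofPS K (d⁄dX K f) := by
  have := laurent_derivative_single_mul 0 f
  simp only [Int.cast_zero, zero_mul, zero_add] at this
  have h1 : (HahnSeries.single (0:ℤ) (1 : K)) = (1 : LaurentSeries K) := rfl
  rw [h1, one_mul, one_mul] at this
  exact this

theorem lsDeriv_eq_zero [CharZero K] (f : LS K) (h : lsDeriv K f = 0) :
    f ∈ (algebraMap K (LS K)).range :=
  ⟨HahnSeries.coeff (Γ := ℤ) f 0, laurent_derivative_eq_zero (K := K) f h⟩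

end EDescent

namespace EDescent

open Finset PowerSeries

/-! ### Recurrences satisfied by coefficients of solutions of differential equations -/

theorem coeff_X_pow_mul_iterate_derivative {E : Type*} [Field E] (f : E⟦X⟧) (j m : ℕ) :
    coeff m (X ^ j * (d⁄dX E)^[j] f) = (m.descFactorial j : E) * coeff m f := by
  rw [coeff_X_pow_mul']
  split_ifs with h
  · obtain ⟨r, rfl⟩ := Nat.exists_eq_add_of_le' h
    rw [coeff_iterate_derivative]
    simp [Nat.add_descFactorial_eq_ascFactorial]
  · rw [Nat.descFactorial_of_lt (by omega)]; simp

theorem exists_common_X_pow {F : Type*} [Field F] (J : ℕ) (p : ℕ → Polynomial F)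
    (hp : ∃ j ≤ J, p j ≠ 0) :
    ∃ (i : ℕ) (p' : ℕ → Polynomial F), (∀ j ≤ J, p j = Polynomial.X ^ i * p' j) ∧
      ∃ j ≤ J, (p' j).coeff 0 ≠ 0 := by
  classical
  have hex : ∃ i, ∃ j ≤ J, (p j).coeff i ≠ 0 := by
    obtain ⟨j, hj, h⟩ := hp
    obtain ⟨i, hi⟩ : ∃ i, (p j).coeff i ≠ 0 := by
      by_contra! hc
      exact h (Polynomial.ext (by simpa using hc))
    exact ⟨i, j, hj, hi⟩
  have hdvd : ∀ j, ∃ q, j ≤ J → p j = Polynomial.X ^ (Nat.find hex) * q := by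
    intro j
    by_cases hj : j ≤ J
    · obtain ⟨q, hq⟩ : Polynomial.X ^ (Nat.find hex) ∣ p j := by
        rw [Polynomial.X_pow_dvd_iff]
        intro d hd
        by_contra hne
        exact Nat.find_min hex hd ⟨j, hj, hne⟩
      exact ⟨q, fun _ => hq⟩
    · exact ⟨0, fun h => absurd h hj⟩
  choose p' hp' using hdvd
  refine ⟨Nat.find hex, p', hp', ?_⟩
  obtain ⟨j, hj, h⟩ := Nat.find_spec hex
  refine ⟨j, hj, ?_⟩
  rwa [hp' j hj, Polynomial.coeff_X_pow_mul', if_pos le_rfl, Nat.sub_self] at h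

/-- The coefficients of a power series satisfying a linear differential equation satisfy a
recurrence with polynomial coefficients. -/
theorem exists_recurrence {F E : Type*} [Field F] [CharZero F] [Field E] [Algebra F E]
    (J : ℕ) (q : ℕ → Polynomial F) (hq : ∃ j ≤ J, q j ≠ 0) (f : E⟦X⟧)
    (hf : ∑ j ∈ range (J + 1), (((q j).map (algebraMap F E) : Polynomial E) : E⟦X⟧) *
      (d⁄dX E)^[j] f = 0) :
    ∃ (M : ℕ) (χ : ℕ → Polynomial F), χ 0 ≠ 0 ∧ (∀ s, M < s → χ s = 0) ∧
      ∀ m : ℕ, algebraMap F E ((χ 0).eval (m : F)) * coeff m f =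
        -∑ r ∈ range m, algebraMap F E ((χ (m - r)).eval (r : F)) * coeff r f := by
  obtain ⟨i, p, hp, hp0⟩ := exists_common_X_pow J (fun j => Polynomial.X ^ (J - j) * q j) (by
    obtain ⟨j, hj, h⟩ := hq
    exact ⟨j, hj, mul_ne_zero (pow_ne_zero _ Polynomial.X_ne_zero) h⟩)
  have hsum : ∑ j ∈ range (J + 1), (((p j).map (algebraMap F E) : Polynomial E) : E⟦X⟧) *
      (X ^ j * (d⁄dX E)^[j] f) = 0 := by
    have h1 : (X : E⟦X⟧) ^ i * ∑ j ∈ range (J + 1),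
        (((p j).map (algebraMap F E) : Polynomial E) : E⟦X⟧) * (X ^ j * (d⁄dX E)^[j] f) =
        X ^ J * ∑ j ∈ range (J + 1), (((q j).map (algebraMap F E) : Polynomial E) : E⟦X⟧) *
          (d⁄dX E)^[j] f := by
      rw [mul_sum, mul_sum]
      refine sum_congr rfl fun j hj => ?_
      have hj' : j ≤ J := by simpa [Nat.lt_succ_iff] using hj
      have h2 := congrArg (fun r : Polynomial F => ((r.map (algebraMap F E) : Polynomial E) : E⟦X⟧))
        (hp j hj')
      simp only [Polynomial.map_mul, Polynomial.map_pow, Polynomial.map_X, Polynomial.coe_mul,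
        Polynomial.coe_pow, Polynomial.coe_X] at h2
      rw [← mul_assoc, ← h2]
      have : (X : E⟦X⟧) ^ J = X ^ (J - j) * X ^ j := by rw [← pow_add]; congr 1; omega
      rw [this]; ring
    rw [hf, mul_zero] at h1
    exact (mul_eq_zero.1 h1).resolve_left (pow_ne_zero _ X_ne_zero)
  refine ⟨∑ j ∈ range (J + 1), (p j).natDegree,
    fun s => ∑ j ∈ range (J + 1), Polynomial.C ((p j).coeff s) * descPochhammer F j, ?_, ?_, ?_⟩
  · classical
    have hex : ∃ j, j ≤ J ∧ (p j).coeff 0 ≠ 0 := hp0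
    set j0 := Nat.find hex with hj0
    obtain ⟨hj0J, hj0ne⟩ := Nat.find_spec hex
    intro h0
    have h1 := congrArg (Polynomial.eval (j0 : F)) h0
    rw [Polynomial.eval_finsetSum, Polynomial.eval_zero,
      sum_eq_single_of_mem j0 (mem_range.2 (by omega))] at h1
    · rw [Polynomial.eval_mul, Polynomial.eval_C, descPochhammer_eval_eq_descFactorial,
        Nat.descFactorial_self] at h1
      rcases mul_eq_zero.1 h1 with h | h
      · exact hj0ne h
      · exact Nat.factorial_ne_zero j0 (by exact_mod_cast h)
    · intro j hj hne
      rw [Polynomial.eval_mul, Polynomial.eval_C, descPochhammer_eval_eq_descFactorial]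
      rcases lt_or_gt_of_ne hne with h | h
      · have : (p j).coeff 0 = 0 := by
          by_contra hc
          exact Nat.find_min hex h ⟨by simpa [Nat.lt_succ_iff] using hj, hc⟩
        rw [this, zero_mul]
      · rw [Nat.descFactorial_of_lt h]; simp
  · intro s hs
    refine sum_eq_zero fun j hj => ?_
    rw [Polynomial.coeff_eq_zero_of_natDegree_lt, Polynomial.C_0, zero_mul]
    exact lt_of_le_of_lt (single_le_sum (f := fun j => (p j).natDegree) (fun _ _ => Nat.zero_le _) hj) hs
  · intro m
    set χ : ℕ → Polynomial F := fun s => ∑ j ∈ range (J + 1),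
      Polynomial.C ((p j).coeff s) * descPochhammer F j with hχ
    suffices hanti : ∑ p ∈ antidiagonal m,
        algebraMap F E ((χ p.1).eval (p.2 : F)) * coeff p.2 f = 0 by
      rw [Nat.antidiagonal_eq_map', sum_map, sum_range_succ] at hanti
      change ∑ r ∈ range m, algebraMap F E ((χ (m - r)).eval (r : F)) * coeff r f +
        algebraMap F E ((χ (m - m)).eval (m : F)) * coeff m f = 0 at hanti
      rw [Nat.sub_self] at hanti
      linear_combination hanti
    have h1 := congrArg (coeff m) hsum
    rw [map_sum, map_zero] at h1
    rw [← h1]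
    have hcm : ∀ j, coeff m ((((p j).map (algebraMap F E) : Polynomial E) : E⟦X⟧) *
        (X ^ j * (d⁄dX E)^[j] f)) = ∑ x ∈ antidiagonal m, algebraMap F E ((p j).coeff x.1) *
          ((x.2.descFactorial j : E) * coeff x.2 f) := by
      intro j
      rw [coeff_mul]
      refine sum_congr rfl fun x _ => ?_
      rw [coeff_X_pow_mul_iterate_derivative, Polynomial.coeff_coe, Polynomial.coeff_map]
    simp only [hcm]
    rw [sum_comm]
    refine sum_congr rfl fun x _ => ?_
    rw [Polynomial.eval_finsetSum, map_sum, sum_mul]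
    refine sum_congr rfl fun j _ => ?_
    rw [Polynomial.eval_mul, Polynomial.eval_C, descPochhammer_eval_eq_descFactorial, map_mul,
      map_natCast, mul_assoc]

theorem exists_forall_eval_natCast_ne_zero {F : Type*} [Field F] [CharZero F] (χ : Polynomial F)
    (h : χ ≠ 0) : ∃ m0 : ℕ, ∀ m : ℕ, m0 ≤ m → χ.eval (m : F) ≠ 0 := by
  classical
  have hfin : {m : ℕ | χ.eval (m : F) = 0}.Finite := by
    have := (χ.roots.toFinset.finite_toSet).preimage (f := fun m : ℕ => (m : F))
      (Nat.cast_injective.injOn)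
    refine this.subset fun m hm => ?_
    simp only [Set.mem_preimage, Finset.mem_coe, Multiset.mem_toFinset]
    exact (Polynomial.mem_roots h).2 hm
  obtain ⟨N, hN⟩ := hfin.bddAbove
  exact ⟨N + 1, fun m hm h0 => by have := hN h0; omega⟩

/-- If the coefficients of a differential equation lie in `F`, all coefficients of a solution lie
in the extension of `F` generated by finitely many of them. -/
theorem exists_coeff_determined {F E : Type*} [Field F] [CharZero F] [Field E] [Algebra F E]
    (J : ℕ) (q : ℕ → Polynomial F) (hq : ∃ j ≤ J, q j ≠ 0) (f : E⟦X⟧)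
    (hf : ∑ j ∈ range (J + 1), (((q j).map (algebraMap F E) : Polynomial E) : E⟦X⟧) *
      (d⁄dX E)^[j] f = 0) :
    ∃ m0 : ℕ, ∀ S : IntermediateField F E, (∀ m < m0, coeff m f ∈ S) → ∀ m, coeff m f ∈ S := by
  obtain ⟨M, χ, h0, -, hrec⟩ := exists_recurrence J q hq f hf
  obtain ⟨m0, hm0⟩ := exists_forall_eval_natCast_ne_zero (χ 0) h0
  refine ⟨m0, fun S hS m => ?_⟩
  induction m using Nat.strong_induction_on with
  | _ m ih =>
    by_cases hm : m < m0
    · exact hS m hm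
    · have hr := hrec m
      have hne : algebraMap F E ((χ 0).eval (m : F)) ≠ 0 := by
        rw [Ne, _root_.map_eq_zero]; exact hm0 m (by omega)
      have : coeff m f = (algebraMap F E ((χ 0).eval (m : F)))⁻¹ *
          (-∑ x ∈ range m, algebraMap F E ((χ (m - x)).eval (x : F)) * coeff x f) := by
        rw [eq_inv_mul_iff_mul_eq₀ hne]
        exact hr
      rw [this]
      exact S.mul_mem (S.inv_mem (S.algebraMap_mem _)) (S.neg_mem (S.sum_mem fun x hx =>
        S.mul_mem (S.algebraMap_mem _) (ih x (mem_range.1 hx))))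

end EDescent

namespace EDescent

open Finset PowerSeries

theorem exists_int_multiple_eval (χ : Polynomial ℚ) :
    ∃ c : ℕ, 0 < c ∧ ∀ r : ℕ, ∃ z : ℤ, (c : ℚ) * χ.eval (r : ℚ) = z := by
  refine ⟨∏ i ∈ range (χ.natDegree + 1), (χ.coeff i).den,
    prod_pos fun i _ => (χ.coeff i).den_pos, fun r => ?_⟩
  have h : ∀ i ∈ range (χ.natDegree + 1), ∃ z : ℤ,
      ((∏ i ∈ range (χ.natDegree + 1), (χ.coeff i).den : ℕ) : ℚ) * (χ.coeff i * (r : ℚ) ^ i) = z := by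
    intro i hi
    obtain ⟨k, hk⟩ := dvd_prod_of_mem (fun i => (χ.coeff i).den) hi
    refine ⟨k * (χ.coeff i).num * r ^ i, ?_⟩
    rw [hk]
    push_cast
    have := Rat.mul_den_eq_num (χ.coeff i)
    linear_combination ((k : ℚ) * (r : ℚ) ^ i) * this
  choose! z hz using h
  refine ⟨∑ i ∈ range (χ.natDegree + 1), z i, ?_⟩
  rw [Polynomial.eval_eq_sum_range, mul_sum, Int.cast_sum]
  exact sum_congr rfl hz

theorem exists_abs_eval_le (χ : Polynomial ℚ) :
    ∃ A κ : ℕ, ∀ r : ℕ, |χ.eval (r : ℚ)| ≤ A * ((r : ℚ) + 1) ^ κ := by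
  obtain ⟨A, hA⟩ := exists_nat_ge (∑ i ∈ range (χ.natDegree + 1), |χ.coeff i|)
  refine ⟨A, χ.natDegree, fun r => ?_⟩
  rw [Polynomial.eval_eq_sum_range]
  calc |∑ i ∈ range (χ.natDegree + 1), χ.coeff i * (r : ℚ) ^ i|
      ≤ ∑ i ∈ range (χ.natDegree + 1), |χ.coeff i * (r : ℚ) ^ i| := abs_sum_le_sum_abs _ _
    _ ≤ ∑ i ∈ range (χ.natDegree + 1), |χ.coeff i| * ((r : ℚ) + 1) ^ χ.natDegree := by
        refine sum_le_sum fun i hi => ?_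
        have hr0 : (0 : ℚ) ≤ r := Nat.cast_nonneg r
        rw [abs_mul, abs_of_nonneg (pow_nonneg hr0 i)]
        refine mul_le_mul_of_nonneg_left ?_ (abs_nonneg _)
        calc (r : ℚ) ^ i ≤ ((r : ℚ) + 1) ^ i := pow_le_pow_left₀ hr0 (by linarith) i
          _ ≤ _ := pow_le_pow_right₀ (by linarith) (by simpa [Nat.lt_succ_iff] using hi)
    _ ≤ A * ((r : ℚ) + 1) ^ χ.natDegree := by
        rw [← sum_mul]
        exact mul_le_mul_of_nonneg_right hA (by positivity)

theorem exists_uniform_eval_bounds (M : ℕ) (χ : ℕ → Polynomial ℚ) (hχ : ∀ s, M < s → χ s = 0) :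
    ∃ c A κ : ℕ, 0 < c ∧ 0 < A ∧ ∀ s r : ℕ, (∃ z : ℤ, (c : ℚ) * (χ s).eval (r : ℚ) = z) ∧
      |(c : ℚ) * (χ s).eval (r : ℚ)| ≤ A * ((r : ℚ) + 1) ^ κ := by
  choose c hc hcz using fun s => exists_int_multiple_eval (χ s)
  choose A κ hA using fun s => exists_abs_eval_le (χ s)
  refine ⟨∏ s ∈ range (M + 1), c s, (∏ s ∈ range (M + 1), c s) * (∑ s ∈ range (M + 1), A s) + 1,
    ∑ s ∈ range (M + 1), κ s, prod_pos fun s _ => hc s, Nat.succ_pos _, fun s r => ?_⟩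
  by_cases hs : M < s
  · rw [hχ s hs]
    refine ⟨⟨0, by simp⟩, ?_⟩
    simp only [Polynomial.eval_zero, mul_zero, abs_zero]
    positivity
  · have hs' : s ∈ range (M + 1) := mem_range.2 (by omega)
    constructor
    · obtain ⟨k, hk⟩ := dvd_prod_of_mem c hs'
      obtain ⟨z, hz⟩ := hcz s r
      refine ⟨k * z, ?_⟩
      rw [hk]; push_cast; rw [← hz]; ring
    · have hr0 : (0 : ℚ) ≤ r := Nat.cast_nonneg r
      have h1 : (A s : ℚ) ≤ ((∑ s ∈ range (M + 1), A s : ℕ) : ℚ) := by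
        exact_mod_cast single_le_sum (f := A) (fun _ _ => Nat.zero_le _) hs'
      have h2 : κ s ≤ ∑ s ∈ range (M + 1), κ s :=
        single_le_sum (f := κ) (fun _ _ => Nat.zero_le _) hs'
      have h3 : ((r : ℚ) + 1) ^ κ s ≤ ((r : ℚ) + 1) ^ (∑ s ∈ range (M + 1), κ s) :=
        pow_le_pow_right₀ (by linarith) h2
      rw [abs_mul, Nat.abs_cast]
      calc ((∏ s ∈ range (M + 1), c s : ℕ) : ℚ) * |(χ s).eval (r : ℚ)|
          ≤ ((∏ s ∈ range (M + 1), c s : ℕ) : ℚ) *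
            (((∑ s ∈ range (M + 1), A s : ℕ) : ℚ) * ((r : ℚ) + 1) ^ (∑ s ∈ range (M + 1), κ s)) := by
            gcongr
            exact (hA s r).trans (mul_le_mul h1 h3 (by positivity) (by positivity))
        _ ≤ _ := by
            rw [← mul_assoc]
            refine mul_le_mul_of_nonneg_right ?_ (by positivity)
            push_cast
            linarith

theorem prod_range_mul_pow (A κ B : ℕ) :
    ∏ m ∈ range (B + 1), A * (m + 1) ^ κ = A ^ (B + 1) * ((B + 1).factorial) ^ κ := by
  rw [prod_mul_distrib, prod_const, card_range, prod_pow, prod_range_add_one_eq_factorial]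

/-- Coefficients of a rational power series solution of a differential equation over `ℚ[X]` have
height and common denominators bounded by a power of the factorial. -/
theorem exists_denominator_bound (J : ℕ) (q : ℕ → Polynomial ℚ) (hq : ∃ j ≤ J, q j ≠ 0)
    (f : ℚ⟦X⟧) (hf : ∑ j ∈ range (J + 1), ((q j : Polynomial ℚ) : ℚ⟦X⟧) * (d⁄dX ℚ)^[j] f = 0) :
    ∃ A κ : ℕ, ∀ B : ℕ, ∃ D : ℕ, 0 < D ∧ D ≤ A ^ (B + 1) * B.factorial ^ κ ∧
      ∀ l ≤ B, (∃ z : ℤ, (D : ℚ) * coeff l f = z) ∧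
        |coeff l f| ≤ (A : ℚ) ^ (B + 1) * (B.factorial : ℚ) ^ κ := by
  obtain ⟨M, χ, h0, hM, hrec⟩ := exists_recurrence J q hq f (by
    simpa [Algebra.algebraMap_self, Polynomial.map_id] using hf)
  simp only [Algebra.algebraMap_self, RingHom.id_apply] at hrec
  obtain ⟨m0, hm0⟩ := exists_forall_eval_natCast_ne_zero (χ 0) h0
  obtain ⟨c, A, κ, hc, hA, hbd⟩ := exists_uniform_eval_bounds M χ hM
  choose v hv using fun s r => (hbd s r).1
  have hvb : ∀ s r : ℕ, |(v s r : ℚ)| ≤ A * ((r : ℚ) + 1) ^ κ := fun s r => by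
    rw [← hv]; exact (hbd s r).2
  have hrec' : ∀ m : ℕ, (v 0 m : ℚ) * coeff m f = -∑ r ∈ range m, (v (m - r) r : ℚ) * coeff r f := by
    intro m
    simp only [← hv]
    rw [mul_assoc, hrec, mul_neg, mul_sum]
    simp only [mul_assoc]
  have hv0 : ∀ m, m0 ≤ m → v 0 m ≠ 0 := by
    intro m hm h
    have h1 := hv 0 m
    rw [h, Int.cast_zero] at h1
    rcases mul_eq_zero.1 h1 with h2 | h2
    · exact hc.ne' (by exact_mod_cast h2)
    · exact hm0 m hm h2
  -- denominators
  let w : ℕ → ℕ := fun m => if m0 ≤ m then (v 0 m).natAbs else 1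
  have hw : ∀ m, 0 < w m := by
    intro m
    simp only [w]
    split_ifs with h
    · exact Int.natAbs_pos.2 (hv0 m h)
    · exact one_pos
  have hwb : ∀ m, w m ≤ A * (m + 1) ^ (κ + 1) := by
    intro m
    simp only [w]
    split_ifs with h
    · have h1 := hvb 0 m
      have h2 : ((v 0 m).natAbs : ℚ) ≤ A * ((m : ℚ) + 1) ^ κ := by
        rw [Nat.cast_natAbs, Int.cast_abs]; exact h1
      have h3 : (v 0 m).natAbs ≤ A * (m + 1) ^ κ := by exact_mod_cast h2
      exact h3.trans (Nat.mul_le_mul_left _ (Nat.pow_le_pow_right (Nat.succ_pos m) (Nat.le_succ κ)))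
    · exact Nat.mul_pos hA (pow_pos (Nat.succ_pos m) _)
  let D0 : ℕ := ∏ l ∈ range m0, (coeff l f).den
  have hD0 : 0 < D0 := prod_pos fun l _ => (coeff l f).den_pos
  let Dn : ℕ → ℕ := fun B => D0 * ∏ m ∈ range (B + 1), w m
  have hDsucc : ∀ B, Dn (B + 1) = Dn B * w (B + 1) := fun B => by
    simp only [Dn, prod_range_succ _ (B + 1), mul_assoc]
  have hInt : ∀ B, ∀ l ≤ B, ∃ z : ℤ, (Dn B : ℚ) * coeff l f = z := by
    have hsmall : ∀ l < m0, ∀ B, ∃ z : ℤ, (Dn B : ℚ) * coeff l f = z := by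
      intro l hl B
      obtain ⟨k, hk⟩ := dvd_prod_of_mem (fun l => (coeff l f).den) (mem_range.2 hl)
      refine ⟨(coeff l f).num * k * ∏ m ∈ range (B + 1), w m, ?_⟩
      have h1 : (D0 : ℚ) = (coeff l f).den * k := by exact_mod_cast hk
      simp only [Dn]
      push_cast
      rw [h1]
      have := Rat.mul_den_eq_num (coeff l f)
      linear_combination ((k : ℚ) * ∏ m ∈ range (B + 1), (w m : ℚ)) * this
    have hlarge : ∀ m, m0 ≤ m → ∀ E : ℕ, (∀ r < m, ∃ z : ℤ, (E : ℚ) * coeff r f = z) →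
        ∃ z : ℤ, ((E * w m : ℕ) : ℚ) * coeff m f = z := by
      intro m hm E hE
      choose! z hz using hE
      have h1 : (E : ℚ) * ((v 0 m : ℚ) * coeff m f) =
          ((-∑ r ∈ range m, v (m - r) r * z r : ℤ) : ℚ) := by
        rw [hrec', mul_neg, mul_sum]
        push_cast
        congr 1
        refine sum_congr rfl fun r hr => ?_
        rw [← hz r (mem_range.1 hr)]; ring
      have hwm : w m = (v 0 m).natAbs := if_pos hm
      rw [hwm]
      rcases Int.natAbs_eq (v 0 m) with h | h
      · refine ⟨_, Eq.trans ?_ h1⟩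
        have : ((v 0 m).natAbs : ℚ) = (v 0 m : ℚ) := by
          have h4 := congrArg (Int.cast : ℤ → ℚ) h.symm
          rwa [Int.cast_natCast] at h4
        push_cast [this]; ring
      · refine ⟨_, Eq.trans ?_ (congrArg Neg.neg h1 |>.trans (Int.cast_neg _).symm)⟩
        have : ((v 0 m).natAbs : ℚ) = -(v 0 m : ℚ) := by
          have : ((v 0 m).natAbs : ℤ) = -(v 0 m) := by omega
          have h4 := congrArg (Int.cast : ℤ → ℚ) this
          rwa [Int.cast_natCast, Int.cast_neg] at h4
        push_cast [this]; ring
    intro B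
    induction B with
    | zero =>
      intro l hl
      obtain rfl : l = 0 := by omega
      by_cases hm : m0 ≤ 0
      · simpa [Dn] using hlarge 0 hm D0 (fun r hr => absurd hr (Nat.not_lt_zero r))
      · exact hsmall 0 (by omega) 0
    | succ B ih =>
      intro l hl
      rw [hDsucc]
      rcases Nat.lt_or_ge l (B + 1) with h | h
      · obtain ⟨z, hz⟩ := ih l (by omega)
        refine ⟨z * w (B + 1), ?_⟩
        push_cast
        rw [← hz]; ring
      · obtain rfl : l = B + 1 := by omega
        by_cases hm : m0 ≤ B + 1
        · exact hlarge _ hm _ fun r hr => ih r (by omega)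
        · rw [← hDsucc]; exact hsmall _ (by omega) _
  -- sizes
  obtain ⟨S, hS⟩ := exists_nat_ge (∑ l ∈ range m0, |coeff l f| + 1)
  have hS1 : 1 ≤ S := by
    have : (0 : ℚ) ≤ ∑ l ∈ range m0, |coeff l f| := sum_nonneg fun _ _ => abs_nonneg _
    exact_mod_cast (show (1 : ℚ) ≤ S by linarith)
  have hsize : ∀ l, |coeff l f| ≤ (S : ℚ) * ∏ m ∈ range (l + 1), ((A * (m + 1) ^ (κ + 1) : ℕ) : ℚ) := by
    have hge1 : ∀ m, (1 : ℚ) ≤ ((A * (m + 1) ^ (κ + 1) : ℕ) : ℚ) := fun m => by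
      exact_mod_cast Nat.mul_pos hA (pow_pos (Nat.succ_pos m) _)
    have hmono : ∀ a b, a ≤ b → ∏ m ∈ range a, ((A * (m + 1) ^ (κ + 1) : ℕ) : ℚ) ≤
        ∏ m ∈ range b, ((A * (m + 1) ^ (κ + 1) : ℕ) : ℚ) := by
      intro a b hab
      induction b, hab using Nat.le_induction with
      | base => rfl
      | succ b _ ih =>
        rw [prod_range_succ]
        exact ih.trans (le_mul_of_one_le_right (prod_nonneg fun m _ => Nat.cast_nonneg _) (hge1 b))
    intro l
    induction l using Nat.strong_induction_on with
    | _ l ih =>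
      by_cases hl : l < m0
      · have h1 : |coeff l f| ≤ S := by
          have := single_le_sum (f := fun l => |coeff l f|) (fun _ _ => abs_nonneg _) (mem_range.2 hl)
          linarith
        exact h1.trans (le_mul_of_one_le_right (Nat.cast_nonneg _)
          (by simpa using hmono 0 (l + 1) (by omega)))
      · have hne := hv0 l (by omega)
        have h1 : (1 : ℚ) ≤ |(v 0 l : ℚ)| := by
          exact_mod_cast Int.one_le_abs hne
        calc |coeff l f| ≤ |(v 0 l : ℚ)| * |coeff l f| := le_mul_of_one_le_left (abs_nonneg _) h1
          _ = |∑ r ∈ range l, (v (l - r) r : ℚ) * coeff r f| := by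
              rw [← abs_mul, hrec', abs_neg]
          _ ≤ ∑ r ∈ range l, |(v (l - r) r : ℚ) * coeff r f| := abs_sum_le_sum_abs _ _
          _ ≤ ∑ r ∈ range l, (A * ((l : ℚ) + 1) ^ κ) *
                ((S : ℚ) * ∏ m ∈ range l, ((A * (m + 1) ^ (κ + 1) : ℕ) : ℚ)) := by
              refine sum_le_sum fun r hr => ?_
              rw [abs_mul]
              have hr' := mem_range.1 hr
              refine mul_le_mul ((hvb _ _).trans ?_) ((ih r hr').trans ?_) (abs_nonneg _) (by positivity)
              · have : (r : ℚ) ≤ l := by exact_mod_cast hr'.le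
                gcongr
              · exact mul_le_mul_of_nonneg_left (hmono _ _ hr') (Nat.cast_nonneg _)
          _ = (S : ℚ) * ((∏ m ∈ range l, ((A * (m + 1) ^ (κ + 1) : ℕ) : ℚ)) *
                (A * ((l : ℚ) + 1) ^ κ * l)) := by
              rw [sum_const, card_range, nsmul_eq_mul]; ring
          _ ≤ _ := by
              rw [prod_range_succ]
              refine mul_le_mul_of_nonneg_left (mul_le_mul_of_nonneg_left ?_
                (prod_nonneg fun m _ => Nat.cast_nonneg _)) (Nat.cast_nonneg _)
              push_cast
              rw [pow_succ, ← mul_assoc]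
              gcongr
              linarith
  -- conclusion
  have hfinal : ∀ B : ℕ, ∀ Z ≤ D0 * S, Z * ∏ m ∈ range (B + 1), A * (m + 1) ^ (κ + 1) ≤
      (D0 * S * (A * 2 ^ (κ + 1))) ^ (B + 1) * B.factorial ^ (κ + 1) := by
    intro B Z hZ
    rw [prod_range_mul_pow]
    have h1 : (B + 1).factorial ≤ 2 ^ (B + 1) * B.factorial := by
      rw [Nat.factorial_succ]
      exact Nat.mul_le_mul_right _ Nat.lt_two_pow_self.le
    have h2 : D0 * S ≤ (D0 * S) ^ (B + 1) := Nat.le_self_pow (Nat.succ_ne_zero B) _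
    calc Z * (A ^ (B + 1) * (B + 1).factorial ^ (κ + 1))
        ≤ (D0 * S) ^ (B + 1) * (A ^ (B + 1) * (2 ^ (B + 1) * B.factorial) ^ (κ + 1)) := by
          gcongr
          exact hZ.trans h2
      _ = _ := by rw [mul_pow, mul_pow, mul_pow, mul_pow, mul_pow, ← pow_mul, ← pow_mul, mul_comm (B + 1)]; ring
  refine ⟨D0 * S * (A * 2 ^ (κ + 1)), κ + 1, fun B => ⟨Dn B,
    Nat.mul_pos hD0 (prod_pos fun m _ => hw m), ?_, fun l hl => ⟨hInt B l hl, ?_⟩⟩⟩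
  · refine le_trans ?_ (hfinal B D0 (Nat.le_mul_of_pos_right _ hS1))
    exact Nat.mul_le_mul_left _ (prod_le_prod' fun m _ => hwb m)
  · have h2 : S * ∏ m ∈ range (l + 1), (A * (m + 1) ^ (κ + 1)) ≤
        S * ∏ m ∈ range (B + 1), (A * (m + 1) ^ (κ + 1)) :=
      Nat.mul_le_mul_left _ (prod_le_prod_of_subset_of_one_le' (range_mono (by omega))
        fun m _ _ => Nat.mul_pos hA (pow_pos (Nat.succ_pos m) _))
    have h3 := h2.trans (hfinal B S (Nat.le_mul_of_pos_left _ hD0))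
    refine (hsize l).trans ?_
    exact_mod_cast h3

end EDescent

namespace EDescent

open Finset PowerSeries

/-! ### Rational power series with the arithmetic growth of E-functions -/

/-- The `n`-th coefficient of a power series multiplied by `n!`. -/
def ecoeff (g : ℚ⟦X⟧) (n : ℕ) : ℚ := n.factorial * coeff n g

theorem coeff_eq_ecoeff_div (g : ℚ⟦X⟧) (n : ℕ) : coeff n g = ecoeff g n / n.factorial := by
  rw [ecoeff, mul_div_cancel_left₀]
  exact_mod_cast n.factorial_ne_zero

theorem ecoeff_add (g h : ℚ⟦X⟧) (n : ℕ) : ecoeff (g + h) n = ecoeff g n + ecoeff h n := by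
  simp [ecoeff, mul_add]

theorem ecoeff_mul (g h : ℚ⟦X⟧) (n : ℕ) :
    ecoeff (g * h) n = ∑ p ∈ antidiagonal n, (n.choose p.1 : ℚ) * (ecoeff g p.1 * ecoeff h p.2) := by
  rw [ecoeff, coeff_mul, mul_sum]
  refine sum_congr rfl fun p hp => ?_
  obtain rfl := mem_antidiagonal.1 hp
  have := Nat.choose_mul_factorial_mul_factorial (Nat.le_add_right p.1 p.2)
  rw [Nat.add_sub_cancel_left] at this
  have h2 : ((p.1 + p.2).factorial : ℚ) = (p.1 + p.2).choose p.1 * p.1.factorial * p.2.factorial := by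
    exact_mod_cast this.symm
  rw [h2, ecoeff, ecoeff]; ring

theorem ecoeff_derivative (g : ℚ⟦X⟧) (n : ℕ) : ecoeff (d⁄dX ℚ g) n = ecoeff g (n + 1) := by
  rw [ecoeff, ecoeff, coeff_derivative, Nat.factorial_succ]; push_cast; ring

/-- Rational power series `∑ aₙ/n! Xⁿ` for which `aₙ` and the common denominators of
`a₀, …, aₙ` grow at most geometrically. -/
def IsEQ (g : ℚ⟦X⟧) : Prop :=
  ∃ (C : ℕ) (d : ℕ → ℕ), 0 < C ∧ ∀ n, 0 < d n ∧ d n ≤ C ^ (n + 1) ∧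
    |ecoeff g n| ≤ (C : ℚ) ^ (n + 1) ∧ ∀ i ≤ n, ∃ z : ℤ, (d n : ℚ) * ecoeff g i = z

theorem IsEQ.add {g h : ℚ⟦X⟧} (hg : IsEQ g) (hh : IsEQ h) : IsEQ (g + h) := by
  obtain ⟨C, d, hC, H⟩ := hg
  obtain ⟨C', d', hC', H'⟩ := hh
  refine ⟨C * C' * 2, fun n => d n * d' n, by positivity, fun n => ?_⟩
  obtain ⟨h1, h2, h3, h4⟩ := H n
  obtain ⟨h1', h2', h3', h4'⟩ := H' n
  refine ⟨by positivity, ?_, ?_, fun i hi => ?_⟩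
  · calc d n * d' n ≤ C ^ (n + 1) * C' ^ (n + 1) := Nat.mul_le_mul h2 h2'
      _ ≤ C ^ (n + 1) * C' ^ (n + 1) * 2 ^ (n + 1) := Nat.le_mul_of_pos_right _ (by positivity)
      _ = _ := by rw [mul_pow, mul_pow]
  · have e1 : (1 : ℚ) ≤ (C : ℚ) ^ (n + 1) := one_le_pow₀ (by exact_mod_cast hC)
    have e2 : (1 : ℚ) ≤ (C' : ℚ) ^ (n + 1) := one_le_pow₀ (by exact_mod_cast hC')
    have e3 : (2 : ℚ) ≤ 2 ^ (n + 1) := le_self_pow₀ (by norm_num) (Nat.succ_ne_zero n)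
    rw [ecoeff_add]
    push_cast
    rw [mul_pow, mul_pow]
    calc |ecoeff g n + ecoeff h n| ≤ (C : ℚ) ^ (n + 1) + (C' : ℚ) ^ (n + 1) :=
          (abs_add_le _ _).trans (add_le_add h3 h3')
      _ ≤ (C : ℚ) ^ (n + 1) * (C' : ℚ) ^ (n + 1) * 2 := by nlinarith
      _ ≤ _ := by gcongr
  · obtain ⟨z, hz⟩ := h4 i hi
    obtain ⟨z', hz'⟩ := h4' i hi
    refine ⟨z * d' n + z' * d n, ?_⟩
    rw [ecoeff_add]; push_cast; rw [← hz, ← hz']; ring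

theorem IsEQ.mul {g h : ℚ⟦X⟧} (hg : IsEQ g) (hh : IsEQ h) : IsEQ (g * h) := by
  obtain ⟨C, d, hC, H⟩ := hg
  obtain ⟨C', d', hC', H'⟩ := hh
  refine ⟨C * C' * 2, fun n => d n * d' n, by positivity, fun n => ?_⟩
  obtain ⟨h1, h2, h3, h4⟩ := H n
  obtain ⟨h1', h2', h3', h4'⟩ := H' n
  refine ⟨by positivity, ?_, ?_, fun i hi => ?_⟩
  · calc d n * d' n ≤ C ^ (n + 1) * C' ^ (n + 1) := Nat.mul_le_mul h2 h2'
      _ ≤ C ^ (n + 1) * C' ^ (n + 1) * 2 ^ (n + 1) := Nat.le_mul_of_pos_right _ (by positivity)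
      _ = _ := by rw [mul_pow, mul_pow]
  · have e1 : (1 : ℚ) ≤ C := by exact_mod_cast hC
    have e2 : (1 : ℚ) ≤ C' := by exact_mod_cast hC'
    rw [ecoeff_mul]
    push_cast
    rw [mul_pow, mul_pow]
    calc |∑ p ∈ antidiagonal n, (n.choose p.1 : ℚ) * (ecoeff g p.1 * ecoeff h p.2)|
        ≤ ∑ p ∈ antidiagonal n, |(n.choose p.1 : ℚ) * (ecoeff g p.1 * ecoeff h p.2)| :=
          abs_sum_le_sum_abs _ _
      _ ≤ ∑ p ∈ antidiagonal n, (n.choose p.1 : ℚ) * ((C : ℚ) ^ (n + 1) * (C' : ℚ) ^ (n + 1)) := by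
          refine sum_le_sum fun p hp => ?_
          have hp' := mem_antidiagonal.1 hp
          rw [abs_mul, Nat.abs_cast, abs_mul]
          have b1 := (H p.1).2.2.1.trans (pow_le_pow_right₀ e1 (show p.1 + 1 ≤ n + 1 by omega))
          have b2 := (H' p.2).2.2.1.trans (pow_le_pow_right₀ e2 (show p.2 + 1 ≤ n + 1 by omega))
          gcongr
      _ = (C : ℚ) ^ (n + 1) * (C' : ℚ) ^ (n + 1) * 2 ^ n := by
          have : ∑ p ∈ antidiagonal n, (n.choose p.1 : ℚ) = 2 ^ n := by
            have := Nat.sum_range_choose n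
            rw [Finset.Nat.sum_antidiagonal_eq_sum_range_succ (fun a _ => (n.choose a : ℚ))]
            exact_mod_cast this
          rw [← sum_mul, this]; ring
      _ ≤ _ := by
          gcongr
          · norm_num
          · omega
  · have : ∀ p ∈ antidiagonal i, ∃ z : ℤ,
        ((d n * d' n : ℕ) : ℚ) * ((i.choose p.1 : ℚ) * (ecoeff g p.1 * ecoeff h p.2)) = z := by
      intro p hp
      have hp' := mem_antidiagonal.1 hp
      obtain ⟨z, hz⟩ := h4 p.1 (by omega)
      obtain ⟨z', hz'⟩ := h4' p.2 (by omega)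
      refine ⟨i.choose p.1 * (z * z'), ?_⟩
      push_cast; rw [← hz, ← hz']; ring
    choose! z hz using this
    refine ⟨∑ p ∈ antidiagonal i, z p, ?_⟩
    rw [ecoeff_mul, mul_sum, Int.cast_sum]
    exact sum_congr rfl hz

theorem IsEQ.derivative {g : ℚ⟦X⟧} (hg : IsEQ g) : IsEQ (d⁄dX ℚ g) := by
  obtain ⟨C, d, hC, H⟩ := hg
  have hC1 : 1 ≤ C := hC
  have hle : ∀ n, n + 2 ≤ 2 * (n + 1) := fun n => by omega
  refine ⟨C ^ 2, fun n => d (n + 1), by positivity, fun n => ?_⟩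
  obtain ⟨h1, h2, h3, h4⟩ := H (n + 1)
  refine ⟨h1, ?_, ?_, fun i hi => ?_⟩
  · rw [← pow_mul]; exact h2.trans (Nat.pow_le_pow_right hC (hle n))
  · rw [ecoeff_derivative]
    push_cast
    rw [← pow_mul]
    exact h3.trans (pow_le_pow_right₀ (by exact_mod_cast hC1) (hle n))
  · rw [ecoeff_derivative]; exact h4 (i + 1) (by omega)

theorem isEQ_C (a : ℚ) : IsEQ (C a) := by
  obtain ⟨A, hA⟩ := exists_nat_ge |a|
  have hz : ∀ i, ecoeff (C a) i = if i = 0 then a else 0 := by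
    intro i
    rw [ecoeff, coeff_C]
    split_ifs with h
    · subst h; simp
    · simp
  have hpos : 0 < a.den * (A + 1) := Nat.mul_pos a.den_pos (Nat.succ_pos A)
  refine ⟨a.den * (A + 1), fun _ => a.den, hpos, fun n =>
    ⟨a.den_pos, ?_, ?_, fun i _ => ?_⟩⟩
  · exact (Nat.le_mul_of_pos_right _ (Nat.succ_pos A)).trans (Nat.le_self_pow (Nat.succ_ne_zero n) _)
  · have h1 : |a| ≤ ((a.den * (A + 1) : ℕ) : ℚ) := by
      have : (1 : ℚ) ≤ a.den := by exact_mod_cast a.den_pos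
      push_cast
      nlinarith [abs_nonneg a]
    have h2 : ((a.den * (A + 1) : ℕ) : ℚ) ≤ ((a.den * (A + 1) : ℕ) : ℚ) ^ (n + 1) :=
      le_self_pow₀ (by exact_mod_cast hpos) (Nat.succ_ne_zero n)
    rw [hz]
    split_ifs
    · exact h1.trans h2
    · rw [abs_zero]; positivity
  · rw [hz]
    split_ifs
    · exact ⟨a.num, by rw [mul_comm]; exact Rat.mul_den_eq_num a⟩
    · exact ⟨0, by simp⟩

theorem isEQ_X : IsEQ (X : ℚ⟦X⟧) := by
  have hz : ∀ i, ecoeff X i = if i = 1 then 1 else 0 := by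
    intro i
    rw [ecoeff, coeff_X]
    split_ifs with h
    · subst h; simp
    · simp
  refine ⟨1, fun _ => 1, one_pos, fun n => ⟨one_pos, by simp, ?_, fun i _ => ?_⟩⟩
  · rw [hz]; split_ifs <;> simp
  · rw [hz]; split_ifs
    · exact ⟨1, by simp⟩
    · exact ⟨0, by simp⟩

/-- The ring of power series satisfying `IsEQ`. -/
def EQ : Subalgebra ℚ ℚ⟦X⟧ where
  carrier := {g | IsEQ g}
  add_mem' := IsEQ.add
  mul_mem' := IsEQ.mul
  algebraMap_mem' := isEQ_C

theorem coe_mem_EQ (p : Polynomial ℚ) : (p : ℚ⟦X⟧) ∈ EQ := by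
  induction p using Polynomial.induction_on' with
  | add p q hp hq => rw [Polynomial.coe_add]; exact EQ.add_mem hp hq
  | monomial n a =>
    rw [← Polynomial.C_mul_X_pow_eq_monomial, Polynomial.coe_mul, Polynomial.coe_pow,
      Polynomial.coe_C, Polynomial.coe_X]
    exact EQ.mul_mem (isEQ_C a) (EQ.pow_mem isEQ_X n)

theorem derivative_mem_EQ {g : ℚ⟦X⟧} (hg : g ∈ EQ) : d⁄dX ℚ g ∈ EQ := IsEQ.derivative hg

/-! ### Taylor expansion at `1` -/

theorem summable_choose_mul {g : ℚ⟦X⟧} (hg : g ∈ EQ) (l : ℕ) :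
    Summable fun j : ℕ => (j.choose l : ℂ) * ((coeff j g : ℚ) : ℂ) := by
  obtain ⟨C, d, hC, H⟩ := hg
  refine Summable.of_norm_bounded (g := fun j : ℕ => (C : ℝ) * ((2 * C : ℝ) ^ j / j.factorial))
    ((Real.summable_pow_div_factorial (2 * C : ℝ)).mul_left _) fun j => ?_
  have h1 : |((coeff j g : ℚ) : ℝ)| ≤ (C : ℝ) ^ (j + 1) / j.factorial := by
    have h2 : |coeff j g| ≤ (C : ℚ) ^ (j + 1) / j.factorial := by
      rw [coeff_eq_ecoeff_div, abs_div, Nat.abs_cast]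
      have := (H j).2.2.1
      gcongr
    have h5 : ((|coeff j g| : ℚ) : ℝ) ≤ (((C : ℚ) ^ (j + 1) / j.factorial : ℚ) : ℝ) := Rat.cast_le.2 h2
    rw [Rat.cast_abs] at h5
    refine h5.trans (le_of_eq ?_)
    push_cast; rfl
  have h3 : ‖((coeff j g : ℚ) : ℂ)‖ = |((coeff j g : ℚ) : ℝ)| := by
    rw [show ((coeff j g : ℚ) : ℂ) = (((coeff j g : ℚ) : ℝ) : ℂ) by push_cast; rfl,
      Complex.norm_real, Real.norm_eq_abs]
  rw [norm_mul, h3, Complex.norm_natCast]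
  have h4 : (j.choose l : ℝ) ≤ 2 ^ j := by exact_mod_cast Nat.choose_le_two_pow j l
  calc (j.choose l : ℝ) * |((coeff j g : ℚ) : ℝ)| ≤ 2 ^ j * ((C : ℝ) ^ (j + 1) / j.factorial) := by gcongr
    _ = _ := by rw [mul_pow, pow_succ]; ring

/-- The formal Taylor expansion at `1` of an entire power series. -/
def taylorOne (g : ℚ⟦X⟧) : ℂ⟦X⟧ := mk fun l => ∑' j : ℕ, (j.choose l : ℂ) * ((coeff j g : ℚ) : ℂ)

theorem coeff_taylorOne (g : ℚ⟦X⟧) (l : ℕ) :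
    coeff l (taylorOne g) = ∑' j : ℕ, (j.choose l : ℂ) * ((coeff j g : ℚ) : ℂ) := coeff_mk _ _

theorem taylorOne_add {g h : ℚ⟦X⟧} (hg : g ∈ EQ) (hh : h ∈ EQ) :
    taylorOne (g + h) = taylorOne g + taylorOne h := by
  ext l
  rw [map_add, coeff_taylorOne, coeff_taylorOne, coeff_taylorOne,
    ← (summable_choose_mul hg l).tsum_add (summable_choose_mul hh l)]
  refine tsum_congr fun j => ?_
  rw [map_add]; push_cast; ring

theorem taylorOne_C_mul (a : ℚ) (g : ℚ⟦X⟧) : taylorOne (C a * g) = C (a : ℂ) * taylorOne g := by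
  ext l
  rw [coeff_C_mul, coeff_taylorOne, coeff_taylorOne, ← tsum_mul_left]
  refine tsum_congr fun j => ?_
  rw [coeff_C_mul]; push_cast; ring

theorem taylorOne_derivative {g : ℚ⟦X⟧} (hg : g ∈ EQ) :
    taylorOne (d⁄dX ℚ g) = d⁄dX ℂ (taylorOne g) := by
  ext l
  rw [coeff_derivative, coeff_taylorOne, coeff_taylorOne,
    (summable_choose_mul hg (l + 1)).tsum_eq_zero_add]
  rw [Nat.choose_zero_succ, Nat.cast_zero, zero_mul, zero_add, ← tsum_mul_right]
  refine tsum_congr fun j => ?_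
  rw [coeff_derivative]
  have : ((j + 1 : ℕ) : ℂ) * (j.choose l : ℂ) = ((j + 1).choose (l + 1) : ℂ) * ((l + 1 : ℕ) : ℂ) := by
    exact_mod_cast Nat.add_one_mul_choose_eq j l
  push_cast at this ⊢
  linear_combination ((coeff (j + 1) g : ℚ) : ℂ) * this

theorem taylorOne_X_mul {g : ℚ⟦X⟧} (hg : g ∈ EQ) :
    taylorOne (X * g) = (1 + X) * taylorOne g := by
  have hXg : X * g ∈ EQ := EQ.mul_mem isEQ_X hg
  ext l
  rw [add_mul, one_mul, map_add, coeff_taylorOne, coeff_taylorOne,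
    (summable_choose_mul hXg l).tsum_eq_zero_add]
  have h0 : coeff 0 (X * g) = 0 := by simp
  rw [h0, Rat.cast_zero, mul_zero, zero_add]
  cases l with
  | zero =>
    rw [coeff_zero_X_mul, add_zero]
    refine tsum_congr fun j => ?_
    rw [coeff_succ_X_mul]; simp
  | succ l =>
    rw [coeff_succ_X_mul, coeff_taylorOne,
      ← (summable_choose_mul hg (l + 1)).tsum_add (summable_choose_mul hg l)]
    refine tsum_congr fun j => ?_
    rw [coeff_succ_X_mul, Nat.choose_succ_succ]; push_cast; ring

variable {K : Type*} [Field K] in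
/-- The embedding of polynomials into power series centred at `z₀`. -/
def tau (z0 : K) : Polynomial K →+* K⟦X⟧ :=
  Polynomial.coeToPowerSeries.ringHom.comp (Polynomial.taylorAlgHom z0 : Polynomial K →+* Polynomial K)

section tau
variable {K : Type*} [Field K]

theorem tau_apply (z0 : K) (p : Polynomial K) :
    tau z0 p = ((Polynomial.taylor z0 p : Polynomial K) : K⟦X⟧) := rfl

theorem tau_injective (z0 : K) : Function.Injective (tau z0) := by
  intro p q h
  rw [tau_apply, tau_apply, Polynomial.coe_inj] at h
  exact Polynomial.taylor_injective z0 h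

theorem tau_C (z0 a : K) : tau z0 (Polynomial.C a) = C a := by
  rw [tau_apply, Polynomial.taylor_C, Polynomial.coe_C]

theorem tau_X (z0 : K) : tau z0 Polynomial.X = X + C z0 := by
  rw [tau_apply, Polynomial.taylor_X, Polynomial.coe_add, Polynomial.coe_X, Polynomial.coe_C]

theorem tau_zero_apply (p : Polynomial K) : tau 0 p = (p : K⟦X⟧) := by
  rw [tau_apply, Polynomial.taylor_zero]

theorem derivative_tau (z0 : K) (p : Polynomial K) :
    d⁄dX K (tau z0 p) = tau z0 (Polynomial.derivative p) := by
  rw [tau_apply, tau_apply, derivative_coe]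
  congr 1
  simp [Polynomial.taylor_apply, Polynomial.derivative_comp]

end tau

theorem taylorOne_coe_mul (p : Polynomial ℚ) {g : ℚ⟦X⟧} (hg : g ∈ EQ) :
    taylorOne ((p : ℚ⟦X⟧) * g) = PowerSeries.map (algebraMap ℚ ℂ) (tau 1 p) * taylorOne g := by
  induction p using Polynomial.induction_on with
  | C a => simp [tau_C, taylorOne_C_mul]
  | add p q hp hq =>
    rw [Polynomial.coe_add, add_mul, taylorOne_add (EQ.mul_mem (coe_mem_EQ p) hg)
      (EQ.mul_mem (coe_mem_EQ q) hg), hp, hq, map_add, map_add, add_mul]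
  | monomial n a h =>
    have h1 : ((Polynomial.C a * Polynomial.X ^ (n + 1) : Polynomial ℚ) : ℚ⟦X⟧) * g =
        X * (((Polynomial.C a * Polynomial.X ^ n : Polynomial ℚ) : ℚ⟦X⟧) * g) := by
      simp only [Polynomial.coe_mul, Polynomial.coe_pow, Polynomial.coe_C, Polynomial.coe_X]; ring
    have h2 : (Polynomial.C a * Polynomial.X ^ (n + 1) : Polynomial ℚ) =
        (Polynomial.C a * Polynomial.X ^ n) * Polynomial.X := by ring
    have h3 : PowerSeries.map (algebraMap ℚ ℂ) (tau (1 : ℚ) Polynomial.X) = 1 + X := by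
      rw [tau_X, map_add, PowerSeries.map_X, PowerSeries.map_C, map_one, map_one, add_comm]
    rw [h1, taylorOne_X_mul (EQ.mul_mem (coe_mem_EQ _) hg), h, h2, map_mul (tau (1 : ℚ)) _ Polynomial.X,
      map_mul (PowerSeries.map (algebraMap ℚ ℂ)) _ (tau (1 : ℚ) Polynomial.X), h3]
    ring

theorem taylorOne_sum {ι : Type*} (s : Finset ι) (g : ι → ℚ⟦X⟧) (hg : ∀ i ∈ s, g i ∈ EQ) :
    taylorOne (∑ i ∈ s, g i) = ∑ i ∈ s, taylorOne (g i) := by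
  classical
  induction s using Finset.induction_on with
  | empty =>
    ext l; simp [coeff_taylorOne]
  | insert a s ha ih =>
    rw [sum_insert ha, sum_insert ha, taylorOne_add (hg a (mem_insert_self a s))
      (EQ.sum_mem fun i hi => hg i (mem_insert_of_mem hi)), ih fun i hi => hg i (mem_insert_of_mem hi)]

end EDescent

namespace EDescent

open Finset PowerSeries

/-! ### Minors -/

theorem exists_minor_ne_zero_of_field {F : Type*} [Field F] {r : ℕ} {ι : Type*} [Fintype ι]
    (A : Matrix (Fin r) ι F) (hA : LinearIndependent F A.row) :
    ∃ s : Fin r → ι, (A.submatrix id s).det ≠ 0 := by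
  have hr : Module.finrank F (Submodule.span F (Set.range A.col)) = r := by
    rw [← Matrix.rank_eq_finrank_span_cols, hA.rank_matrix, Fintype.card_fin]
  obtain ⟨f, hf, -, hli⟩ := Submodule.exists_fun_fin_finrank_span_eq F (Set.range A.col)
  choose s hs using hf
  refine ⟨fun i => s (Fin.cast hr.symm i), fun h0 => ?_⟩
  have h1 : LinearIndependent F (A.submatrix id fun i => s (Fin.cast hr.symm i)).col := by
    have h2 := hli.comp (Fin.cast hr.symm) (Fin.cast_injective _)
    have h4 : (A.submatrix id fun i => s (Fin.cast hr.symm i)).col = f ∘ Fin.cast hr.symm :=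
      funext fun i => hs _
    rw [h4]
    exact h2
  have h3 := Matrix.linearIndependent_cols_iff_isUnit.1 h1
  rw [Matrix.isUnit_iff_isUnit_det, h0] at h3
  exact not_isUnit_zero h3

theorem exists_minor_ne_zero {R : Type*} [CommRing R] [IsDomain R] {r : ℕ} {ι : Type*} [Fintype ι]
    (A : Matrix (Fin r) ι R) (hA : LinearIndependent R A.row) :
    ∃ s : Fin r → ι, (A.submatrix id s).det ≠ 0 := by
  let F := FractionRing R
  have h1 : LinearIndependent F (A.map (algebraMap R F)).row := by
    have h2 : LinearIndependent R (A.map (algebraMap R F)).row := by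
      rw [Fintype.linearIndependent_iff] at hA ⊢
      intro g hg
      refine hA g ?_
      funext j
      have := congrFun hg j
      simp only [Finset.sum_apply, Matrix.row, Pi.zero_apply, Algebra.smul_def] at this ⊢
      apply IsFractionRing.injective R F
      simpa [map_sum, map_mul] using this
    exact (LinearIndependent.iff_fractionRing R F).1 h2
  obtain ⟨s, hs⟩ := exists_minor_ne_zero_of_field _ h1
  refine ⟨s, fun h => hs ?_⟩
  have := congrArg (algebraMap R F) h
  rw [RingHom.map_det, map_zero] at this
  exact this

/-! ### The adjoint operator of a linear differential system -/

variable {H : ℕ}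

/-- The operator on linear forms adjoint to the differential system `T • dy/dX = B y`: it sends `P` to the
form whose value at a solution is `T` times the derivative of the value of `P`. -/
def sysOp (T : Polynomial ℚ) (B : Matrix (Fin H) (Fin H) (Polynomial ℚ))
    (P : Fin H → Polynomial ℚ) : Fin H → Polynomial ℚ :=
  fun j => T * Polynomial.derivative (P j) + ∑ i, P i * B i j

/-- Evaluation of a linear form with polynomial coefficients. -/
def pairing {R : Type*} [CommRing R] (t : Polynomial ℚ →+* R) (P : Fin H → Polynomial ℚ)
    (y : Fin H → R) : R := ∑ j, t (P j) * y j

section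
variable {R : Type*} [CommRing R] (t : Polynomial ℚ →+* R) (d : R →+ R)

theorem pairing_sysOp
    (hl : ∀ a b, d (a * b) = a * d b + b * d a)
    (hd : ∀ p, d (t p) = t (Polynomial.derivative p)) (T : Polynomial ℚ)
    (B : Matrix (Fin H) (Fin H) (Polynomial ℚ)) (y : Fin H → R)
    (hy : ∀ i, t T * d (y i) = ∑ j, t (B i j) * y j) (P : Fin H → Polynomial ℚ) :
    pairing t (sysOp T B P) y = t T * d (pairing t P y) := by
  simp only [pairing, sysOp, map_add, map_sum, map_mul, hl, hd, add_mul,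
    sum_add_distrib, mul_add]
  rw [add_comm]
  congr 1
  · simp only [sum_mul, mul_sum]
    rw [sum_comm]
    refine sum_congr rfl fun i _ => ?_
    rw [mul_left_comm, hy i, mul_sum]
    exact sum_congr rfl fun j _ => by ring
  · rw [mul_sum]
    exact sum_congr rfl fun j _ => by ring

theorem pairing_sysOp_iterate
    (hl : ∀ a b, d (a * b) = a * d b + b * d a)
    (hd : ∀ p, d (t p) = t (Polynomial.derivative p)) (T : Polynomial ℚ)
    (B : Matrix (Fin H) (Fin H) (Polynomial ℚ)) (y : Fin H → R)
    (hy : ∀ i, t T * d (y i) = ∑ j, t (B i j) * y j) (P : Fin H → Polynomial ℚ) (n : ℕ) :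
    pairing t ((sysOp T B)^[n] P) y = (fun r => t T * d r)^[n] (pairing t P y) := by
  induction n with
  | zero => rfl
  | succ n ih =>
    rw [Function.iterate_succ_apply', Function.iterate_succ_apply', pairing_sysOp t d hl hd T B y hy, ih]

end

theorem X_pow_dvd_mul_derivative {K : Type*} [CommRing K] (u f : K⟦X⟧) (m : ℕ) (h : X ^ (m + 1) ∣ f) :
    X ^ m ∣ u * d⁄dX K f := by
  refine Dvd.dvd.mul_left ?_ u
  rw [X_pow_dvd_iff] at h ⊢
  intro i hi
  rw [coeff_derivative, h (i + 1) (by omega), zero_mul]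

theorem X_pow_dvd_iterate {K : Type*} [CommRing K] (u f : K⟦X⟧) (m n : ℕ) (h : X ^ (m + n) ∣ f) :
    X ^ m ∣ (fun r => u * d⁄dX K r)^[n] f := by
  induction n generalizing m with
  | zero => exact h
  | succ n ih =>
    rw [Function.iterate_succ_apply']
    exact X_pow_dvd_mul_derivative u _ m (ih (m + 1) (by rwa [add_right_comm]))

/-- Iterates of the system operator on a linear form, as rows of a matrix. -/
def iterMatrix (T : Polynomial ℚ) (B : Matrix (Fin H) (Fin H) (Polynomial ℚ))
    (P : Fin H → Polynomial ℚ) (r : ℕ) : Matrix (Fin r) (Fin H) (Polynomial ℚ) :=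
  Matrix.of fun j i => (sysOp T B)^[j] P i

theorem mulVec_iterMatrix {R : Type*} [CommRing R] (t : Polynomial ℚ →+* R) (T : Polynomial ℚ)
    (B : Matrix (Fin H) (Fin H) (Polynomial ℚ)) (P : Fin H → Polynomial ℚ) (r : ℕ) (y : Fin H → R)
    (j : Fin r) :
    ((iterMatrix T B P r).map t).mulVec y j = pairing t ((sysOp T B)^[j] P) y := rfl

theorem dvd_det_mul {R ι : Type*} [CommRing R] [Fintype ι] [DecidableEq ι] (A : Matrix ι ι R)
    (y : ι → R) (a : R) (h : ∀ i, a ∣ A.mulVec y i) (i : ι) : a ∣ A.det * y i := by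
  have h1 : A.adjugate.mulVec (A.mulVec y) = A.det • y := by
    rw [Matrix.mulVec_mulVec, Matrix.adjugate_mul, Matrix.smul_mulVec, Matrix.one_mulVec]
  have h2 := congrFun h1 i
  rw [Pi.smul_apply, smul_eq_mul] at h2
  rw [← h2]
  exact dvd_sum fun j _ => (h j).mul_left _

/-! ### Degrees -/

theorem natDegree_det_le {ι : Type*} [Fintype ι] [DecidableEq ι] (A : Matrix ι ι (Polynomial ℚ)) (e : ℕ)
    (h : ∀ i j, (A i j).natDegree ≤ e) : A.det.natDegree ≤ Fintype.card ι * e := by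
  rw [Matrix.det_apply]
  refine Polynomial.natDegree_sum_le_of_forall_le _ _ fun s _ => ?_
  refine (Polynomial.natDegree_smul_le _ _).trans ((Polynomial.natDegree_prod_le _ _).trans ?_)
  calc ∑ i, (A (s i) i).natDegree ≤ ∑ _i : ι, e := sum_le_sum fun i _ => h _ _
    _ = _ := by simp

theorem exists_natDegree_sysOp_le (T : Polynomial ℚ) (B : Matrix (Fin H) (Fin H) (Polynomial ℚ)) :
    ∃ w : ℕ, ∀ (P : Fin H → Polynomial ℚ) (n : ℕ), (∀ i, (P i).natDegree ≤ n) →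
      ∀ j i, ((sysOp T B)^[j] P i).natDegree ≤ n + j * w := by
  refine ⟨T.natDegree + ∑ i, ∑ j, (B i j).natDegree, fun P n hP j => ?_⟩
  set w := T.natDegree + ∑ i, ∑ j, (B i j).natDegree with hw
  induction j with
  | zero => simpa using hP
  | succ j ih =>
    intro i
    rw [Function.iterate_succ_apply', sysOp]
    refine Polynomial.natDegree_add_le_of_degree_le ?_ ?_
    · refine Polynomial.natDegree_mul_le.trans ?_
      have h1 := (Polynomial.natDegree_derivative_le ((sysOp T B)^[j] P i)).trans (Nat.sub_le _ _)
      have h2 := ih i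
      have : T.natDegree ≤ w := by omega
      nlinarith
    · refine Polynomial.natDegree_sum_le_of_forall_le _ _ fun k _ => ?_
      refine Polynomial.natDegree_mul_le.trans ?_
      have h2 := ih k
      have h3 : (B k i).natDegree ≤ ∑ i, ∑ j, (B i j).natDegree :=
        (single_le_sum (f := fun j => (B k j).natDegree) (fun _ _ => Nat.zero_le _) (mem_univ i)).trans
          (single_le_sum (f := fun k => ∑ j, (B k j).natDegree) (fun _ _ => Nat.zero_le _) (mem_univ k))
      nlinarith

/-! ### Fundamental matrices -/

/-- Coefficients of the fundamental matrix of `Y' = A Y` normalised by `Y(0) = 1`. -/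
def fundCoeff {K : Type*} [Field K] (A : ℕ → Matrix (Fin H) (Fin H) K) : ℕ → Matrix (Fin H) (Fin H) K
  | 0 => 1
  | l + 1 => ((l : K) + 1)⁻¹ • ∑ i : Fin (l + 1), A (l - i) * fundCoeff A i

theorem exists_fundamental_matrix {K : Type*} [Field K] [CharZero K] (A : Matrix (Fin H) (Fin H) K⟦X⟧) :
    ∃ Y : Matrix (Fin H) (Fin H) K⟦X⟧, (∀ i j, d⁄dX K (Y i j) = ∑ k, A i k * Y k j) ∧ Y.det ≠ 0 := by
  let a : ℕ → Matrix (Fin H) (Fin H) K := fun l => Matrix.of fun i j => coeff l (A i j)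
  let Y : Matrix (Fin H) (Fin H) K⟦X⟧ := Matrix.of fun i j => mk fun l => fundCoeff a l i j
  have hY : ∀ l i j, coeff l (Y i j) = fundCoeff a l i j := fun l i j => by
    simp only [Y, Matrix.of_apply, coeff_mk]
  refine ⟨Y, fun i j => ?_, fun h => ?_⟩
  · ext l
    have h0 : (l : K) + 1 ≠ 0 := by exact_mod_cast l.succ_ne_zero
    rw [coeff_derivative, map_sum]
    simp only [coeff_mul]
    rw [hY, fundCoeff, Matrix.smul_apply, smul_eq_mul, mul_comm, mul_inv_cancel_left₀ h0,
      Fin.sum_univ_eq_sum_range (fun k => a (l - k) * fundCoeff a k) (l + 1), Matrix.sum_apply, sum_comm]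
    rw [Finset.Nat.sum_antidiagonal_eq_sum_range_succ_mk, ← sum_range_reflect]
    refine sum_congr rfl fun k hk => ?_
    have hk' := mem_range.1 hk
    rw [Matrix.mul_apply]
    refine sum_congr rfl fun m _ => ?_
    rw [show l - (l + 1 - 1 - k) = k by omega]
    rw [hY, show l - k = l + 1 - 1 - k by omega]
    rfl
  · have h1 : (Y.map (constantCoeff (R := K))).det = 0 := by
      have := congrArg (constantCoeff (R := K)) h
      rwa [RingHom.map_det, map_zero] at this
    have h2 : Y.map (constantCoeff (R := K)) = 1 := by
      ext i j
      rw [Matrix.map_apply, ← coeff_zero_eq_constantCoeff_apply, hY, fundCoeff]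
    rw [h2, Matrix.det_one] at h1
    exact one_ne_zero h1

end EDescent

namespace EDescent

open Finset PowerSeries

theorem exists_bounded_coordinates {F : Type*} [Field F] [Algebra ℚ F] (t : Polynomial ℚ →+* F)
    (ht : Function.Injective t) (V : Submodule ℚ F) (hV : V.FG) :
    ∃ c : ℕ, ∀ v ∈ V, v ≠ 0 → ∃ e : F → Polynomial ℚ, (∀ u ∈ V, (e u).natDegree ≤ c) ∧ e v ≠ 0 ∧
      ∀ u ∈ V, ∀ w ∈ V, ∀ a b, t a * u = t b * w → a * e u = b * e w := by
  let _ : Algebra (Polynomial ℚ) F := t.toAlgebra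
  obtain ⟨s, rfl⟩ := hV
  let N : Submodule (Polynomial ℚ) F := Submodule.span (Polynomial ℚ) (s : Set F)
  have hTF : Module.IsTorsionFree (Polynomial ℚ) F :=
    Module.IsTorsionFree.of_smul_eq_zero fun p x h => by
      rcases mul_eq_zero.1 (show t p * x = 0 from h) with h | h
      · exact Or.inl (ht (by rw [h, map_zero]))
      · exact Or.inr h
  have hsm : ∀ (q : ℚ) (x : F), q • x = (Polynomial.C q) • x := fun q x => by
    rw [Algebra.smul_def, Algebra.smul_def]
    congr 1
    exact (RingHom.congr_fun (RingHom.ext_rat (algebraMap ℚ F) (t.comp Polynomial.C)) q)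
  have hsub : ∀ u ∈ Submodule.span ℚ (s : Set F), u ∈ N := fun u hu => by
    induction hu using Submodule.span_induction with
    | mem x hx => exact Submodule.subset_span hx
    | zero => exact N.zero_mem
    | add x y _ _ hx hy => exact N.add_mem hx hy
    | smul q x _ hx => rw [hsm]; exact N.smul_mem _ hx
  have : Module.Finite (Polynomial ℚ) N := Module.Finite.iff_fg.2 ⟨s, rfl⟩
  let b := Module.Free.chooseBasis (Polynomial ℚ) N
  let e : Module.Free.ChooseBasisIndex (Polynomial ℚ) N → F → Polynomial ℚ := fun i u =>
    open Classical in if h : u ∈ N then b.repr ⟨u, h⟩ i else 0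
  have he : ∀ i u (h : u ∈ N), e i u = b.repr ⟨u, h⟩ i := fun i u h => dif_pos h
  refine ⟨∑ i, ∑ u ∈ s, (e i u).natDegree, fun v hv hv0 => ?_⟩
  have hvN := hsub v hv
  have : ∃ i, e i v ≠ 0 := by
    by_contra! hcon
    apply hv0
    have : b.repr ⟨v, hvN⟩ = 0 := Finsupp.ext fun i => by rw [← he, hcon i]; rfl
    rw [LinearEquiv.map_eq_zero_iff] at this
    exact congrArg Subtype.val this
  obtain ⟨i, hi⟩ := this
  refine ⟨e i, fun u hu => ?_, hi, fun u hu w hw p q h => ?_⟩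
  · induction hu using Submodule.span_induction with
    | mem x hx =>
      exact (single_le_sum (f := fun u => (e i u).natDegree) (fun _ _ => Nat.zero_le _) hx).trans
        (single_le_sum (f := fun i => ∑ u ∈ s, (e i u).natDegree) (fun _ _ => Nat.zero_le _) (mem_univ i))
    | zero =>
      rw [he i 0 N.zero_mem, show (⟨0, N.zero_mem⟩ : N) = 0 from rfl, map_zero]
      simp
    | add x y hx hy h1 h2 =>
      have hx := hsub x hx
      have hy := hsub y hy
      have : e i (x + y) = e i x + e i y := by
        rw [he i _ (N.add_mem hx hy), he i x hx, he i y hy, ← Finsupp.add_apply, ← map_add]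
        rfl
      rw [this]
      exact Polynomial.natDegree_add_le_of_degree_le h1 h2
    | smul q x hx h1 =>
      have hx := hsub x hx
      have : e i (q • x) = Polynomial.C q * e i x := by
        rw [hsm, he i _ (N.smul_mem _ hx), he i x hx, ← smul_eq_mul, ← Finsupp.smul_apply, ← map_smul]
        rfl
      rw [this]
      exact (Polynomial.natDegree_C_mul_le _ _).trans h1
  · have hu := hsub u hu
    have hw := hsub w hw
    rw [he i u hu, he i w hw, ← smul_eq_mul, ← smul_eq_mul, ← Finsupp.smul_apply, ← Finsupp.smul_apply,
      ← map_smul, ← map_smul]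
    rw [show p • (⟨u, hu⟩ : N) = q • (⟨w, hw⟩ : N) from Subtype.ext h]

theorem prod_mem_pow_card {k R ι : Type*} [CommRing k] [CommRing R] [Algebra k R] (V : Submodule k R)
    (s : Finset ι) (f : ι → R) (hf : ∀ i ∈ s, f i ∈ V) : ∏ i ∈ s, f i ∈ V ^ #s := by
  classical
  induction s using Finset.induction_on with
  | empty => rw [prod_empty, card_empty, pow_zero]; exact Submodule.one_le.1 le_rfl
  | insert a s ha ih =>
    rw [prod_insert ha, card_insert_of_notMem ha, pow_succ']
    exact Submodule.mul_mem_mul (hf a (mem_insert_self a s))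
      (ih fun i hi => hf i (mem_insert_of_mem hi))

theorem det_mem_pow_card {k R ι : Type*} [CommRing k] [CommRing R] [Algebra k R] [Fintype ι]
    [DecidableEq ι] (V : Submodule k R) (A : Matrix ι ι R) (hA : ∀ i j, A i j ∈ V) :
    A.det ∈ V ^ Fintype.card ι := by
  rw [Matrix.det_apply]
  refine Submodule.sum_mem _ fun s _ => ?_
  rw [Units.smul_def]
  exact zsmul_mem (prod_mem_pow_card V univ _ fun i _ => hA _ _) _

end EDescent

namespace EDescent

open Finset PowerSeries
variable {H : ℕ}

theorem exists_minor_factorization {F : Type*} [Field F] [Algebra ℚ F] (t : Polynomial ℚ →+* F)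
    (ht : Function.Injective t) (d : Derivation ℤ F F)
    (hconst : ∀ a, d a = 0 → a ∈ (algebraMap ℚ F).range)
    (hd : ∀ p, d (t p) = t (Polynomial.derivative p)) (T : Polynomial ℚ) (hT : T ≠ 0)
    (B : Matrix (Fin H) (Fin H) (Polynomial ℚ)) (Y : Matrix (Fin H) (Fin H) F) (hY0 : Y.det ≠ 0)
    (hY : ∀ i j, t T * d (Y i j) = ∑ k, t (B i k) * Y k j) (P : Fin H → Polynomial ℚ) (r : ℕ)
    (hM : LinearIndependent (Polynomial ℚ) (iterMatrix T B P r).row) (s : ℕ → Polynomial ℚ)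
    (hs0 : s r ≠ 0) (hs : ∑ j ∈ range (r + 1), s j • (sysOp T B)^[j] P = 0) :
    ∃ (π : F) (μ : (Fin r → Fin H) → F), π ≠ 0 ∧ ∀ f,
      μ f ∈ (Submodule.span ℚ (Set.range fun q : Fin H × Fin H => Y⁻¹ q.1 q.2)) ^ r ∧
      t ((iterMatrix T B P r).submatrix id f).det = π * μ f := by
  have htT : t T ≠ 0 := by rwa [Ne, _root_.map_eq_zero_iff _ ht]
  have htS : t (s r) ≠ 0 := by rwa [Ne, _root_.map_eq_zero_iff _ ht]
  set M := iterMatrix T B P r with hMdef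
  set p : Matrix (Fin r) (Fin H) F := M.map t * Y with hp
  let q : ℕ → Fin H → F := fun j l => pairing t ((sysOp T B)^[j] P) fun k => Y k l
  have hpq : ∀ j l, p j l = q j l := fun j l => rfl
  have hq : ∀ j l, t T * d (q j l) = q (j + 1) l := fun j l => by
    simp only [q]
    rw [Function.iterate_succ_apply', pairing_sysOp t (d : F →+ F) (d.leibniz) hd T B _ fun i => hY i l]
    rfl
  have hrel : ∀ l, ∑ j ∈ range (r + 1), t (s j) * q j l = 0 := fun l => by
    have h1 : ∀ k, ∑ j ∈ range (r + 1), t (s j) * t ((sysOp T B)^[j] P k) = 0 := fun k => by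
      have := congrArg t (congrFun hs k)
      simpa [Finset.sum_apply, map_sum] using this
    simp only [q, pairing, mul_sum]
    rw [sum_comm]
    refine sum_eq_zero fun k _ => ?_
    simp only [← mul_assoc]
    rw [← sum_mul, h1, zero_mul]
  have hN : ∀ j : Fin r, ∃ n : Fin r → F, ∀ l, d (p j l) = ∑ k, n k * p k l := by
    intro j
    by_cases hj : (j : ℕ) + 1 < r
    · refine ⟨fun k => if k = ⟨j + 1, hj⟩ then (t T)⁻¹ else 0, fun l => ?_⟩
      simp only [ite_mul, zero_mul, sum_ite_eq', mem_univ, if_true]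
      rw [hpq, hpq, ← hq, inv_mul_cancel_left₀ htT]
    · have hj' : (j : ℕ) + 1 = r := by have := j.2; omega
      refine ⟨fun k => -(t (s k)) / (t (s r) * t T), fun l => ?_⟩
      have h1 := hrel l
      rw [sum_range_succ, ← Fin.sum_univ_eq_sum_range (fun j => t (s j) * q j l)] at h1
      have h2 : t (s r) * t T * d (p j l) = ∑ k : Fin r, -(t (s k)) * p k l := by
        have := hq j l
        rw [hj'] at this
        rw [hpq, mul_assoc, this, eq_neg_of_add_eq_zero_right h1, ← sum_neg_distrib]
        exact sum_congr rfl fun k _ => by rw [hpq]; ring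
      have h3 : ∑ k : Fin r, -(t (s k)) / (t (s r) * t T) * p k l =
          (t (s r) * t T)⁻¹ * ∑ k : Fin r, -(t (s k)) * p k l := by
        rw [mul_sum]; exact sum_congr rfl fun k _ => by ring
      rw [h3, ← h2, inv_mul_cancel_left₀ (mul_ne_zero htS htT)]
  choose n hn using hN
  let N : Matrix (Fin r) (Fin r) F := Matrix.of n
  have hdp : p.map d = N * p := by
    ext j l; rw [Matrix.map_apply, hn, Matrix.mul_apply]; rfl
  have hYu : IsUnit Y.det := isUnit_iff_ne_zero.2 hY0
  have hMt : LinearIndependent F (M.map t).row := by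
    obtain ⟨f, hf⟩ := exists_minor_ne_zero M hM
    rw [Fintype.linearIndependent_iff]
    intro g hg
    have h1 : Matrix.vecMul g ((M.map t).submatrix id f) = 0 := by
      funext i
      have := congrFun hg (f i)
      simpa [Matrix.vecMul, dotProduct, Finset.sum_apply] using this
    have h2 : ((M.map t).submatrix id f).det ≠ 0 := by
      rw [show (M.map t).submatrix id f = t.mapMatrix (M.submatrix id f) from rfl, ← RingHom.map_det]
      rwa [Ne, _root_.map_eq_zero_iff _ ht]
    exact congrFun (Matrix.eq_zero_of_vecMul_eq_zero h2 h1)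
  have hpli : LinearIndependent F p.row := by
    rw [Fintype.linearIndependent_iff] at hMt ⊢
    intro g hg
    refine hMt g ?_
    have h1 : Matrix.vecMul g p = 0 := by
      rw [← hg]; funext i; simp [Matrix.vecMul, dotProduct, Finset.sum_apply]
    have h2 : Matrix.vecMul g (M.map t) = 0 := by
      have := congrArg (fun v => Matrix.vecMul v Y⁻¹) h1
      simpa [hp, Matrix.vecMul_vecMul, Matrix.mul_assoc, Matrix.mul_nonsing_inv _ hYu] using this
    rw [← h2]; funext i; simp [Matrix.vecMul, dotProduct, Finset.sum_apply]
  obtain ⟨J, hJ⟩ := exists_minor_ne_zero_of_field p hpli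
  set pJ := p.submatrix id J with hpJ
  have hJu : IsUnit pJ.det := isUnit_iff_ne_zero.2 hJ
  set c : Matrix (Fin r) (Fin H) F := pJ⁻¹ * p with hc
  have hpc : p = pJ * c := by rw [hc, ← Matrix.mul_assoc, Matrix.mul_nonsing_inv _ hJu, Matrix.one_mul]
  have hdc : ∀ i l, d (c i l) = 0 := by
    have h1 : pJ.map d = N * pJ := by
      have := congrArg (fun A => A.submatrix id J) hdp
      ext a b
      exact congrFun (congrFun this a) b
    have h2 : p.map d = pJ.map d * c + pJ * c.map d := by
      ext a b
      rw [hpc]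
      simp only [Matrix.map_apply, Matrix.mul_apply, Matrix.add_apply, map_sum, Derivation.leibniz,
        smul_eq_mul, sum_add_distrib]
      rw [add_comm]
      congr 1
      exact sum_congr rfl fun k _ => mul_comm _ _
    rw [hdp, h1, Matrix.mul_assoc, ← hpc, left_eq_add] at h2
    have h3 : c.map d = 0 := by
      have := congrArg (fun A => pJ⁻¹ * A) h2
      simpa [← Matrix.mul_assoc, Matrix.nonsing_inv_mul _ hJu] using this
    exact fun i l => congrFun (congrFun h3 i) l
  choose c0 hc0 using fun i l => hconst _ (hdc i l)
  have hMp : M.map t = pJ * (c * Y⁻¹) := by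
    rw [← Matrix.mul_assoc, ← hpc, hp, Matrix.mul_assoc, Matrix.mul_nonsing_inv _ hYu, Matrix.mul_one]
  refine ⟨pJ.det, fun f => ((c * Y⁻¹).submatrix id f).det, hJ, fun f => ⟨?_, ?_⟩⟩
  · have := det_mem_pow_card (Submodule.span ℚ (Set.range fun q : Fin H × Fin H => Y⁻¹ q.1 q.2))
      ((c * Y⁻¹).submatrix id f) fun i j => by
        rw [Matrix.submatrix_apply, Matrix.mul_apply]
        refine Submodule.sum_mem _ fun k _ => ?_
        rw [← hc0, ← Algebra.smul_def]
        exact Submodule.smul_mem _ _ (Submodule.subset_span ⟨(k, f j), rfl⟩)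
    rwa [Fintype.card_fin] at this
  · rw [← Matrix.det_mul, RingHom.map_det]
    congr 1
    have := congrArg (fun A => A.submatrix id f) hMp
    exact this

end EDescent

namespace EDescent

open Finset PowerSeries
variable {H : ℕ}

theorem X_pow_dvd_of_mul {K : Type*} [Field K] {a n : ℕ} {p f : K⟦X⟧} (hp : coeff n p ≠ 0)
    (h : X ^ (a + n) ∣ p * f) : X ^ a ∣ f := by
  rw [X_pow_dvd_iff] at h ⊢
  have h1 : ((a + n : ℕ) : ℕ∞) ≤ order (p * f) := nat_le_order _ _ h
  rw [order_mul] at h1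
  have h2 := order_le n hp
  have h3 : ((a : ℕ) : ℕ∞) ≤ order f := by
    by_contra! hlt
    have h4 : order p + order f < (n : ℕ∞) + a :=
      ENat.add_lt_add_of_le_of_lt (ne_top_of_le_ne_top (ENat.natCast_ne_top n) h2) h2 hlt
    rw [Nat.cast_add, add_comm] at h1
    exact absurd h1 (not_le.2 h4)
  exact fun m hm => coeff_of_lt_order m (lt_of_lt_of_le (by exact_mod_cast hm) h3)

theorem X_pow_dvd_of_polynomial_mul {a n : ℕ} {p : Polynomial ℚ} {f : ℚ⟦X⟧} (hp : p ≠ 0)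
    (hn : p.natDegree ≤ n) (h : X ^ (a + n) ∣ tau 0 p * f) : X ^ a ∣ f := by
  have h1 : coeff p.natDegree (tau 0 p) ≠ 0 := by
    rw [tau_zero_apply, Polynomial.coeff_coe, Polynomial.coeff_natDegree]
    exact Polynomial.leadingCoeff_ne_zero.2 hp
  exact X_pow_dvd_of_mul h1 ((pow_dvd_pow X (by omega)).trans h)

/-- The span of the products `X ^ k * G l` with `k ≤ c`. -/
def boundedSpan (G : Fin H → ℚ⟦X⟧) (c : ℕ) : Submodule ℚ ℚ⟦X⟧ :=
  Submodule.span ℚ (Set.range fun q : Fin (c + 1) × Fin H => X ^ (q.1 : ℕ) * G q.2)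

instance (G : Fin H → ℚ⟦X⟧) (c : ℕ) : FiniteDimensional ℚ (boundedSpan G c) :=
  FiniteDimensional.span_of_finite ℚ (Set.finite_range _)

theorem pairing_mem_boundedSpan (G : Fin H → ℚ⟦X⟧) (c : ℕ) (e : Fin H → Polynomial ℚ)
    (he : ∀ l, (e l).natDegree ≤ c) : pairing (tau 0) e G ∈ boundedSpan G c := by
  refine Submodule.sum_mem _ fun l _ => ?_
  rw [tau_zero_apply, (e l).as_sum_range' (c + 1) (by have := he l; omega)]
  rw [← Polynomial.coeToPowerSeries.ringHom_apply, map_sum, sum_mul]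
  refine Submodule.sum_mem _ fun k hk => ?_
  rw [Polynomial.coeToPowerSeries.ringHom_apply, ← Polynomial.C_mul_X_pow_eq_monomial,
    Polynomial.coe_mul, Polynomial.coe_C, Polynomial.coe_pow, Polynomial.coe_X, mul_assoc,
    ← PowerSeries.smul_eq_C_mul]
  exact Submodule.smul_mem _ _ (Submodule.subset_span ⟨(⟨k, mem_range.1 hk⟩, l), rfl⟩)

theorem exists_fundamental_solution (T : Polynomial ℚ) (hT : T ≠ 0)
    (B : Matrix (Fin H) (Fin H) (Polynomial ℚ)) :
    ∃ (z0 : ℚ) (Y : Matrix (Fin H) (Fin H) ℚ⟦X⟧), Y.det ≠ 0 ∧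
      ∀ i j, tau z0 T * d⁄dX ℚ (Y i j) = ∑ k, tau z0 (B i k) * Y k j := by
  obtain ⟨m, hm⟩ := exists_forall_eval_natCast_ne_zero T hT
  have h0 : constantCoeff (tau (m : ℚ) T) ≠ 0 := by
    rw [tau_apply, Polynomial.constantCoeff_coe, Polynomial.taylor_coeff_zero]
    exact hm m le_rfl
  obtain ⟨Y, hY, hY0⟩ := exists_fundamental_matrix
    (Matrix.of fun i k => (tau (m : ℚ) T)⁻¹ * tau (m : ℚ) (B i k))
  refine ⟨m, Y, hY0, fun i j => ?_⟩
  rw [hY, mul_sum]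
  refine sum_congr rfl fun k _ => ?_
  rw [Matrix.of_apply, ← mul_assoc, ← mul_assoc, PowerSeries.mul_inv_cancel _ h0, one_mul]

theorem X_pow_dvd_pairing_iterate {K : Type*} [Field K] (t : Polynomial ℚ →+* K⟦X⟧)
    (hd : ∀ p, d⁄dX K (t p) = t (Polynomial.derivative p)) (T : Polynomial ℚ)
    (B : Matrix (Fin H) (Fin H) (Polynomial ℚ)) (G : Fin H → K⟦X⟧)
    (hG : ∀ i, t T * d⁄dX K (G i) = ∑ j, t (B i j) * G j) (P : Fin H → Polynomial ℚ) (m r j : ℕ)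
    (hj : j ≤ r) (h : X ^ (m + r) ∣ pairing t P G) : X ^ m ∣ pairing t ((sysOp T B)^[j] P) G := by
  rw [pairing_sysOp_iterate t (d⁄dX K : K⟦X⟧ →+ K⟦X⟧) (d⁄dX K).leibniz hd T B G hG]
  exact X_pow_dvd_iterate _ _ m j ((pow_dvd_pow X (by omega)).trans h)

theorem exists_first_dependence (T : Polynomial ℚ) (B : Matrix (Fin H) (Fin H) (Polynomial ℚ))
    (P : Fin H → Polynomial ℚ) (hP : P ≠ 0) (hdet : (iterMatrix T B P H).det = 0) :
    ∃ r, 0 < r ∧ r < H ∧ LinearIndependent (Polynomial ℚ) (iterMatrix T B P r).row ∧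
      ∃ s : ℕ → Polynomial ℚ, s r ≠ 0 ∧ ∑ j ∈ range (r + 1), s j • (sysOp T B)^[j] P = 0 := by
  classical
  have hex : ∃ r, ¬ LinearIndependent (Polynomial ℚ) (iterMatrix T B P r).row := by
    refine ⟨H, fun h => ?_⟩
    obtain ⟨v, hv, hv0⟩ := Matrix.exists_vecMul_eq_zero_iff.2 hdet
    rw [Fintype.linearIndependent_iff] at h
    refine hv (funext (h v ?_))
    rw [← hv0]; funext i; simp [Matrix.vecMul, dotProduct, Finset.sum_apply]
  have hle : Nat.find hex ≤ H := Nat.find_min' hex <| by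
    intro h
    obtain ⟨v, hv, hv0⟩ := Matrix.exists_vecMul_eq_zero_iff.2 hdet
    rw [Fintype.linearIndependent_iff] at h
    refine hv (funext (h v ?_))
    rw [← hv0]; funext i; simp [Matrix.vecMul, dotProduct, Finset.sum_apply]
  have hspec := Nat.find_spec hex
  have hmin : ∀ m < Nat.find hex, LinearIndependent (Polynomial ℚ) (iterMatrix T B P m).row :=
    fun m hm => not_not.1 (Nat.find_min hex hm)
  obtain ⟨r, hr⟩ : ∃ r, Nat.find hex = r + 1 := by
    refine Nat.exists_eq_succ_of_ne_zero fun h0 => ?_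
    rw [h0] at hspec
    exact hspec linearIndependent_empty_type
  rw [hr] at hspec hle hmin
  have hrel : ∃ s : ℕ → Polynomial ℚ, (∃ j ≤ r, s j ≠ 0) ∧
      ∑ j ∈ range (r + 1), s j • (sysOp T B)^[j] P = 0 := by
    rw [Fintype.not_linearIndependent_iff] at hspec
    obtain ⟨g, hg, i, hi⟩ := hspec
    refine ⟨fun j => if h : j < r + 1 then g ⟨j, h⟩ else 0, ⟨i, by have := i.2; omega, ?_⟩, ?_⟩
    · simp only [dif_pos i.2]; exact hi
    · rw [← Fin.sum_univ_eq_sum_range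
        (fun j => (if h : j < r + 1 then g ⟨j, h⟩ else 0) • (sysOp T B)^[j] P), ← hg]
      exact sum_congr rfl fun j _ => by rw [dif_pos j.2]; rfl
  have hli := hmin r (by omega)
  obtain ⟨s, ⟨j, hj, hsj⟩, hs⟩ := hrel
  have hsr : s r ≠ 0 := by
    intro h0
    rw [sum_range_succ, h0, zero_smul, add_zero,
      ← Fin.sum_univ_eq_sum_range (fun j => s j • (sysOp T B)^[j] P)] at hs
    rw [Fintype.linearIndependent_iff] at hli
    have hjr : j < r := lt_of_le_of_ne hj fun h => hsj (h ▸ h0)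
    exact hsj (hli (fun j => s j) hs ⟨j, hjr⟩)
  refine ⟨r, Nat.pos_of_ne_zero fun h0 => hP ?_, by omega, hli, s, hsr, hs⟩
  subst h0
  simp only [zero_add, range_one, sum_singleton, Function.iterate_zero, id] at hs
  exact (smul_eq_zero.1 hs).resolve_left hsr

/-- A linear form in a differential system whose iterates are dependent cannot vanish to high order. -/
theorem exists_order_bound_of_det_eq_zero (T : Polynomial ℚ) (hT : T ≠ 0)
    (B : Matrix (Fin H) (Fin H) (Polynomial ℚ)) (G : Fin H → ℚ⟦X⟧)
    (hG : ∀ i, tau 0 T * d⁄dX ℚ (G i) = ∑ j, tau 0 (B i j) * G j)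
    (hli : ∀ P : Fin H → Polynomial ℚ, pairing (tau 0) P G = 0 → P = 0) :
    ∃ c0 : ℕ, ∀ (n : ℕ) (P : Fin H → Polynomial ℚ), (∀ i, (P i).natDegree ≤ n) → P ≠ 0 →
      (iterMatrix T B P H).det = 0 → ¬ X ^ ((H - 1) * n + c0) ∣ pairing (tau 0) P G := by
  obtain ⟨z0, Y0, hY0, hYeq⟩ := exists_fundamental_solution T hT B
  let t : Polynomial ℚ →+* LS ℚ := (LS.ofPS ℚ).comp (tau z0)
  have ht : Function.Injective t := (LS.ofPS_injective).comp (tau_injective z0)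
  have hd : ∀ p, lsDeriv ℚ (t p) = t (Polynomial.derivative p) := fun p => by
    simp only [t, RingHom.comp_apply]
    rw [lsDeriv_ofPS, derivative_tau]
  let Y : Matrix (Fin H) (Fin H) (LS ℚ) := Y0.map (LS.ofPS ℚ)
  have hYdet : Y.det ≠ 0 := by
    rw [show Y = (LS.ofPS ℚ).mapMatrix Y0 from rfl, ← RingHom.map_det]
    rwa [Ne, _root_.map_eq_zero_iff _ (LS.ofPS_injective)]
  have hY : ∀ i j, t T * lsDeriv ℚ (Y i j) = ∑ k, t (B i k) * Y k j := fun i j => by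
    have := congrArg (LS.ofPS ℚ) (hYeq i j)
    rw [map_mul, map_sum, ← lsDeriv_ofPS] at this
    simp only [map_mul] at this
    exact this
  set V := Submodule.span ℚ (Set.range fun q : Fin H × Fin H => Y⁻¹ q.1 q.2) with hV
  have hVfg : ∀ r, (V ^ r).FG := fun r =>
    Submodule.FG.pow (Submodule.fg_span (Set.finite_range _)) r
  choose c hc using fun r => exists_bounded_coordinates t ht (V ^ r) (hVfg r)
  obtain ⟨o, ho⟩ := exists_order_bound (boundedSpan G (∑ r ∈ range H, c r))
  obtain ⟨w, hw⟩ := exists_natDegree_sysOp_le T B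
  refine ⟨H + H * (H * w) + o, fun n P hPn hP0 hdet hdvd => ?_⟩
  obtain ⟨r, hr0, hrH, hM, s, hsr, hs⟩ := exists_first_dependence T B P hP0 hdet
  obtain ⟨π, μ, hπ, hμ⟩ := exists_minor_factorization t ht (lsDeriv ℚ) lsDeriv_eq_zero hd T hT B Y
    hYdet hY P r hM s hsr hs
  obtain ⟨I, hI⟩ := exists_minor_ne_zero _ hM
  set M := iterMatrix T B P r with hMdef
  have hμI : μ I ≠ 0 := fun h => by
    have := (hμ I).2
    rw [h, mul_zero, _root_.map_eq_zero_iff _ ht] at this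
    exact hI this
  obtain ⟨e, he1, he2, he3⟩ := hc r (μ I) (hμ I).1 hμI
  let i0 : Fin r := ⟨0, hr0⟩
  let m : Fin H → Polynomial ℚ := fun l => (M.submatrix id (Function.update I i0 l)).det
  let ε : Fin H → Polynomial ℚ := fun l => e (μ (Function.update I i0 l))
  have hrel : ∀ l, e (μ I) * m l = (M.submatrix id I).det * ε l := fun l => by
    rw [mul_comm]
    refine (he3 _ (hμ I).1 _ (hμ _).1 _ _ ?_)
    rw [(hμ _).2, (hμ _).2]; ring
  -- `ε` has bounded degree and is nonzero
  have hεdeg : ∀ l, (ε l).natDegree ≤ ∑ r ∈ range H, c r := fun l =>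
    (he1 _ (hμ _).1).trans (single_le_sum (f := c) (fun _ _ => Nat.zero_le _) (mem_range.2 hrH))
  have hε0 : ε (I i0) ≠ 0 := by
    simp only [ε, Function.update_eq_self]; exact he2
  have hdeg : ∀ j i, (M j i).natDegree ≤ n + H * w := fun j i =>
    (hw P n hPn j i).trans (by have := j.2; gcongr; omega)
  have hdetdeg : (M.submatrix id I).det.natDegree ≤ (H - 1) * n + H * (H * w) := by
    refine (natDegree_det_le _ (n + H * w) fun i j => hdeg _ _).trans ?_
    rw [Fintype.card_fin, mul_add]
    have : r ≤ H - 1 := by omega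
    gcongr
  have hsum : X ^ (o + ((H - 1) * n + H * (H * w))) ∣ pairing (tau 0) m G := by
    have h1 : pairing (tau 0) m G =
        Matrix.cramer ((M.submatrix id I).map (tau 0)) ((M.map (tau 0)).mulVec G) i0 := by
      have h2 : (M.map (tau 0)).mulVec G = ∑ l, G l • fun j => tau 0 (M j l) := by
        funext j
        simp [Matrix.mulVec, dotProduct, Finset.sum_apply, mul_comm]
      rw [h2, map_sum, Finset.sum_apply]
      refine sum_congr rfl fun l _ => ?_
      rw [map_smul, Pi.smul_apply, smul_eq_mul, mul_comm, Matrix.cramer_apply, RingHom.map_det]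
      congr 2
      ext a b
      by_cases hb : b = i0
      · subst hb; simp
      · simp [hb]
    rw [h1, Matrix.cramer_eq_adjugate_mulVec]
    rw [Matrix.mulVec, dotProduct]
    refine dvd_sum fun j _ => Dvd.dvd.mul_left ?_ _
    refine X_pow_dvd_pairing_iterate (tau 0) (derivative_tau 0) T B G hG P _ H j (by have := j.2; omega) ?_
    convert hdvd using 2
    ring
  have hfin : X ^ o ∣ pairing (tau 0) ε G := by
    refine X_pow_dvd_of_polynomial_mul hI hdetdeg (f := pairing (tau 0) ε G) ?_
    have h1 : tau 0 (M.submatrix id I).det * pairing (tau 0) ε G =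
        tau 0 (e (μ I)) * pairing (tau 0) m G := by
      simp only [pairing, mul_sum, ← mul_assoc, ← map_mul, hrel]
    rw [h1]
    exact hsum.mul_left _
  have h0 := ho _ (pairing_mem_boundedSpan G _ ε hεdeg) hfin
  exact hε0 (congrFun (hli ε h0) _)

end EDescent

namespace EDescent

open Finset PowerSeries
variable {H : ℕ}

section Siegel
attribute [local instance] Matrix.seminormedAddCommGroup

theorem exists_small_integer_solution {α β : Type*} [Fintype α] [Fintype β] (A : Matrix α β ℤ) (Q e : ℕ)
    (hQ : 0 < Q) (hA : ∀ i j, |A i j| ≤ Q) (hm : 0 < Fintype.card α) (hn : Fintype.card α < Fintype.card β)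
    (he : Fintype.card α ≤ e * (Fintype.card β - Fintype.card α)) :
    ∃ t : β → ℤ, t ≠ 0 ∧ A.mulVec t = 0 ∧ ∀ j, |t j| ≤ (Fintype.card β * Q : ℤ) ^ e := by
  obtain ⟨t, h0, h1, h2⟩ := Int.Matrix.exists_ne_zero_int_vec_norm_le A hn hm
  refine ⟨t, h0, h1, fun j => ?_⟩
  have h3 : ‖A‖ ≤ Q := by
    rw [Matrix.norm_le_iff (Nat.cast_nonneg Q)]
    intro i j
    rw [Int.norm_eq_abs]
    exact_mod_cast hA i j
  have hQ1 : (1 : ℝ) ≤ Q := by exact_mod_cast hQ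
  have hβ : (1 : ℝ) ≤ Fintype.card β := by exact_mod_cast (hm.trans hn)
  have hpos : (0 : ℝ) < (Fintype.card β : ℝ) - Fintype.card α := sub_pos.2 (by exact_mod_cast hn)
  have h4 : ((Fintype.card α : ℝ) / (Fintype.card β - Fintype.card α)) ≤ (e : ℝ) := by
    rw [div_le_iff₀ hpos, ← Nat.cast_sub hn.le]
    exact_mod_cast he
  have h5 : (1 : ℝ) ≤ (Fintype.card β : ℝ) * max 1 ‖A‖ :=
    one_le_mul_of_one_le_of_one_le hβ (le_max_left _ _)
  have h6 : ‖t‖ ≤ ((Fintype.card β : ℝ) * Q) ^ e := by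
    refine h2.trans ((Real.rpow_le_rpow_of_exponent_le h5 h4).trans ?_)
    rw [Real.rpow_natCast]
    gcongr
    exact max_le hQ1 h3
  have h7 : |(t j : ℝ)| ≤ ((Fintype.card β : ℝ) * Q) ^ e := by
    rw [← Int.norm_eq_abs]; exact (norm_le_pi_norm t j).trans h6
  exact_mod_cast h7

end Siegel

theorem exists_common_bounds (G : Fin H → ℚ⟦X⟧) (hG : ∀ i, G i ∈ EQ) :
    ∃ (C : ℕ) (d : ℕ → ℕ), 0 < C ∧ ∀ n, 0 < d n ∧ d n ≤ C ^ (n + 1) ∧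
      ∀ i, |ecoeff (G i) n| ≤ (C : ℚ) ^ (n + 1) ∧ ∀ j ≤ n, ∃ z : ℤ, (d n : ℚ) * ecoeff (G i) j = z := by
  choose C d hC h using hG
  have hle : ∀ i, C i ≤ ∏ i, C i := fun i =>
    Nat.le_of_dvd (prod_pos fun i _ => hC i) (dvd_prod_of_mem C (mem_univ i))
  refine ⟨∏ i, C i, fun n => ∏ i, d i n, prod_pos fun i _ => hC i, fun n =>
    ⟨prod_pos fun i _ => (h i n).1, ?_, fun i => ⟨?_, fun j hj => ?_⟩⟩⟩
  · rw [← prod_pow]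
    exact prod_le_prod' fun i _ => (h i n).2.1
  · refine ((h i n).2.2.1).trans ?_
    have : (C i : ℚ) ≤ ((∏ i, C i : ℕ) : ℚ) := by exact_mod_cast hle i
    gcongr
  · obtain ⟨z, hz⟩ := (h i n).2.2.2 j hj
    obtain ⟨e, he⟩ := dvd_prod_of_mem (fun i => d i n) (mem_univ i)
    refine ⟨e * z, ?_⟩
    change ((∏ i, d i n : ℕ) : ℚ) * _ = _
    rw [he]; push_cast; rw [← hz]; ring

theorem norm_ratCast (q : ℚ) : ‖(q : ℂ)‖ = ((|q| : ℚ) : ℝ) := by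
  rw [show (q : ℂ) = ((q : ℝ) : ℂ) by push_cast; rfl, Complex.norm_real, Real.norm_eq_abs, Rat.cast_abs]

theorem norm_coeff_taylorOne_le (R : ℚ⟦X⟧) (L C : ℕ) (Q : ℝ) (hQ : 0 ≤ Q) (hX : X ^ L ∣ R)
    (hR : ∀ j, ((|ecoeff R j| : ℚ) : ℝ) ≤ Q * (C : ℝ) ^ j) (l : ℕ) :
    ‖coeff l (taylorOne R)‖ ≤ Q * (2 * C : ℝ) ^ L * Real.exp (2 * C) / L.factorial := by
  have hterm : ∀ j : ℕ, ‖((j.choose l : ℂ) * ((coeff j R : ℚ) : ℂ))‖ ≤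
      Q * ((2 * C : ℝ) ^ j / j.factorial) := fun j => by
    rw [norm_mul, Complex.norm_natCast, norm_ratCast, coeff_eq_ecoeff_div, abs_div, Nat.abs_cast,
      Rat.cast_div, Rat.cast_natCast]
    have h4 : (j.choose l : ℝ) ≤ 2 ^ j := by exact_mod_cast Nat.choose_le_two_pow j l
    calc (j.choose l : ℝ) * (((|ecoeff R j| : ℚ) : ℝ) / j.factorial)
        ≤ 2 ^ j * (Q * (C : ℝ) ^ j / j.factorial) := by
          have := hR j
          gcongr
      _ = _ := by rw [mul_pow]; ring
  have hS := (Real.summable_pow_div_factorial (2 * C : ℝ)).mul_left Q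
  have hzero : ∀ j < L, ((j.choose l : ℂ) * ((coeff j R : ℚ) : ℂ)) = 0 := fun j hj => by
    rw [X_pow_dvd_iff.1 hX j hj, Rat.cast_zero, mul_zero]
  have hsum : Summable fun j : ℕ => (j.choose l : ℂ) * ((coeff j R : ℚ) : ℂ) :=
    Summable.of_norm_bounded hS hterm
  rw [coeff_taylorOne, ← hsum.sum_add_tsum_nat_add L, sum_eq_zero fun j hj => hzero j (mem_range.1 hj),
    zero_add]
  have hexp : HasSum (fun i : ℕ => (2 * C : ℝ) ^ i / i.factorial) (Real.exp (2 * C)) := by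
    rw [Real.exp_eq_exp_ℝ]; exact NormedSpace.expSeries_div_hasSum_exp _
  have hfin := hexp.mul_left (Q * (2 * C : ℝ) ^ L / L.factorial)
  refine (tsum_of_norm_bounded hfin fun i => ?_).trans (le_of_eq (by ring))
  refine (hterm (i + L)).trans ?_
  have hf : ((i.factorial * L.factorial : ℕ) : ℝ) ≤ ((i + L).factorial : ℝ) := by
    exact_mod_cast Nat.le_of_dvd (Nat.factorial_pos _) (Nat.factorial_mul_factorial_dvd_factorial_add i L)
  have hi : (0 : ℝ) < ((i.factorial * L.factorial : ℕ) : ℝ) := by exact_mod_cast (by positivity)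
  calc Q * ((2 * C : ℝ) ^ (i + L) / (i + L).factorial)
      ≤ Q * ((2 * C : ℝ) ^ (i + L) / ((i.factorial * L.factorial : ℕ) : ℝ)) := by gcongr
    _ = _ := by push_cast; rw [pow_add]; field_simp

end EDescent

namespace EDescent

open Finset PowerSeries
variable {H : ℕ}

/-- The polynomial `n! ∑_{k ≤ n} β k / k! X ^ k`. -/
def facPoly (n : ℕ) (β : ℕ → ℤ) : Polynomial ℚ :=
  ∑ k ∈ range (n + 1), Polynomial.monomial k ((n.factorial : ℚ) * β k / k.factorial)

theorem coeff_facPoly (n : ℕ) (β : ℕ → ℤ) (k : ℕ) :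
    (facPoly n β).coeff k = if k ≤ n then (n.factorial : ℚ) * β k / k.factorial else 0 := by
  simp [facPoly, Polynomial.finsetSum_coeff, Polynomial.coeff_monomial]

theorem ecoeff_facPoly (n : ℕ) (β : ℕ → ℤ) (hβ : ∀ k, n < k → β k = 0) (k : ℕ) :
    ecoeff (tau 0 (facPoly n β)) k = n.factorial * β k := by
  rw [ecoeff, tau_zero_apply, Polynomial.coeff_coe, coeff_facPoly]
  have : (k.factorial : ℚ) ≠ 0 := by exact_mod_cast k.factorial_ne_zero
  split_ifs with h
  · field_simp
  · rw [hβ k (by omega)]; simp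

theorem natDegree_facPoly_le (n : ℕ) (β : ℕ → ℤ) : (facPoly n β).natDegree ≤ n := by
  rw [Polynomial.natDegree_le_iff_coeff_eq_zero]
  intro k hk
  rw [coeff_facPoly, if_neg (by omega)]

theorem exists_int_coeff_facPoly (n : ℕ) (β : ℕ → ℤ) (Q : ℕ) (hβ : ∀ k, |β k| ≤ Q) (k : ℕ) :
    ∃ z : ℤ, (facPoly n β).coeff k = z ∧ |z| ≤ n.factorial * Q := by
  rw [coeff_facPoly]
  split_ifs with h
  · obtain ⟨e, he⟩ := Nat.factorial_dvd_factorial h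
    have hk : (k.factorial : ℚ) ≠ 0 := by exact_mod_cast k.factorial_ne_zero
    refine ⟨e * β k, ?_, ?_⟩
    · rw [he]; push_cast; field_simp
    · rw [abs_mul, Nat.abs_cast]
      have h1 : (e : ℤ) ≤ n.factorial := by
        rw [he]; exact_mod_cast Nat.le_mul_of_pos_left e k.factorial_pos
      exact mul_le_mul h1 (hβ k) (abs_nonneg _) (by positivity)
  · exact ⟨0, by simp, by simp; positivity⟩

theorem ecoeff_sum {ι : Type*} (s : Finset ι) (g : ι → ℚ⟦X⟧) (n : ℕ) :
    ecoeff (∑ i ∈ s, g i) n = ∑ i ∈ s, ecoeff (g i) n := by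
  simp only [ecoeff, map_sum, mul_sum]

theorem ecoeff_pairing_facPoly (G : Fin H → ℚ⟦X⟧) (n : ℕ) (β : Fin H → ℕ → ℤ)
    (hβ : ∀ i k, n < k → β i k = 0) (l : ℕ) :
    ecoeff (pairing (tau 0) (fun i => facPoly n (β i)) G) l =
      n.factorial * ∑ i, ∑ k ∈ range (l + 1), (l.choose k : ℚ) * (β i k * ecoeff (G i) (l - k)) := by
  rw [pairing, ecoeff_sum, mul_sum]
  refine sum_congr rfl fun i _ => ?_
  rw [ecoeff_mul, Finset.Nat.sum_antidiagonal_eq_sum_range_succ_mk, mul_sum]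
  refine sum_congr rfl fun k _ => ?_
  rw [ecoeff_facPoly n _ (hβ i)]; ring

theorem abs_ecoeff_pairing_le (G : Fin H → ℚ⟦X⟧) (n : ℕ) (β : Fin H → ℕ → ℤ)
    (hβ : ∀ i k, n < k → β i k = 0) (Q C : ℕ) (hC : 0 < C) (hβQ : ∀ i k, |β i k| ≤ Q)
    (hG : ∀ i j, |ecoeff (G i) j| ≤ (C : ℚ) ^ (j + 1)) (l : ℕ) :
    |ecoeff (pairing (tau 0) (fun i => facPoly n (β i)) G) l| ≤
      n.factorial * H * Q * C * (2 * C : ℚ) ^ l := by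
  rw [ecoeff_pairing_facPoly G n β hβ, abs_mul, Nat.abs_cast]
  have hC1 : (1 : ℚ) ≤ C := by exact_mod_cast hC
  have h1 : ∀ i, |∑ k ∈ range (l + 1), (l.choose k : ℚ) * (β i k * ecoeff (G i) (l - k))| ≤
      Q * C * (2 * C : ℚ) ^ l := fun i => by
    calc |∑ k ∈ range (l + 1), (l.choose k : ℚ) * (β i k * ecoeff (G i) (l - k))|
        ≤ ∑ k ∈ range (l + 1), |(l.choose k : ℚ) * (β i k * ecoeff (G i) (l - k))| :=
          abs_sum_le_sum_abs _ _
      _ ≤ ∑ k ∈ range (l + 1), (l.choose k : ℚ) * (Q * (C : ℚ) ^ (l + 1)) := by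
          refine sum_le_sum fun k hk => ?_
          rw [abs_mul, Nat.abs_cast, abs_mul]
          have b1 : |(β i k : ℚ)| ≤ Q := by exact_mod_cast hβQ i k
          have b2 := (hG i (l - k)).trans (pow_le_pow_right₀ hC1 (show l - k + 1 ≤ l + 1 by omega))
          gcongr
      _ = _ := by
          have := Nat.sum_range_choose l
          have h2 : ∑ k ∈ range (l + 1), (l.choose k : ℚ) = 2 ^ l := by exact_mod_cast this
          rw [← sum_mul, h2, mul_pow, pow_succ]; ring
  have h2 : |∑ i, ∑ k ∈ range (l + 1), (l.choose k : ℚ) * (β i k * ecoeff (G i) (l - k))| ≤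
      H * (Q * C * (2 * C : ℚ) ^ l) := by
    refine (abs_sum_le_sum_abs _ _).trans ((sum_le_sum fun i _ => h1 i).trans ?_)
    simp
  calc (n.factorial : ℚ) * |∑ i, ∑ k ∈ range (l + 1), (l.choose k : ℚ) * (β i k * ecoeff (G i) (l - k))|
      ≤ n.factorial * (H * (Q * C * (2 * C : ℚ) ^ l)) := by gcongr
    _ = _ := by ring

theorem exists_siegel_vector (G : Fin H → ℚ⟦X⟧) (C : ℕ) (d : ℕ → ℕ) (hC : 0 < C)
    (hd : ∀ n, 0 < d n ∧ d n ≤ C ^ (n + 1) ∧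
      ∀ i, |ecoeff (G i) n| ≤ (C : ℚ) ^ (n + 1) ∧ ∀ j ≤ n, ∃ z : ℤ, (d n : ℚ) * ecoeff (G i) j = z)
    (n L e : ℕ) (hL : 0 < L) (hn : L < H * (n + 1)) (he : L ≤ e * (H * (n + 1) - L)) :
    ∃ β : Fin H → ℕ → ℤ, (∃ i k, β i k ≠ 0) ∧ (∀ i k, n < k → β i k = 0) ∧
      (∀ i k, |β i k| ≤ ((H * (n + 1) * (2 ^ L * (C ^ (L + 1) * C ^ (L + 1))) : ℕ) : ℤ) ^ e) ∧
      X ^ L ∣ pairing (tau 0) (fun i => facPoly n (β i)) G := by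
  have hC1 : (1 : ℚ) ≤ C := by exact_mod_cast hC
  obtain ⟨hd0, hdC, hdz⟩ := hd L
  have : ∀ (i : Fin H) (j : ℕ), ∃ z : ℤ, j ≤ L → (d L : ℚ) * ecoeff (G i) j = z := fun i j => by
    by_cases hj : j ≤ L
    · obtain ⟨z, hz⟩ := (hdz i).2 j hj
      exact ⟨z, fun _ => hz⟩
    · exact ⟨0, fun h => absurd h hj⟩
  choose z hz using this
  have hzb : ∀ i j, j ≤ L → |z i j| ≤ ((C ^ (L + 1) * C ^ (L + 1) : ℕ) : ℤ) := fun i j hj => by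
    have h1 : |((z i j : ℤ) : ℚ)| ≤ (C : ℚ) ^ (L + 1) * (C : ℚ) ^ (L + 1) := by
      rw [← hz i j hj, abs_mul, Nat.abs_cast]
      have h2 : (d L : ℚ) ≤ (C : ℚ) ^ (L + 1) := by exact_mod_cast hdC
      have h3 := ((hd j).2.2 i).1.trans (pow_le_pow_right₀ hC1 (show j + 1 ≤ L + 1 by omega))
      gcongr
    exact_mod_cast h1
  let A : Matrix (Fin L) (Fin H × Fin (n + 1)) ℤ := Matrix.of fun l q =>
    if (q.2 : ℕ) ≤ l then ((l : ℕ).choose q.2 : ℤ) * z q.1 (l - q.2) else 0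
  have hA : ∀ l q, |A l q| ≤ ((2 ^ L * (C ^ (L + 1) * C ^ (L + 1)) : ℕ) : ℤ) := fun l q => by
    simp only [A, Matrix.of_apply]
    split_ifs with h
    · rw [abs_mul, Nat.abs_cast, Nat.cast_mul]
      have h1 : (((l : ℕ).choose q.2 : ℕ) : ℤ) ≤ ((2 ^ L : ℕ) : ℤ) := by
        exact_mod_cast (Nat.choose_le_two_pow _ _).trans (Nat.pow_le_pow_right (by norm_num) l.2.le)
      exact mul_le_mul h1 (hzb _ _ (by have := l.2; omega)) (abs_nonneg _) (by positivity)
    · rw [abs_zero]; positivity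
  have hcard : Fintype.card (Fin H × Fin (n + 1)) = H * (n + 1) := by simp
  obtain ⟨t, ht0, htA, htb⟩ := exists_small_integer_solution A (2 ^ L * (C ^ (L + 1) * C ^ (L + 1))) e
    (by positivity) hA (by simpa using hL) (by simpa using hn) (by simpa using he)
  let β : Fin H → ℕ → ℤ := fun i k => if h : k < n + 1 then t (i, ⟨k, h⟩) else 0
  have hβ0 : ∀ i k, n < k → β i k = 0 := fun i k hk => dif_neg (by omega)
  refine ⟨β, ?_, hβ0, fun i k => ?_, ?_⟩
  · by_contra! hcon
    apply ht0
    funext q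
    have := hcon q.1 q.2
    exact (dif_pos q.2.2).symm.trans this
  · simp only [β]
    split_ifs with h
    · have := htb (i, ⟨k, h⟩)
      rw [hcard] at this
      exact_mod_cast this
    · rw [abs_zero]; positivity
  · rw [X_pow_dvd_iff]
    intro l hl
    rw [coeff_eq_ecoeff_div, ecoeff_pairing_facPoly G n β hβ0]
    have h1 : ∑ i, ∑ k ∈ range (l + 1), (l.choose k : ℚ) * (β i k * ecoeff (G i) (l - k)) = 0 := by
      have h2 := congrFun htA ⟨l, hl⟩
      have h3 : (d L : ℚ) * ∑ i, ∑ k ∈ range (l + 1), (l.choose k : ℚ) * (β i k * ecoeff (G i) (l - k)) =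
          ((A.mulVec t ⟨l, hl⟩ : ℤ) : ℚ) := by
        rw [Matrix.mulVec, dotProduct, Fintype.sum_prod_type, Int.cast_sum, mul_sum]
        refine sum_congr rfl fun i _ => ?_
        have h4 : ∀ k : Fin (n + 1), A ⟨l, hl⟩ (i, k) * t (i, k) =
            (fun k : ℕ => (if k ≤ l then (l.choose k : ℤ) * z i (l - k) else 0) * β i k) k := fun k => by
          simp only [A, β, Matrix.of_apply, dif_pos k.2, Fin.eta]
        simp only [h4]
        rw [Fin.sum_univ_eq_sum_range
          (fun k : ℕ => (if k ≤ l then (l.choose k : ℤ) * z i (l - k) else 0) * β i k) (n + 1), Int.cast_sum,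
          mul_sum]
        have h5 : ∀ k ∈ range (l + 1), (d L : ℚ) * ((l.choose k : ℚ) * (β i k * ecoeff (G i) (l - k))) =
            (((if k ≤ l then (l.choose k : ℤ) * z i (l - k) else 0) * β i k : ℤ) : ℚ) := fun k hk => by
          have := mem_range.1 hk
          rw [if_pos (by omega)]
          push_cast
          rw [← hz i (l - k) (by omega)]; ring
        rw [sum_congr rfl h5]
        rcases le_total l n with h | h
        · refine sum_subset (range_subset_range.2 (by omega)) fun k _ hk => ?_
          rw [if_neg (by simpa using hk)]; simp
        · refine (sum_subset (range_subset_range.2 (by omega)) fun k _ hk => ?_).symm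
          rw [hβ0 i k (by simpa using hk)]; simp
      rw [h2] at h3
      have hdL : (d L : ℚ) ≠ 0 := by exact_mod_cast hd0.ne'
      simpa [hdL] using h3
    rw [h1, mul_zero, zero_div]

theorem exists_auxiliary_form (G : Fin H → ℚ⟦X⟧) (hG : ∀ i, G i ∈ EQ) (hH : 0 < H) (N : ℕ)
    (hN : 2 ≤ N) :
    ∃ A : ℕ, 0 < A ∧ ∀ b : ℕ, 0 < b → ∃ P : Fin H → Polynomial ℚ, P ≠ 0 ∧
      (∀ i, (P i).natDegree ≤ N * b) ∧
      (∀ i k, ∃ z : ℤ, (P i).coeff k = z ∧ |z| ≤ (N * b).factorial * (A : ℤ) ^ b) ∧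
      X ^ ((H * N - 1) * b) ∣ pairing (tau 0) P G ∧
      ∀ l, ‖coeff l (taylorOne (pairing (tau 0) P G))‖ ≤
        (N * b).factorial * (A : ℝ) ^ b / ((H * N - 1) * b).factorial := by
  obtain ⟨C, d, hC, hd⟩ := exists_common_bounds G hG
  obtain ⟨E, hE⟩ : ∃ E, H * N - 1 = E := ⟨_, rfl⟩
  have hHN : 2 ≤ H * N := hN.trans (Nat.le_mul_of_pos_left N hH)
  have hE0 : 0 < E := by omega
  have hHN' : H * N = E + 1 := by omega
  rw [hE]
  obtain ⟨M, hM⟩ := exists_nat_ge (Real.exp (2 * (2 * C : ℕ)))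
  have hM0 : 0 < M := by
    have : (0 : ℝ) < M := (Real.exp_pos _).trans_le hM
    exact_mod_cast this
  obtain ⟨A0, hA0⟩ : ∃ A0, A0 = (H * (N + 1) * 2 * (2 ^ E * (C ^ (E + 1) * C ^ (E + 1)))) ^ E := ⟨_, rfl⟩
  have hA0p : 0 < A0 := by rw [hA0]; positivity
  refine ⟨H * C * A0 * (4 * C) ^ E * M, by positivity, fun b hb => ?_⟩
  obtain ⟨n, hn⟩ : ∃ n, n = N * b := ⟨_, rfl⟩
  obtain ⟨L, hL⟩ : ∃ L, L = E * b := ⟨_, rfl⟩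
  have hHn : H * (n + 1) = L + (b + H) := by
    rw [hn, hL, mul_add, ← mul_assoc, hHN']; ring
  obtain ⟨β, ⟨i0, k0, hβ⟩, hβ0, hβb, hX⟩ := exists_siegel_vector G C d hC hd n L E
    (by rw [hL]; positivity) (by omega) (by
      rw [hHn, Nat.add_sub_cancel_left, hL]; exact Nat.mul_le_mul le_rfl (by omega))
  have hb1 : b ≠ 0 := by omega
  have hQ : (H * (n + 1) * (2 ^ L * (C ^ (L + 1) * C ^ (L + 1)))) ^ E ≤ A0 ^ b := by
    rw [hA0, ← pow_mul, mul_comm E b, pow_mul]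
    refine Nat.pow_le_pow_left ?_ _
    rw [mul_pow, mul_pow, mul_pow _ (C ^ (E + 1) * C ^ (E + 1)), mul_pow (C ^ (E + 1)), ← pow_mul, ← pow_mul, ← hL]
    have h1 : C ^ (L + 1) ≤ C ^ ((E + 1) * b) := Nat.pow_le_pow_right hC (by
      rw [hL, add_mul]; omega)
    have h2 : H * (N + 1) ≤ (H * (N + 1)) ^ b := Nat.le_self_pow hb1 _
    have h3 : b ≤ 2 ^ b := Nat.lt_two_pow_self.le
    have h4 : n + 1 ≤ (N + 1) * b := by rw [hn, add_mul]; omega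
    have h5 : H * (n + 1) ≤ (H * (N + 1)) ^ b * 2 ^ b :=
      calc H * (n + 1) ≤ H * ((N + 1) * b) := Nat.mul_le_mul le_rfl h4
        _ = H * (N + 1) * b := by ring
        _ ≤ _ := Nat.mul_le_mul h2 h3
    exact Nat.mul_le_mul h5 (Nat.mul_le_mul le_rfl (Nat.mul_le_mul h1 h1))
  have hβQ : ∀ i k, |β i k| ≤ ((A0 ^ b : ℕ) : ℤ) := fun i k => (hβb i k).trans (by exact_mod_cast hQ)
  have hAA : A0 ^ b ≤ (H * C * A0 * (4 * C) ^ E * M) ^ b := by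
    refine Nat.pow_le_pow_left ?_ _
    have : 0 < H * C * (4 * C) ^ E * M := by positivity
    calc A0 ≤ (H * C * (4 * C) ^ E * M) * A0 := Nat.le_mul_of_pos_left _ this
      _ = _ := by ring
  rw [← hn, ← hL]
  refine ⟨fun i => facPoly n (β i), fun h0 => ?_, fun i => natDegree_facPoly_le n _, fun i k => ?_, hX,
    fun l => ?_⟩
  · have h1 := congrArg (fun p => ecoeff (tau 0 p) k0) (congrFun h0 i0)
    beta_reduce at h1
    rw [ecoeff_facPoly n _ (hβ0 i0), Pi.zero_apply, map_zero, ecoeff, map_zero, mul_zero] at h1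
    have : (n.factorial : ℚ) ≠ 0 := by exact_mod_cast n.factorial_ne_zero
    simp [this, hβ] at h1
  · obtain ⟨z, hz, hzb⟩ := exists_int_coeff_facPoly n (β i) _ (hβQ i) k
    exact ⟨z, hz, hzb.trans (by gcongr; exact_mod_cast hAA)⟩
  · have h1 := norm_coeff_taylorOne_le _ L (2 * C) (n.factorial * H * (A0 ^ b : ℕ) * C : ℝ)
      (by positivity) hX (fun j => by
        have := abs_ecoeff_pairing_le G n β hβ0 (A0 ^ b) C hC hβQ (fun i j => ((hd j).2.2 i).1) j
        exact_mod_cast this) l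
    refine h1.trans (div_le_div_of_nonneg_right ?_ (by positivity))
    have hH1 : (1 : ℝ) ≤ H := by exact_mod_cast hH
    have hC1 : (1 : ℝ) ≤ C := by exact_mod_cast hC
    have hM1 : (1 : ℝ) ≤ M := by exact_mod_cast hM0
    calc (n.factorial * H * (A0 ^ b : ℕ) * C : ℝ) * (2 * (2 * C : ℕ)) ^ L * Real.exp (2 * (2 * C : ℕ))
        ≤ (n.factorial * (H : ℝ) ^ b * (A0 ^ b : ℕ) * (C : ℝ) ^ b) * (2 * (2 * C : ℕ)) ^ L * (M : ℝ) ^ b := by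
          have e1 := le_self_pow₀ hH1 hb1
          have e2 := le_self_pow₀ hC1 hb1
          have e3 := hM.trans (le_self_pow₀ hM1 hb1)
          gcongr
      _ = _ := by
          push_cast
          rw [hL, pow_mul, show (2 * (2 * (C : ℝ))) = 4 * C by ring]
          simp only [mul_pow]
          ring

end EDescent

namespace EDescent

open Finset PowerSeries
variable {H : ℕ}

theorem X_pow_dvd_det_iterMatrix_mul (t : Polynomial ℚ →+* ℚ⟦X⟧)
    (hd : ∀ p, d⁄dX ℚ (t p) = t (Polynomial.derivative p)) (T : Polynomial ℚ)
    (B : Matrix (Fin H) (Fin H) (Polynomial ℚ)) (y : Fin H → ℚ⟦X⟧)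
    (hy : ∀ i, t T * d⁄dX ℚ (y i) = ∑ j, t (B i j) * y j) (P : Fin H → Polynomial ℚ) (m : ℕ)
    (h : X ^ (m + H) ∣ pairing t P y) (i : Fin H) : X ^ m ∣ t (iterMatrix T B P H).det * y i := by
  have h1 := dvd_det_mul ((iterMatrix T B P H).map t) y (X ^ m) (fun j => by
    rw [mulVec_iterMatrix]
    exact X_pow_dvd_pairing_iterate t hd T B y hy P m H j j.2.le h) i
  rwa [show ((iterMatrix T B P H).map t).det = t (iterMatrix T B P H).det from
    (RingHom.map_det t _).symm] at h1

theorem X_pow_dvd_coe_iff (p : Polynomial ℚ) (m : ℕ) :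
    (X : ℚ⟦X⟧) ^ m ∣ (p : ℚ⟦X⟧) ↔ Polynomial.X ^ m ∣ p := by
  rw [X_pow_dvd_iff, Polynomial.X_pow_dvd_iff]
  simp only [Polynomial.coeff_coe]

theorem not_X_pow_dvd_tau_one {p : Polynomial ℚ} (hp : p ≠ 0) {m r : ℕ} (hm : X ^ m ∣ tau 0 p)
    (hdeg : p.natDegree ≤ m + r) : ¬ X ^ (r + 1) ∣ tau 1 p := by
  intro h
  rw [tau_zero_apply, X_pow_dvd_coe_iff] at hm
  rw [tau_apply, X_pow_dvd_coe_iff] at h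
  have h1 : (Polynomial.X - Polynomial.C 1) ^ (r + 1) ∣ p := by
    rw [Polynomial.X_sub_C_pow_dvd_iff]
    simpa [Polynomial.taylor_apply] using h
  have h2 : IsCoprime ((Polynomial.X : Polynomial ℚ) ^ m) ((Polynomial.X - Polynomial.C 1) ^ (r + 1)) := by
    refine IsCoprime.pow ⟨1, -1, ?_⟩
    simp
  have h3 := Polynomial.natDegree_le_of_dvd (h2.mul_dvd hm h1) hp
  rw [Polynomial.natDegree_mul (pow_ne_zero _ Polynomial.X_ne_zero)
    (pow_ne_zero _ (Polynomial.X_sub_C_ne_zero 1)), Polynomial.natDegree_pow, Polynomial.natDegree_pow,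
    Polynomial.natDegree_X, Polynomial.natDegree_X_sub_C] at h3
  omega

theorem exists_coeff_ne_zero {K : Type*} [Field K] {r : ℕ} {p : K⟦X⟧} (h : ¬ X ^ (r + 1) ∣ p) :
    ∃ n ≤ r, coeff n p ≠ 0 := by
  rw [X_pow_dvd_iff] at h
  push Not at h
  obtain ⟨n, hn, h⟩ := h
  exact ⟨n, by omega, h⟩

/-- Nondegeneracy of the Taylor coefficients at `1` of an auxiliary form against a family of rational
solutions. -/
theorem exists_nondegeneracy_bound (hH : 0 < H) (T : Polynomial ℚ) (hT : T ≠ 0)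
    (B : Matrix (Fin H) (Fin H) (Polynomial ℚ)) (G : Fin H → ℚ⟦X⟧)
    (hG : ∀ i, tau 0 T * d⁄dX ℚ (G i) = ∑ j, tau 0 (B i j) * G j)
    (hli : ∀ P : Fin H → Polynomial ℚ, pairing (tau 0) P G = 0 → P = 0)
    {s : ℕ} (y : Fin s → Fin H → ℚ⟦X⟧)
    (hy : ∀ k i, tau 1 T * d⁄dX ℚ (y k i) = ∑ j, tau 1 (B i j) * y k j)
    (hyli : LinearIndependent ℚ y) :
    ∃ c1 c2 : ℕ, ∀ N b : ℕ, 2 ≤ N → c1 ≤ b → ∀ P : Fin H → Polynomial ℚ, P ≠ 0 →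
      (∀ i, (P i).natDegree ≤ N * b) → X ^ ((H * N - 1) * b) ∣ pairing (tau 0) P G →
      ∀ a : Fin s → ℚ, (∀ l < b + c2, ∑ k, a k * coeff l (pairing (tau 1) P (y k)) = 0) → a = 0 := by
  obtain ⟨c0, hc0⟩ := exists_order_bound_of_det_eq_zero T hT B G hG hli
  obtain ⟨w, hw⟩ := exists_natDegree_sysOp_le T B
  have hG0 : G ⟨0, hH⟩ ≠ 0 := by
    intro h0
    have := hli (Pi.single ⟨0, hH⟩ 1) (by simp [pairing, Pi.single_apply, h0, apply_ite (tau (0 : ℚ))])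
    simpa using congrFun this ⟨0, hH⟩
  obtain ⟨n0, hn0⟩ : ∃ n, coeff n (G ⟨0, hH⟩) ≠ 0 := by
    by_contra! hcon
    exact hG0 (PowerSeries.ext (by simpa using hcon))
  let V : Submodule ℚ ℚ⟦X⟧ := Submodule.span ℚ (Set.range fun q : Fin s × Fin H => y q.1 q.2)
  have hVfd : FiniteDimensional ℚ V := FiniteDimensional.span_of_finite ℚ (Set.finite_range _)
  obtain ⟨c, hc⟩ := exists_order_bound V
  refine ⟨c0 + H + n0, H * (H * w) + H + n0 + c + H, fun N b hN hb P hP hdeg hX a ha => ?_⟩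
  have hbN : b ≤ (N - 1) * b := Nat.le_mul_of_pos_left b (by omega)
  have hL0 : (H * N - 1) * b = (H - 1) * (N * b) + (N - 1) * b := by
    obtain ⟨H', rfl⟩ : ∃ H', H = H' + 1 := ⟨H - 1, by omega⟩
    obtain ⟨N', rfl⟩ : ∃ N', N = N' + 1 := ⟨N - 1, by omega⟩
    rw [show (H' + 1) * (N' + 1) - 1 = H' * (N' + 1) + N' by rw [add_mul]; omega]
    simp only [Nat.add_sub_cancel]
    ring
  have hL1 : (H * N - 1) * b + b = H * (N * b) := by
    have : 1 ≤ H * N := Nat.mul_pos hH (by omega)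
    obtain ⟨E, hE⟩ : ∃ E, H * N = E + 1 := ⟨H * N - 1, by omega⟩
    rw [← mul_assoc, hE]; simp; ring
  have hΔ : (iterMatrix T B P H).det ≠ 0 := fun h0 =>
    hc0 (N * b) P hdeg hP h0 ((pow_dvd_pow X (by omega)).trans hX)
  obtain ⟨m, hm⟩ : ∃ m, (H * N - 1) * b = m + n0 + H := ⟨(H * N - 1) * b - n0 - H, by omega⟩
  have hm0 : X ^ m ∣ tau 0 (iterMatrix T B P H).det := by
    rw [hm] at hX
    have := X_pow_dvd_det_iterMatrix_mul (tau 0) (derivative_tau 0) T B G hG P (m + n0) hX ⟨0, hH⟩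
    rw [mul_comm] at this
    exact X_pow_dvd_of_mul hn0 this
  have hdegΔ : (iterMatrix T B P H).det.natDegree ≤ m + (b + H * (H * w) + H + n0) := by
    have h1 := natDegree_det_le (iterMatrix T B P H) (N * b + H * w) (fun j i =>
      (hw P (N * b) hdeg j i).trans (by have := Nat.mul_le_mul_right w j.2.le; omega))
    rw [Fintype.card_fin, mul_add] at h1
    omega
  obtain ⟨n1, hn1, hn1'⟩ := exists_coeff_ne_zero (not_X_pow_dvd_tau_one hΔ hm0 hdegΔ)
  let u : Fin H → ℚ⟦X⟧ := ∑ k, a k • y k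
  have hu_apply : ∀ i, u i = ∑ k, a k • y k i := fun i => by simp [u]
  have hu : ∀ i, tau 1 T * d⁄dX ℚ (u i) = ∑ j, tau 1 (B i j) * u j := fun i => by
    simp only [hu_apply, map_sum, mul_sum, mul_smul_comm]
    rw [sum_comm]
    refine sum_congr rfl fun j _ => ?_
    rw [(d⁄dX ℚ).map_smul, mul_smul_comm, hy, smul_sum]
  have hpair : pairing (tau 1) P u = ∑ k, a k • pairing (tau 1) P (y k) := by
    simp only [pairing, hu_apply, mul_sum, smul_sum, mul_smul_comm]
    rw [sum_comm]
  have hXu : X ^ (b + (H * (H * w) + H + n0 + c + H)) ∣ pairing (tau 1) P u := by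
    rw [X_pow_dvd_iff]
    intro l hl
    rw [hpair, map_sum, ← ha l hl]
    exact sum_congr rfl fun k _ => by rw [map_smul, smul_eq_mul]
  have hu0 : u = 0 := by
    funext i
    refine hc (u i) ?_ ?_
    · rw [hu_apply]
      exact Submodule.sum_mem _ fun k _ => Submodule.smul_mem _ _ (Submodule.subset_span ⟨(k, i), rfl⟩)
    · have h1 := X_pow_dvd_det_iterMatrix_mul (tau 1) (derivative_tau 1) T B u hu P (c + n1)
        ((pow_dvd_pow X (by omega)).trans hXu) i
      exact X_pow_dvd_of_mul hn1' h1
  exact funext (Fintype.linearIndependent_iff.1 hyli a hu0)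

end EDescent

namespace EDescent

open Finset PowerSeries
variable {H : ℕ}

theorem exists_iterate_expansion (t : Polynomial ℚ →+* ℚ⟦X⟧)
    (hd : ∀ p, d⁄dX ℚ (t p) = t (Polynomial.derivative p)) (T : Polynomial ℚ) (j : ℕ) :
    ∃ a : ℕ → Polynomial ℚ, (∀ k, j < k → a k = 0) ∧ a j = T ^ j ∧
      ∀ f : ℚ⟦X⟧, (fun r => t T * d⁄dX ℚ r)^[j] f = ∑ k ∈ range (j + 1), t (a k) * (d⁄dX ℚ)^[k] f := by
  induction j with
  | zero =>
    refine ⟨fun k => if k = 0 then 1 else 0, fun k hk => if_neg (by omega), by simp, fun f => by simp⟩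
  | succ j ih =>
    obtain ⟨a, ha0, haj, ha⟩ := ih
    refine ⟨fun k => T * (Polynomial.derivative (a k) + if k = 0 then 0 else a (k - 1)), fun k hk => ?_, ?_,
      fun f => ?_⟩
    · beta_reduce
      rw [ha0 k (by omega), if_neg (by omega), ha0 (k - 1) (by omega)]; simp
    · simp [ha0 (j + 1) (by omega), haj, pow_succ']
    · rw [Function.iterate_succ_apply', ha, map_sum, mul_sum]
      have h1 : ∀ k ∈ range (j + 1), t T * d⁄dX ℚ (t (a k) * (d⁄dX ℚ)^[k] f) =
          t (T * Polynomial.derivative (a k)) * (d⁄dX ℚ)^[k] f + t (T * a k) * (d⁄dX ℚ)^[k + 1] f :=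
        fun k _ => by
          rw [Derivation.leibniz, hd, Function.iterate_succ_apply', smul_eq_mul, smul_eq_mul, map_mul, map_mul]
          ring
      rw [sum_congr rfl h1, sum_add_distrib]
      simp only [mul_add, map_add, add_mul, sum_add_distrib]
      congr 1
      · rw [sum_range_succ _ (j + 1), ha0 (j + 1) (by omega)]; simp
      · rw [sum_range_succ' _ (j + 1)]; simp

/-- Each component of a solution of a first order system solves a scalar equation. -/
theorem exists_scalar_equation (T : Polynomial ℚ) (hT : T ≠ 0)
    (B : Matrix (Fin H) (Fin H) (Polynomial ℚ)) (t : Polynomial ℚ →+* ℚ⟦X⟧)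
    (hd : ∀ p, d⁄dX ℚ (t p) = t (Polynomial.derivative p)) (y : Fin H → ℚ⟦X⟧)
    (hy : ∀ i, t T * d⁄dX ℚ (y i) = ∑ j, t (B i j) * y j) (i : Fin H) :
    ∃ q : ℕ → Polynomial ℚ, (∃ j ≤ H, q j ≠ 0) ∧
      ∑ j ∈ range (H + 1), t (q j) * (d⁄dX ℚ)^[j] (y i) = 0 := by
  have hdep : ¬ LinearIndependent (Polynomial ℚ)
      (fun j : Fin (H + 1) => (sysOp T B)^[j] (Pi.single i 1)) := fun h => by
    have := h.fintype_card_le_finrank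
    simp at this
  rw [Fintype.linearIndependent_iff] at hdep
  push Not at hdep
  obtain ⟨s, hs, hs0⟩ := hdep
  obtain ⟨J, hJ, hJmax⟩ : ∃ J, s J ≠ 0 ∧ ∀ j, J < j → s j = 0 := by
    classical
    let S := univ.filter fun j => s j ≠ 0
    obtain ⟨j0, hj0⟩ := hs0
    have hS : S.Nonempty := ⟨j0, by simpa [S] using hj0⟩
    refine ⟨S.max' hS, by simpa [S] using S.max'_mem hS, fun j hj => ?_⟩
    by_contra hne
    exact absurd (S.le_max' j (by simpa [S] using hne)) (not_le.2 hj)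
  choose a ha0 haj ha using exists_iterate_expansion t hd T
  refine ⟨fun k => ∑ j, s j * a j k, ⟨J, by omega, ?_⟩, ?_⟩
  · beta_reduce
    rw [sum_eq_single J]
    · rw [haj]; exact mul_ne_zero hJ (pow_ne_zero _ hT)
    · intro j _ hj
      rcases lt_or_gt_of_ne hj with h | h
      · rw [ha0 j J h, mul_zero]
      · rw [hJmax j h, zero_mul]
    · simp
  · have h1 : ∀ j : Fin (H + 1), pairing t ((sysOp T B)^[j] (Pi.single i 1)) y =
        ∑ k ∈ range (H + 1), t (a j k) * (d⁄dX ℚ)^[k] (y i) := fun j => by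
      have h3 : pairing t (Pi.single i 1) y = y i := by
        simp [pairing, Pi.single_apply, apply_ite t]
      rw [pairing_sysOp_iterate t (d⁄dX ℚ : ℚ⟦X⟧ →+ ℚ⟦X⟧) (d⁄dX ℚ).leibniz hd T B y hy, h3]
      refine (ha j (y i)).trans (sum_subset (range_subset_range.2 (by omega)) fun k _ hk => ?_)
      rw [ha0 j k (by simpa using hk), map_zero, zero_mul]
    have h2 : ∑ j, t (s j) * pairing t ((sysOp T B)^[j] (Pi.single i 1)) y = 0 := by
      simp only [pairing, mul_sum]
      rw [sum_comm]
      refine sum_eq_zero fun l _ => ?_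
      have h3 := congrFun hs l
      simp only [Finset.sum_apply, Pi.smul_apply, smul_eq_mul, Pi.zero_apply] at h3
      simp only [← mul_assoc, ← map_mul]
      rw [← sum_mul, ← map_sum, h3, map_zero, zero_mul]
    rw [← h2]
    simp only [h1, map_sum, map_mul, sum_mul, mul_sum]
    rw [sum_comm]
    simp only [mul_assoc]

theorem factorial_add_le (b c : ℕ) (hb : 0 < b) :
    (b + c).factorial ≤ (2 ^ (c + 1) * c.factorial) ^ b * b.factorial := by
  rw [← Nat.add_choose_mul_factorial_mul_factorial b c]
  have h1 : (b + c).choose c ≤ 2 ^ (b + c) := Nat.choose_le_two_pow _ _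
  have h2 : 2 ^ (b + c) ≤ (2 ^ (c + 1)) ^ b := by
    rw [← pow_mul]
    refine Nat.pow_le_pow_right (by norm_num) ?_
    have := Nat.le_mul_of_pos_right c hb
    rw [add_mul]; omega
  have h3 : c.factorial ≤ c.factorial ^ b := Nat.le_self_pow (by omega) _
  calc (b + c).choose c * b.factorial * c.factorial
      ≤ (2 ^ (c + 1)) ^ b * b.factorial * c.factorial ^ b := by gcongr; exact h1.trans h2
    _ = _ := by rw [mul_pow]; ring

theorem exists_family_denominator_bound {ι : Type*} [Fintype ι] (f : ι → ℚ⟦X⟧) (J : ℕ)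
    (hf : ∀ i, ∃ q : ℕ → Polynomial ℚ, (∃ j ≤ J, q j ≠ 0) ∧
      ∑ j ∈ range (J + 1), ((q j : Polynomial ℚ) : ℚ⟦X⟧) * (d⁄dX ℚ)^[j] (f i) = 0) (c : ℕ) :
    ∃ A κ : ℕ, 0 < A ∧ ∀ b : ℕ, 0 < b → ∃ D : ℕ, 0 < D ∧ D ≤ A ^ b * b.factorial ^ κ ∧
      ∀ l < b + c, ∀ i, (∃ z : ℤ, (D : ℚ) * coeff l (f i) = z) ∧
        |coeff l (f i)| ≤ (A : ℚ) ^ b * (b.factorial : ℚ) ^ κ := by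
  choose q hq hode using hf
  choose A κ h using fun i => exists_denominator_bound J (q i) (hq i) (f i) (hode i)
  have hbase : ∃ A' κ' : ℕ, 0 < A' ∧ (∀ i, A i ≤ A') ∧ ∀ i, κ i ≤ κ' :=
    ⟨∑ i, A i + 1, ∑ i, κ i, by omega, fun i => by
      have := single_le_sum (f := A) (fun _ _ => Nat.zero_le _) (mem_univ i); omega,
      fun i => single_le_sum (f := κ) (fun _ _ => Nat.zero_le _) (mem_univ i)⟩
  obtain ⟨A', κ', hA', hAA, hκκ⟩ := hbase
  obtain ⟨F, hF⟩ : ∃ F, F = 2 ^ (c + 1) * c.factorial := ⟨_, rfl⟩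
  have hF0 : 0 < F := by rw [hF]; positivity
  obtain ⟨M, hM⟩ : ∃ M, M = A' ^ (c + 2) * F ^ κ' := ⟨_, rfl⟩
  have hM0 : 0 < M := by rw [hM]; positivity
  have hbd : ∀ i b, 0 < b → A i ^ (b + c + 1) * (b + c).factorial ^ κ i ≤ M ^ b * b.factorial ^ κ' :=
    fun i b hb => by
      have h1 : A i ^ (b + c + 1) ≤ (A' ^ (c + 2)) ^ b := by
        refine (Nat.pow_le_pow_left (hAA i) _).trans ?_
        rw [← pow_mul]
        refine Nat.pow_le_pow_right hA' ?_
        have := Nat.le_mul_of_pos_right c hb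
        rw [add_mul]; omega
      have h2 : (b + c).factorial ^ κ i ≤ (F ^ b * b.factorial) ^ κ' :=
        (Nat.pow_le_pow_right (Nat.factorial_pos _) (hκκ i)).trans
          (Nat.pow_le_pow_left (hF ▸ factorial_add_le b c hb) _)
      calc A i ^ (b + c + 1) * (b + c).factorial ^ κ i ≤ (A' ^ (c + 2)) ^ b * (F ^ b * b.factorial) ^ κ' :=
            Nat.mul_le_mul h1 h2
        _ = _ := by rw [hM, mul_pow (F ^ b), mul_pow _ (F ^ κ'), ← pow_mul F, ← pow_mul F, mul_comm b κ']; ring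
  obtain ⟨m, hm⟩ : ∃ m, m = Fintype.card ι := ⟨_, rfl⟩
  refine ⟨M ^ (m + 1), κ' * (m + 1), by positivity, fun b hb => ?_⟩
  choose D hD0 hD h using fun i => h i (b + c)
  refine ⟨∏ i, D i, prod_pos fun i _ => hD0 i, ?_, fun l hl i => ⟨?_, ?_⟩⟩
  · have h1 : ∏ i, D i ≤ ∏ _i : ι, (M ^ b * b.factorial ^ κ') :=
      prod_le_prod' fun i _ => (hD i).trans (hbd i b hb)
    rw [prod_const, card_univ, ← hm] at h1
    refine h1.trans ((Nat.pow_le_pow_right (by positivity) (Nat.le_succ m)).trans (le_of_eq ?_))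
    rw [mul_pow, ← pow_mul, ← pow_mul, ← pow_mul, mul_comm b]
  · obtain ⟨z, hz⟩ := (h i l (by omega)).1
    obtain ⟨e, he⟩ := dvd_prod_of_mem D (mem_univ i)
    refine ⟨e * z, ?_⟩
    rw [he]; push_cast; rw [← hz]; ring
  · refine (h i l (by omega)).2.trans ?_
    have h1 : A i ^ (b + c + 1) * (b + c).factorial ^ κ i ≤ (M ^ (m + 1)) ^ b * b.factorial ^ (κ' * (m + 1)) := by
      refine (hbd i b hb).trans (Nat.mul_le_mul ?_ ?_)
      · exact Nat.pow_le_pow_left (Nat.le_self_pow (by omega) _) _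
      · exact Nat.pow_le_pow_right (Nat.factorial_pos _) (Nat.le_mul_of_pos_right _ (by omega))
    exact_mod_cast h1

end EDescent

namespace EDescent

open Finset PowerSeries
variable {H : ℕ}

theorem coeff_tau_one (p : Polynomial ℚ) (n l : ℕ) (hp : p.natDegree ≤ n) :
    coeff l (tau 1 p) = ∑ k ∈ range (n + 1), (k.choose l : ℚ) * p.coeff k := by
  rw [tau_apply, Polynomial.coeff_coe, Polynomial.taylor_coeff, Polynomial.hasseDeriv_apply,
    Polynomial.sum_over_range' p (by simp) (n + 1) (by omega), Polynomial.eval_finsetSum]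
  exact sum_congr rfl fun k _ => by simp

theorem exists_int_coeff_tau_one (p : Polynomial ℚ) (n M : ℕ) (hp : p.natDegree ≤ n)
    (hM : ∀ k, ∃ z : ℤ, p.coeff k = z ∧ |z| ≤ M) (l : ℕ) :
    ∃ z : ℤ, coeff l (tau 1 p) = z ∧ |z| ≤ (n + 1) * (2 ^ n * M) := by
  choose z hz hzM using hM
  refine ⟨∑ k ∈ range (n + 1), (k.choose l : ℤ) * z k, ?_, ?_⟩
  · rw [coeff_tau_one p n l hp]
    push_cast
    exact sum_congr rfl fun k _ => by rw [hz]
  · refine (abs_sum_le_sum_abs _ _).trans ?_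
    have h1 : ∀ k ∈ range (n + 1), |(k.choose l : ℤ) * z k| ≤ 2 ^ n * M := fun k hk => by
      rw [abs_mul, Nat.abs_cast]
      have h2 : ((k.choose l : ℕ) : ℤ) ≤ 2 ^ n := by
        exact_mod_cast (Nat.choose_le_two_pow k l).trans
          (Nat.pow_le_pow_right (by norm_num) (by have := mem_range.1 hk; omega))
      exact mul_le_mul h2 (hzM k) (abs_nonneg _) (by positivity)
    refine (sum_le_sum h1).trans (le_of_eq ?_)
    rw [sum_const, card_range, nsmul_eq_mul]; push_cast; ring

theorem exists_int_coeff_pairing (P : Fin H → Polynomial ℚ) (y : Fin H → ℚ⟦X⟧) (D R l : ℕ) (S : ℚ)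
    (hP : ∀ i k, ∃ z : ℤ, coeff k (tau 1 (P i)) = z ∧ |z| ≤ R)
    (hy : ∀ k ≤ l, ∀ i, (∃ z : ℤ, (D : ℚ) * coeff k (y i) = z) ∧ |coeff k (y i)| ≤ S) :
    ∃ z : ℤ, (D : ℚ) * coeff l (pairing (tau 1) P y) = z ∧ |(z : ℚ)| ≤ D * (H * ((l + 1) * (R * S))) := by
  choose u hu huR using hP
  have : ∀ k i, ∃ z : ℤ, k ≤ l → (D : ℚ) * coeff k (y i) = z := fun k i => by
    by_cases hk : k ≤ l
    · obtain ⟨z, hz⟩ := (hy k hk i).1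
      exact ⟨z, fun _ => hz⟩
    · exact ⟨0, fun h => absurd h hk⟩
  choose v hv using this
  have h1 : coeff l (pairing (tau 1) P y) =
      ∑ i, ∑ q ∈ antidiagonal l, coeff q.1 (tau 1 (P i)) * coeff q.2 (y i) := by
    rw [pairing, map_sum]
    exact sum_congr rfl fun i _ => coeff_mul _ _ _
  have h2 : (D : ℚ) * coeff l (pairing (tau 1) P y) =
      ((∑ i, ∑ q ∈ antidiagonal l, u i q.1 * v q.2 i : ℤ) : ℚ) := by
    rw [h1, mul_sum]
    push_cast
    refine sum_congr rfl fun i _ => ?_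
    rw [mul_sum]
    refine sum_congr rfl fun q hq => ?_
    rw [hu, ← hv q.2 i (by have := mem_antidiagonal.1 hq; omega)]
    ring
  refine ⟨_, h2, ?_⟩
  rw [← h2, abs_mul, Nat.abs_cast, h1]
  refine mul_le_mul_of_nonneg_left ?_ (by positivity)
  have h3 : ∀ i, |∑ q ∈ antidiagonal l, coeff q.1 (tau 1 (P i)) * coeff q.2 (y i)| ≤ (l + 1) * (R * S) :=
    fun i => by
      refine (abs_sum_le_sum_abs _ _).trans ((sum_le_card_nsmul _ _ (R * S) fun q hq => ?_).trans ?_)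
      · rw [abs_mul, hu]
        have h4 : |((u i q.1 : ℤ) : ℚ)| ≤ R := by exact_mod_cast huR i q.1
        exact mul_le_mul h4 (hy q.2 (by have := mem_antidiagonal.1 hq; omega) i).2 (abs_nonneg _) (by positivity)
      · rw [Nat.card_antidiagonal, nsmul_eq_mul]; push_cast; rfl
  refine (abs_sum_le_sum_abs _ _).trans ((sum_le_card_nsmul _ _ _ fun i _ => h3 i).trans ?_)
  rw [card_univ, Fintype.card_fin, nsmul_eq_mul]

theorem norm_det_le_of_column_bound {s : ℕ} (A : Matrix (Fin s) (Fin s) ℂ) (c : Fin s → ℝ)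
    (h : ∀ i j, ‖A i j‖ ≤ c j) : ‖A.det‖ ≤ s.factorial * ∏ j, c j := by
  rw [Matrix.det_apply]
  refine (norm_sum_le _ _).trans ((sum_le_card_nsmul _ _ (∏ j, c j) fun σ _ => ?_).trans ?_)
  · have h1 : ‖Equiv.Perm.sign σ • ∏ i, A (σ i) i‖ = ‖∏ i, A (σ i) i‖ := by
      rcases Int.units_eq_one_or (Equiv.Perm.sign σ) with h | h <;> rw [h] <;> simp
    rw [h1, norm_prod]
    exact prod_le_prod (fun _ _ => norm_nonneg _) fun i _ => h _ _
  · rw [card_univ, Fintype.card_perm, Fintype.card_fin, nsmul_eq_mul]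

theorem det_mul_eq_det_updateCol {s : ℕ} (A : Matrix (Fin s) (Fin s) ℂ) (γ : Fin s → ℂ) (k : Fin s) :
    A.det * γ k = (A.updateCol k (A.mulVec γ)).det := by
  rw [← Matrix.cramer_apply, Matrix.cramer_eq_adjugate_mulVec, Matrix.mulVec_mulVec, Matrix.adjugate_mul,
    Matrix.smul_mulVec, Matrix.one_mulVec, Pi.smul_apply, smul_eq_mul]

theorem factorial_pow_le (a k : ℕ) : a.factorial ^ k ≤ (k * a).factorial := by
  induction k with
  | zero => simp
  | succ k ih =>
    rw [pow_succ, add_mul, one_mul]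
    exact (Nat.mul_le_mul_right _ ih).trans
      (Nat.le_of_dvd (Nat.factorial_pos _) (Nat.factorial_mul_factorial_dvd_factorial_add _ _))

theorem factorial_pow_mul_le (hH : 0 < H) (N b : ℕ) (hN : 2 ≤ N) :
    (N * b).factorial ^ (H - 1) * b.factorial ^ (N - 1) ≤ ((H * N - 1) * b).factorial := by
  have hL0 : (H * N - 1) * b = (H - 1) * (N * b) + (N - 1) * b := by
    obtain ⟨H', rfl⟩ : ∃ H', H = H' + 1 := ⟨H - 1, by omega⟩
    obtain ⟨N', rfl⟩ : ∃ N', N = N' + 1 := ⟨N - 1, by omega⟩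
    rw [show (H' + 1) * (N' + 1) - 1 = H' * (N' + 1) + N' by rw [add_mul]; omega]
    simp only [Nat.add_sub_cancel]
    ring
  rw [hL0]
  exact (Nat.mul_le_mul (factorial_pow_le _ _) (factorial_pow_le _ _)).trans
    (Nat.le_of_dvd (Nat.factorial_pos _) (Nat.factorial_mul_factorial_dvd_factorial_add _ _))

theorem taylorOne_pairing (P : Fin H → Polynomial ℚ) (G : Fin H → ℚ⟦X⟧) (hG : ∀ i, G i ∈ EQ) :
    taylorOne (pairing (tau 0) P G) =
      ∑ i, PowerSeries.map (algebraMap ℚ ℂ) (tau 1 (P i)) * taylorOne (G i) := by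
  simp only [pairing, tau_zero_apply]
  rw [taylorOne_sum _ _ fun i _ => EQ.mul_mem (coe_mem_EQ _) (hG i)]
  exact sum_congr rfl fun i _ => taylorOne_coe_mul _ (hG i)

theorem coeff_taylorOne_pairing {s : ℕ} (P : Fin H → Polynomial ℚ) (G : Fin H → ℚ⟦X⟧)
    (hG : ∀ i, G i ∈ EQ) (y : Fin s → Fin H → ℚ⟦X⟧) (γ : Fin s → ℂ)
    (hexp : ∀ i, taylorOne (G i) = ∑ k, C (γ k) * PowerSeries.map (algebraMap ℚ ℂ) (y k i)) (l : ℕ) :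
    coeff l (taylorOne (pairing (tau 0) P G)) =
      ∑ k, ((coeff l (pairing (tau 1) P (y k)) : ℚ) : ℂ) * γ k := by
  have h : taylorOne (pairing (tau 0) P G) =
      ∑ k, C (γ k) * PowerSeries.map (algebraMap ℚ ℂ) (pairing (tau 1) P (y k)) := by
    rw [taylorOne_pairing P G hG]
    simp only [hexp, pairing, map_sum, mul_sum, map_mul]
    rw [sum_comm]
    exact sum_congr rfl fun k _ => sum_congr rfl fun i _ => by ring
  rw [h, map_sum]
  refine sum_congr rfl fun k _ => ?_
  rw [coeff_C_mul, coeff_map, mul_comm]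
  rfl

end EDescent

namespace EDescent

open Finset PowerSeries
variable {H : ℕ}

theorem absorb_constants (A1 A2 c2 N b l n κ : ℕ) (hb : 0 < b) (hl : l < b + c2)
    (hn : n = N * b) :
    (A2 ^ b * b.factorial ^ κ) * (H * ((l + 1) * (((n + 1) * (2 ^ n * (n.factorial * A1 ^ b))) *
        (A2 ^ b * b.factorial ^ κ)))) ≤
      n.factorial * (H * 2 ^ (c2 + 1) * 2 ^ (N + 1) * 2 ^ N * A1 * A2 * A2) ^ b * b.factorial ^ (2 * κ) := by
  have h1 : l + 1 ≤ (2 ^ (c2 + 1)) ^ b := by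
    have h2 : b + c2 ≤ (c2 + 1) * b := by
      have := Nat.le_mul_of_pos_right c2 hb
      rw [add_mul]; omega
    rw [← pow_mul]
    have := (Nat.lt_two_pow_self (n := b + c2)).trans_le (Nat.pow_le_pow_right (by norm_num) h2)
    omega
  have h2 : n + 1 ≤ (2 ^ (N + 1)) ^ b := by
    have h2 : n + 1 ≤ (N + 1) * b := by rw [hn, add_mul]; omega
    rw [← pow_mul]
    exact h2.trans Nat.lt_two_pow_self.le
  have h3 : H ≤ H ^ b := Nat.le_self_pow (by omega) _
  have h4 : 2 ^ n = (2 ^ N) ^ b := by rw [hn, pow_mul]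
  rw [h4]
  calc _ ≤ (A2 ^ b * b.factorial ^ κ) * (H ^ b * ((2 ^ (c2 + 1)) ^ b * (((2 ^ (N + 1)) ^ b *
        ((2 ^ N) ^ b * (n.factorial * A1 ^ b))) * (A2 ^ b * b.factorial ^ κ)))) := by gcongr
    _ = _ := by
        simp only [mul_pow]
        rw [two_mul, pow_add]; ring

/-- A system of E-functions independent over `ℚ(z)` cannot have Taylor coefficients at `1` spanning a
nonzero rational vector space of dimension smaller than the size of the system. -/
theorem false_of_small_rank (T : Polynomial ℚ) (hT : T ≠ 0)
    (B : Matrix (Fin H) (Fin H) (Polynomial ℚ)) (G : Fin H → ℚ⟦X⟧) (hGE : ∀ i, G i ∈ EQ)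
    (hG : ∀ i, tau 0 T * d⁄dX ℚ (G i) = ∑ j, tau 0 (B i j) * G j)
    (hli : ∀ P : Fin H → Polynomial ℚ, pairing (tau 0) P G = 0 → P = 0)
    {s : ℕ} (hsH : s < H) (y : Fin s → Fin H → ℚ⟦X⟧)
    (hy : ∀ k i, tau 1 T * d⁄dX ℚ (y k i) = ∑ j, tau 1 (B i j) * y k j)
    (hyli : LinearIndependent ℚ y) (γ : Fin s → ℂ) (k0 : Fin s) (hγ : γ k0 ≠ 0)
    (hexp : ∀ i, taylorOne (G i) = ∑ k, C (γ k) * PowerSeries.map (algebraMap ℚ ℂ) (y k i)) : False := by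
  have hH : 0 < H := by omega
  obtain ⟨c1, c2, hnd⟩ := exists_nondegeneracy_bound hH T hT B G hG hli y hy hyli
  obtain ⟨A2, κ, hA2, hden⟩ := exists_family_denominator_bound
    (fun q : Fin s × Fin H => y q.1 q.2) H (fun q => by
      obtain ⟨u, hu, hu'⟩ := exists_scalar_equation T hT B (tau 1) (derivative_tau 1) (y q.1) (hy q.1) q.2
      refine ⟨fun j => Polynomial.taylor 1 (u j), ?_, hu'⟩
      obtain ⟨j, hj, hj'⟩ := hu
      exact ⟨j, hj, fun h0 => hj' (Polynomial.taylor_injective 1 (h0.trans (map_zero _).symm))⟩) c2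
  obtain ⟨N, hN⟩ : ∃ N, N = 2 * κ * (H - 1) + 2 := ⟨_, rfl⟩
  have hN2 : 2 ≤ N := by omega
  obtain ⟨A1, hA1, haux⟩ := exists_auxiliary_form G hGE hH N hN2
  obtain ⟨A3, hA3⟩ : ∃ A3, A3 = H * 2 ^ (c2 + 1) * 2 ^ (N + 1) * 2 ^ N * A1 * A2 * A2 := ⟨_, rfl⟩
  have hA30 : 0 < A3 := by rw [hA3]; positivity
  have key : ∀ b, 0 < b → c1 ≤ b → ‖γ k0‖ ≤ s.factorial * (((A3 ^ (H - 1) : ℕ) : ℝ) ^ b / b.factorial) := by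
    intro b hb hbc
    obtain ⟨P, hP0, hPdeg, hPz, hPX, hPε⟩ := haux b hb
    obtain ⟨D, hD0, hD, hDz⟩ := hden b hb
    obtain ⟨n, hn⟩ : ∃ n, n = N * b := ⟨_, rfl⟩
    obtain ⟨Q, hQ⟩ : ∃ Q, Q = n.factorial * A3 ^ b * b.factorial ^ (2 * κ) := ⟨_, rfl⟩
    have hQ0 : 0 < Q := by rw [hQ]; positivity
    rw [← hn] at hPdeg hPz hPε
    have hz : ∀ (l : Fin (b + c2)) (k : Fin s), ∃ z : ℤ,
        (D : ℚ) * coeff l (pairing (tau 1) P (y k)) = z ∧ |z| ≤ Q := fun l k => by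
      obtain ⟨z, hz, hzb⟩ := exists_int_coeff_pairing P (y k) D ((n + 1) * (2 ^ n * (n.factorial * A1 ^ b))) l
        ((A2 : ℚ) ^ b * (b.factorial : ℚ) ^ κ)
        (fun i m => by
          obtain ⟨z, hz, hzb⟩ := exists_int_coeff_tau_one (P i) n (n.factorial * A1 ^ b) (hPdeg i)
            (fun k => by simpa using hPz i k) m
          exact ⟨z, hz, by exact_mod_cast hzb⟩)
        (fun m hm i => hDz m (by omega) (k, i))
      refine ⟨z, hz, ?_⟩
      have h1 : |(z : ℚ)| ≤ (((A2 ^ b * b.factorial ^ κ) * (H * ((l + 1) *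
          (((n + 1) * (2 ^ n * (n.factorial * A1 ^ b))) * (A2 ^ b * b.factorial ^ κ)))) : ℕ) : ℚ) := by
        refine hzb.trans ?_
        push_cast
        have : (D : ℚ) ≤ (A2 : ℚ) ^ b * (b.factorial : ℚ) ^ κ := by exact_mod_cast hD
        gcongr
      have h2 := absorb_constants (H := H) A1 A2 c2 N b l n κ hb l.2 hn
      rw [← hA3, ← hQ] at h2
      have h3 : |(z : ℚ)| ≤ (Q : ℚ) := h1.trans (by exact_mod_cast h2)
      exact_mod_cast h3
    choose z hz hzQ using hz
    let M : Matrix (Fin s) (Fin (b + c2)) ℤ := Matrix.of fun k l => z l k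
    have hMli : LinearIndependent ℤ M.row := by
      rw [Fintype.linearIndependent_iff]
      intro a ha
      have h1 := hnd N b hN2 hbc P hP0 (hn ▸ hPdeg) hPX (fun k => (a k : ℚ)) (fun l hl => by
        have h2 := congrFun ha ⟨l, hl⟩
        simp only [Finset.sum_apply, Pi.smul_apply, smul_eq_mul, Pi.zero_apply, Matrix.row, M,
          Matrix.of_apply] at h2
        have h3 : (D : ℚ) * ∑ k, (a k : ℚ) * coeff l (pairing (tau 1) P (y k)) = 0 := by
          rw [mul_sum]
          have h4 : ((∑ k, a k * z ⟨l, hl⟩ k : ℤ) : ℚ) = 0 := by rw [h2]; simp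
          rw [← h4]
          push_cast
          refine sum_congr rfl fun k _ => ?_
          rw [← hz ⟨l, hl⟩ k]; ring
        have hD' : (D : ℚ) ≠ 0 := by exact_mod_cast hD0.ne'
        simpa [hD'] using h3)
      intro k
      have := congrFun h1 k
      simpa using this
    obtain ⟨e, he⟩ := exists_minor_ne_zero M hMli
    let R : Matrix (Fin s) (Fin s) ℂ := Matrix.of fun i k => ((z (e i) k : ℤ) : ℂ)
    have hRdet : R.det = (((M.submatrix id e).det : ℤ) : ℂ) := by
      rw [← Matrix.det_transpose (M.submatrix id e)]
      exact (Int.cast_det _).symm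
    have hR1 : 1 ≤ ‖R.det‖ := by
      rw [hRdet, Complex.norm_intCast]
      exact_mod_cast Int.one_le_abs he
    have hε : ∀ i, ‖R.mulVec γ i‖ ≤ Q / ((H * N - 1) * b).factorial := fun i => by
      have h1 : R.mulVec γ i = (D : ℂ) * coeff (e i : ℕ) (taylorOne (pairing (tau 0) P G)) := by
        rw [coeff_taylorOne_pairing P G hGE y γ hexp, mul_sum, Matrix.mulVec, dotProduct]
        refine sum_congr rfl fun k _ => ?_
        have := congrArg (fun q : ℚ => (q : ℂ)) (hz (e i) k)
        simp only [Rat.cast_mul, Rat.cast_natCast, Rat.cast_intCast] at this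
        simp only [R, Matrix.of_apply]
        rw [← this]; ring
      rw [h1, norm_mul, Complex.norm_natCast]
      have h2 : D * (n.factorial * A1 ^ b) ≤ Q := by
        have h3 := absorb_constants (H := H) A1 A2 c2 N b 0 n κ hb (by omega) hn
        rw [← hA3, ← hQ] at h3
        refine le_trans ?_ h3
        have h5 : 1 ≤ H * ((0 + 1) * ((n + 1) * 2 ^ n * (A2 ^ b * b.factorial ^ κ))) :=
          Nat.one_le_iff_ne_zero.2 (by positivity)
        calc D * (n.factorial * A1 ^ b) ≤ (A2 ^ b * b.factorial ^ κ) * (n.factorial * A1 ^ b) := by gcongr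
          _ ≤ (A2 ^ b * b.factorial ^ κ) * (n.factorial * A1 ^ b) *
              (H * ((0 + 1) * ((n + 1) * 2 ^ n * (A2 ^ b * b.factorial ^ κ)))) :=
              Nat.le_mul_of_pos_right _ h5
          _ = _ := by ring
      calc (D : ℝ) * ‖coeff (e i : ℕ) (taylorOne (pairing (tau 0) P G))‖
          ≤ D * (n.factorial * (A1 : ℝ) ^ b / ((H * N - 1) * b).factorial) := by
            have := hPε (e i)
            gcongr
        _ = ((D * (n.factorial * A1 ^ b) : ℕ) : ℝ) / ((H * N - 1) * b).factorial := by push_cast; ring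
        _ ≤ _ := by gcongr
    have hcr : ‖R.det * γ k0‖ ≤ s.factorial * ((Q : ℝ) ^ s / ((H * N - 1) * b).factorial) := by
      rw [det_mul_eq_det_updateCol]
      refine (norm_det_le_of_column_bound _
        (Function.update (fun _ => (Q : ℝ)) k0 (Q / ((H * N - 1) * b).factorial)) fun i j => ?_).trans ?_
      · by_cases hj : j = k0
        · subst hj
          rw [Matrix.updateCol_self, Function.update_self]
          exact hε i
        · rw [Matrix.updateCol_ne hj, Function.update_of_ne hj]
          simp only [R, Matrix.of_apply, Complex.norm_intCast]
          exact_mod_cast hzQ (e i) j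
      · rw [prod_update_of_mem (mem_univ k0), prod_const, ← erase_eq, card_erase_of_mem (mem_univ k0),
          card_univ, Fintype.card_fin]
        obtain ⟨s', rfl⟩ : ∃ s', s = s' + 1 := ⟨s - 1, by have := k0.2; omega⟩
        rw [Nat.add_sub_cancel, pow_succ]
        refine le_of_eq ?_
        ring
    have hQs : (Q : ℝ) ^ s / ((H * N - 1) * b).factorial ≤ ((A3 ^ (H - 1) : ℕ) : ℝ) ^ b / b.factorial := by
      rw [div_le_div_iff₀ (by positivity) (by positivity)]
      have h1 : Q ^ s ≤ Q ^ (H - 1) := Nat.pow_le_pow_right hQ0 (by omega)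
      have h2 := factorial_pow_mul_le hH N b hN2
      rw [← hn] at h2
      have h3 : Q ^ s * b.factorial ≤ (A3 ^ (H - 1)) ^ b * ((H * N - 1) * b).factorial := by
        calc Q ^ s * b.factorial ≤ Q ^ (H - 1) * b.factorial := Nat.mul_le_mul_right _ h1
          _ = (A3 ^ (H - 1)) ^ b * (n.factorial ^ (H - 1) * b.factorial ^ (N - 1)) := by
              rw [hQ, show N - 1 = 2 * κ * (H - 1) + 1 by omega, pow_succ, pow_mul, mul_pow, mul_pow,
                ← pow_mul, ← pow_mul A3, mul_comm b]
              ring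
          _ ≤ _ := Nat.mul_le_mul_left _ h2
      exact_mod_cast h3
    calc ‖γ k0‖ ≤ ‖R.det‖ * ‖γ k0‖ := le_mul_of_one_le_left (norm_nonneg _) hR1
      _ = ‖R.det * γ k0‖ := (norm_mul _ _).symm
      _ ≤ _ := hcr
      _ ≤ _ := by gcongr
  have hlim := (FloorSemiring.tendsto_pow_div_factorial_atTop (((A3 ^ (H - 1) : ℕ) : ℝ))).const_mul
    (s.factorial : ℝ)
  rw [mul_zero] at hlim
  have hle : ‖γ k0‖ ≤ 0 := ge_of_tendsto hlim (Filter.eventually_atTop.2 ⟨c1 + 1, fun b hb =>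
    key b (by omega) (by omega)⟩)
  exact hγ (norm_le_zero_iff.1 hle)

end EDescent

namespace EDescent

open Finset PowerSeries
variable {H : ℕ}

/-- Solutions of a linear system that are independent over the constants are independent over the field of
Laurent series. -/
theorem linearIndependent_solutions (T : Polynomial ℚ) (hT : T ≠ 0)
    (B : Matrix (Fin H) (Fin H) (Polynomial ℚ)) {s : ℕ} (y : Fin s → Fin H → ℚ⟦X⟧)
    (hy : ∀ k i, tau 1 T * d⁄dX ℚ (y k i) = ∑ j, tau 1 (B i j) * y k j)
    (hyli : LinearIndependent ℚ y) :
    LinearIndependent (LS ℚ) fun k i => LS.ofPS ℚ (y k i) := by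
  have hT' : LS.ofPS ℚ (tau 1 T) ≠ 0 := fun h =>
    hT (tau_injective 1 (LS.ofPS_injective (by rw [h, map_zero, map_zero])))
  let D : (Fin H → LS ℚ) →+ (Fin H → LS ℚ) :=
    { toFun := fun v i => lsDeriv ℚ (v i) - (LS.ofPS ℚ (tau 1 T))⁻¹ * ∑ j, LS.ofPS ℚ (tau 1 (B i j)) * v j
      map_zero' := by funext i; simp
      map_add' := fun u v => by
        funext i
        simp only [Pi.add_apply, map_add, mul_add, sum_add_distrib]
        ring }
  refine linearIndependent_of_constants (C := ℚ) (lsDeriv ℚ : LS ℚ →+ LS ℚ) (fun a h => lsDeriv_eq_zero a h) D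
    (fun a v => ?_) _ (fun k => ?_) ?_
  · funext i
    change lsDeriv ℚ (a * v i) - (LS.ofPS ℚ (tau 1 T))⁻¹ * ∑ j, LS.ofPS ℚ (tau 1 (B i j)) * (a * v j) =
      lsDeriv ℚ a * v i + a * (lsDeriv ℚ (v i) - (LS.ofPS ℚ (tau 1 T))⁻¹ *
        ∑ j, LS.ofPS ℚ (tau 1 (B i j)) * v j)
    rw [Derivation.leibniz, smul_eq_mul, smul_eq_mul,
      show ∑ j, LS.ofPS ℚ (tau 1 (B i j)) * (a * v j) = a * ∑ j, LS.ofPS ℚ (tau 1 (B i j)) * v j by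
        rw [mul_sum]; exact sum_congr rfl fun j _ => by ring]
    ring
  · funext i
    change lsDeriv ℚ (LS.ofPS ℚ (y k i)) - (LS.ofPS ℚ (tau 1 T))⁻¹ *
      ∑ j, LS.ofPS ℚ (tau 1 (B i j)) * LS.ofPS ℚ (y k j) = 0
    have h := congrArg (LS.ofPS ℚ) (hy k i)
    rw [map_mul, map_sum] at h
    simp only [map_mul] at h
    rw [← h, lsDeriv_ofPS, inv_mul_cancel_left₀ hT', sub_self]
  · rw [Fintype.linearIndependent_iff] at hyli ⊢
    intro a ha
    refine hyli a (funext fun i => LS.ofPS_injective ?_)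
    have h := congrFun ha i
    simp only [Finset.sum_apply, Pi.smul_apply, Pi.zero_apply, map_sum, LS.ofPS_smul, map_zero] at h ⊢
    exact h

/-- Apply a rational functional to the coefficients of a power series. -/
def coeffMap (c : ℂ →ₗ[ℚ] ℚ) (f : ℂ⟦X⟧) : ℚ⟦X⟧ := PowerSeries.mk fun l => c (coeff l f)

theorem coeff_coeffMap (c : ℂ →ₗ[ℚ] ℚ) (f : ℂ⟦X⟧) (l : ℕ) : coeff l (coeffMap c f) = c (coeff l f) :=
  coeff_mk _ _

theorem coeffMap_map_mul (c : ℂ →ₗ[ℚ] ℚ) (p : ℚ⟦X⟧) (f : ℂ⟦X⟧) :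
    coeffMap c (PowerSeries.map (algebraMap ℚ ℂ) p * f) = p * coeffMap c f := by
  ext l
  rw [coeff_coeffMap, coeff_mul, coeff_mul, map_sum]
  refine sum_congr rfl fun q _ => ?_
  rw [coeff_map, coeff_coeffMap, ← Algebra.smul_def, map_smul, smul_eq_mul]

theorem coeffMap_sum (c : ℂ →ₗ[ℚ] ℚ) {ι : Type*} (s : Finset ι) (f : ι → ℂ⟦X⟧) :
    coeffMap c (∑ i ∈ s, f i) = ∑ i ∈ s, coeffMap c (f i) := by
  ext l
  simp only [coeff_coeffMap, map_sum]

theorem coeffMap_derivative (c : ℂ →ₗ[ℚ] ℚ) (f : ℂ⟦X⟧) :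
    coeffMap c (d⁄dX ℂ f) = d⁄dX ℚ (coeffMap c f) := by
  ext l
  rw [coeff_coeffMap, coeff_derivative, coeff_derivative, coeff_coeffMap]
  have h : coeff (l + 1) f * ((l : ℂ) + 1) = ((l : ℚ) + 1) • coeff (l + 1) f := by
    rw [Algebra.smul_def, mul_comm]; simp
  rw [h, map_smul, smul_eq_mul, mul_comm]

theorem taylorOne_system (T : Polynomial ℚ)
    (B : Matrix (Fin H) (Fin H) (Polynomial ℚ)) (G : Fin H → ℚ⟦X⟧) (hGE : ∀ i, G i ∈ EQ)
    (hG : ∀ i, tau 0 T * d⁄dX ℚ (G i) = ∑ j, tau 0 (B i j) * G j) (i : Fin H) :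
    PowerSeries.map (algebraMap ℚ ℂ) (tau 1 T) * d⁄dX ℂ (taylorOne (G i)) =
      ∑ j, PowerSeries.map (algebraMap ℚ ℂ) (tau 1 (B i j)) * taylorOne (G j) := by
  have h := congrArg taylorOne (hG i)
  simp only [tau_zero_apply] at h
  rw [taylorOne_coe_mul _ (derivative_mem_EQ (hGE i)), taylorOne_derivative (hGE i),
    taylorOne_sum _ _ fun j _ => EQ.mul_mem (coe_mem_EQ _) (hGE j)] at h
  rw [h]
  exact sum_congr rfl fun j _ => taylorOne_coe_mul _ (hGE j)

theorem exists_dual_functionals {s : ℕ} (γ : Fin s → ℂ) (hγ : LinearIndependent ℚ γ) :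
    ∃ c : Fin s → (ℂ →ₗ[ℚ] ℚ), ∀ j k, c j (γ k) = if k = j then 1 else 0 := by
  let b := Module.Basis.span hγ
  choose c hc using fun j => LinearMap.exists_extend (b.coord j)
  refine ⟨c, fun j k => ?_⟩
  have h1 : (γ k) = ((Submodule.span ℚ (Set.range γ)).subtype (b k)) := by
    simp [b, Module.Basis.span_apply]
  rw [h1, ← LinearMap.comp_apply, hc, Module.Basis.coord_apply, Module.Basis.repr_self, Finsupp.single_apply]

/-- Beukers' lifting in matrix form: the Taylor expansions at `1` of a system of E-functions independent over
`ℚ(z)` are combinations of a rational fundamental matrix with rationally independent coefficients. -/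
theorem exists_rational_fundamental_matrix (T : Polynomial ℚ) (hT : T ≠ 0)
    (B : Matrix (Fin H) (Fin H) (Polynomial ℚ)) (G : Fin H → ℚ⟦X⟧) (hGE : ∀ i, G i ∈ EQ)
    (hG : ∀ i, tau 0 T * d⁄dX ℚ (G i) = ∑ j, tau 0 (B i j) * G j)
    (hli : ∀ P : Fin H → Polynomial ℚ, pairing (tau 0) P G = 0 → P = 0)
    (hne : ∃ i, taylorOne (G i) ≠ 0) :
    ∃ (γ : Fin H → ℂ) (Y : Matrix (Fin H) (Fin H) ℚ⟦X⟧), LinearIndependent ℚ γ ∧ Y.det ≠ 0 ∧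
      (∀ i k, tau 1 T * d⁄dX ℚ (Y i k) = ∑ j, tau 1 (B i j) * Y j k) ∧
      ∀ i, taylorOne (G i) = ∑ k, C (γ k) * PowerSeries.map (algebraMap ℚ ℂ) (Y i k) := by
  let Γ : Submodule ℚ ℂ := Submodule.span ℚ (Set.range fun q : ℕ × Fin H => coeff q.1 (taylorOne (G q.2)))
  have hmem : ∀ l i, coeff l (taylorOne (G i)) ∈ Γ := fun l i => Submodule.subset_span ⟨(l, i), rfl⟩
  have hsol : ∀ c : ℂ →ₗ[ℚ] ℚ, ∀ i, tau 1 T * d⁄dX ℚ (coeffMap c (taylorOne (G i))) =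
      ∑ j, tau 1 (B i j) * coeffMap c (taylorOne (G j)) := fun c i => by
    have h := congrArg (coeffMap c) (taylorOne_system T B G hGE hG i)
    rw [coeffMap_map_mul, coeffMap_derivative, coeffMap_sum] at h
    simpa only [coeffMap_map_mul] using h
  have hind : ∀ {s : ℕ} (γ : Fin s → ℂ), (∀ k, γ k ∈ Γ) → ∀ c : Fin s → (ℂ →ₗ[ℚ] ℚ),
      (∀ j k, c j (γ k) = if k = j then 1 else 0) →
      LinearIndependent ℚ fun k i => coeffMap (c k) (taylorOne (G i)) := fun {s} γ hγ c hc => by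
    rw [Fintype.linearIndependent_iff]
    intro a ha
    have h1 : Γ ≤ LinearMap.ker (∑ k, a k • c k) := by
      refine Submodule.span_le.2 ?_
      rintro _ ⟨⟨l, i⟩, rfl⟩
      have h2 := congrArg (coeff l) (congrFun ha i)
      simp only [Finset.sum_apply, Pi.smul_apply, Pi.zero_apply, map_sum, map_zero, map_smul,
        coeff_coeffMap] at h2
      simpa [LinearMap.sum_apply] using h2
    intro k
    have h3 := h1 (hγ k)
    simpa [LinearMap.sum_apply, hc] using h3
  have hcard : ∀ {s : ℕ} (γ : Fin s → ℂ), (∀ k, γ k ∈ Γ) → LinearIndependent ℚ γ → s ≤ H :=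
    fun {s} γ hγ hγli => by
      obtain ⟨c, hc⟩ := exists_dual_functionals γ hγli
      have h := (linearIndependent_solutions T hT B _ (fun k => hsol (c k)) (hind γ hγ c hc)).fintype_card_le_finrank
      simpa using h
  have hrank : Module.rank ℚ Γ ≤ (H : Cardinal) := by
    refine rank_le fun S hS => ?_
    have h1 := hcard (s := S.card) (fun k => ((S.equivFin.symm k : Γ) : ℂ)) (fun k => Subtype.coe_prop _)
      ((hS.comp _ S.equivFin.symm.injective).map' Γ.subtype (Submodule.ker_subtype _))
    exact h1
  have hfd : FiniteDimensional ℚ Γ := by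
    rw [FiniteDimensional, ← Module.rank_lt_aleph0_iff]
    exact hrank.trans_lt (Cardinal.natCast_lt_aleph0)
  obtain ⟨s, hs⟩ : ∃ s, s = Module.finrank ℚ Γ := ⟨_, rfl⟩
  let b := (Module.finBasis ℚ Γ).reindex (finCongr hs.symm)
  let γ : Fin s → ℂ := fun k => b k
  have hγΓ : ∀ k, γ k ∈ Γ := fun k => (b k).2
  have hγli : LinearIndependent ℚ γ := b.linearIndependent.map' Γ.subtype (Submodule.ker_subtype _)
  obtain ⟨c, hc⟩ := exists_dual_functionals γ hγli
  have hrep : ∀ x ∈ Γ, x = ∑ k, γ k * ((c k x : ℚ) : ℂ) := fun x hx => by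
    have h1 := b.sum_repr ⟨x, hx⟩
    have h2 : x = ∑ k, (b.repr ⟨x, hx⟩ k) • γ k := by
      have := congrArg (fun v : Γ => (v : ℂ)) h1
      simp only [Submodule.coe_sum, Submodule.coe_smul] at this
      exact this.symm
    have h3 : ∀ k, c k x = b.repr ⟨x, hx⟩ k := fun k => by
      conv_lhs => rw [h2]
      simp [hc]
    simp only [h3]
    conv_lhs => rw [h2]
    exact sum_congr rfl fun k _ => by rw [Algebra.smul_def, mul_comm]; rfl
  have hexp : ∀ i, taylorOne (G i) =
      ∑ k, C (γ k) * PowerSeries.map (algebraMap ℚ ℂ) (coeffMap (c k) (taylorOne (G i))) := fun i => by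
    ext l
    rw [map_sum]
    conv_lhs => rw [hrep _ (hmem l i)]
    refine sum_congr rfl fun k _ => ?_
    rw [coeff_C_mul, coeff_map, coeff_coeffMap]
    rfl
  have hspos : 0 < s := by
    by_contra h0
    obtain ⟨i, hi⟩ := hne
    have : IsEmpty (Fin s) := by
      rw [show s = 0 by omega]; infer_instance
    exact hi (by rw [hexp i, univ_eq_empty, sum_empty])
  have hle := hcard γ hγΓ hγli
  have heq : s = H := by
    by_contra hne'
    exact false_of_small_rank T hT B G hGE hG hli (lt_of_le_of_ne hle hne')
      (fun k i => coeffMap (c k) (taylorOne (G i))) (fun k => hsol (c k)) (hind γ hγΓ c hc) γ ⟨0, hspos⟩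
      (hγli.ne_zero _) hexp
  clear_value γ b
  subst heq
  refine ⟨γ, Matrix.of fun i k => coeffMap (c k) (taylorOne (G i)), hγli, fun h0 => ?_,
    fun i k => hsol (c k) i, hexp⟩
  have hL := linearIndependent_solutions T hT B _ (fun k => hsol (c k)) (hind γ hγΓ c hc)
  have hu := (Matrix.linearIndependent_rows_iff_isUnit
    (A := Matrix.of fun k i => LS.ofPS ℚ (coeffMap (c k) (taylorOne (G i))))).1 hL
  rw [Matrix.isUnit_iff_isUnit_det] at hu
  refine hu.ne_zero ?_
  rw [← Matrix.det_transpose] at h0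
  have := congrArg (LS.ofPS ℚ) h0
  rw [RingHom.map_det, map_zero] at this
  exact this

end EDescent

namespace EDescent

open Finset PowerSeries
open scoped TensorProduct

/-- An irreducible polynomial over `k` stays irreducible over an extension in which `k` is
algebraically closed. -/
theorem irreducible_map_of_algebraicallyClosedIn {k E : Type*} [Field k] [Field E] [Algebra k E]
    (h : ∀ x : E, IsAlgebraic k x → x ∈ (algebraMap k E).range) {p : Polynomial k} (hm : p.Monic)
    (hp : Irreducible p) : Irreducible (p.map (algebraMap k E)) := by
  rw [(hm.map _).irreducible_iff_natDegree']
  refine ⟨fun h1 => hp.ne_one ?_, fun f g hf hg hfg => ?_⟩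
  · exact (Polynomial.map_injective _ (algebraMap k E).injective) (by simpa using h1)
  have key : ∀ f : Polynomial E, f.Monic → f ∣ p.map (algebraMap k E) →
      ∃ f0 : Polynomial k, f0.map (algebraMap k E) = f := fun f hf hd => by
    have h1 := integralClosure.mem_lifts_of_monic_of_dvd_map E hm hf hd
    have h2 : f ∈ Polynomial.lifts (algebraMap k E) := by
      rw [Polynomial.lifts_iff_coeff_lifts] at h1 ⊢
      intro n
      obtain ⟨y, hy⟩ := h1 n
      rw [← hy]
      exact h _ (IsIntegral.isAlgebraic y.2)
    exact (Polynomial.mem_lifts _).1 h2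
  obtain ⟨f0, rfl⟩ := key f hf ⟨g, hfg.symm⟩
  obtain ⟨g0, rfl⟩ := key g hg ⟨_, by rw [mul_comm]; exact hfg.symm⟩
  rw [← Polynomial.map_mul] at hfg
  have h3 := Polynomial.map_injective _ (algebraMap k E).injective hfg
  have hg0 : g0.Monic := Polynomial.monic_of_injective (algebraMap k E).injective hg
  have hf0 : f0.Monic := Polynomial.monic_of_injective (algebraMap k E).injective hf
  rw [Polynomial.natDegree_map, Polynomial.natDegree_map]
  have := (hm.irreducible_iff_natDegree'.1 hp).2 f0 g0 hf0 hg0 h3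
  exact this

theorem isDomain_tensorProduct_of_finite {k E k' : Type*} [Field k] [CharZero k] [Field E] [Algebra k E]
    (h : ∀ x : E, IsAlgebraic k x → x ∈ (algebraMap k E).range)
    [Field k'] [Algebra k k'] [FiniteDimensional k k'] : IsDomain (E ⊗[k] k') := by
  obtain ⟨θ, hθ⟩ := Field.exists_primitive_element k k'
  have hInt : IsIntegral k θ := IsIntegral.of_finite k θ
  let p := minpoly k θ
  let q := p.map (algebraMap k E)
  have hq : Irreducible q := irreducible_map_of_algebraicallyClosedIn h (minpoly.monic hInt)
    (minpoly.irreducible hInt)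
  have : Fact (Irreducible q) := ⟨hq⟩
  let pb : PowerBasis k k' :=
    (IntermediateField.adjoin.powerBasis hInt).map
      ((IntermediateField.equivOfEq hθ).trans IntermediateField.topEquiv)
  have hgen : pb.gen = θ := by
    simp only [pb, PowerBasis.map_gen, IntermediateField.adjoin.powerBasis_gen]
    rfl
  let ψ : k' →ₐ[k] AdjoinRoot q := pb.lift (AdjoinRoot.root q) (by
    rw [hgen]
    have h1 := AdjoinRoot.eval₂_root q
    rw [Polynomial.eval₂_map] at h1
    rw [Polynomial.aeval_def]
    exact h1)
  have hψ : ψ θ = AdjoinRoot.root q := by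
    rw [← hgen]; exact pb.lift_gen _ _
  let φ : E ⊗[k] k' →ₐ[E] AdjoinRoot q :=
    Algebra.TensorProduct.lift (Algebra.ofId E _) ψ (fun _ _ => mul_comm _ _)
  have hsurj : Function.Surjective φ := by
    rw [← AlgHom.range_eq_top, eq_top_iff, ← AdjoinRoot.adjoinRoot_eq_top (f := q)]
    refine Algebra.adjoin_le ?_
    rintro _ rfl
    exact ⟨1 ⊗ₜ θ, ((Algebra.TensorProduct.lift_tmul ..).trans (by rw [map_one, one_mul])).trans hψ⟩
  have hfin : FiniteDimensional E (AdjoinRoot q) := (AdjoinRoot.powerBasis hq.ne_zero).finite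
  have hrank : Module.finrank E (E ⊗[k] k') = Module.finrank E (AdjoinRoot q) := by
    rw [Module.finrank_baseChange, (AdjoinRoot.powerBasis hq.ne_zero).finrank, pb.finrank,
      AdjoinRoot.powerBasis_dim, Polynomial.natDegree_map]
    rfl
  have hinj : Function.Injective φ :=
    (LinearMap.injective_iff_surjective_of_finrank_eq_finrank (f := φ.toLinearMap) hrank).2 hsurj
  exact hinj.isDomain φ.toRingHom

theorem exists_finite_specialization.{u, v} {k : Type u} {M : Type v} [Field k] [Field M] [Algebra k M] (B : Subalgebra k M)
    (hB : B.FG) (x : B) (hx : IsUnit x) :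
    ∃ (k' : Type v) (_ : Field k') (_ : Algebra k k') (ψ : B →ₐ[k] k'),
      FiniteDimensional k k' ∧ ψ x ≠ 0 := by
  have hft : Algebra.FiniteType k B := Subalgebra.fg_iff_finiteType B |>.1 hB
  obtain ⟨m, hm⟩ := Ideal.exists_maximal B
  let _ := Ideal.Quotient.field m
  exact ⟨B ⧸ m, inferInstance, inferInstance, Ideal.Quotient.mkₐ k m,
    finite_of_finite_type_of_isJacobsonRing k (B ⧸ m), (hx.map (Ideal.Quotient.mkₐ k m)).ne_zero⟩

theorem basis_repr_sum_tmul {k E R ι : Type*} [Field k] [CommRing E] [Algebra k E] [CommRing R] [Algebra k R]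
    [DecidableEq ι] (b : Module.Basis ι k E) (s : Finset ι) (c : ι → R) (l : ι) :
    (Algebra.TensorProduct.basis R b).repr (∑ i ∈ s, c i ⊗ₜ[k] b i) l = if l ∈ s then c l else 0 := by
  have h1 : ∀ i, (Algebra.TensorProduct.basis R b).repr (c i ⊗ₜ[k] b i) l = if i = l then c i else 0 :=
    fun i => by
      have : c i ⊗ₜ[k] b i = c i • Algebra.TensorProduct.basis R b i := by
        simp [TensorProduct.smul_tmul']
      rw [this, map_smul, Module.Basis.repr_self, Finsupp.smul_apply, Finsupp.single_apply]
      split_ifs <;> simp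
  rw [map_sum, Finsupp.finsetSum_apply]
  simp only [h1]
  rw [sum_ite_eq']

theorem tensorProduct_eq_zero_or_eq_zero {k E M : Type*} [Field k] [CharZero k] [Field E] [Algebra k E]
    (h : ∀ x : E, IsAlgebraic k x → x ∈ (algebraMap k E).range)
    [Field M] [Algebra k M] (u v : M ⊗[k] E) (huv : u * v = 0) : u = 0 ∨ v = 0 := by
  classical
  by_contra! hne
  obtain ⟨hu, hv⟩ := hne
  let bE := Module.Basis.ofVectorSpace k E
  let bM := Algebra.TensorProduct.basis M bE
  obtain ⟨i, hi⟩ : ∃ i, bM.repr u i ≠ 0 := by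
    by_contra! h0
    exact hu (bM.repr.map_eq_zero_iff.1 (Finsupp.ext h0))
  obtain ⟨j, hj⟩ : ∃ j, bM.repr v j ≠ 0 := by
    by_contra! h0
    exact hv (bM.repr.map_eq_zero_iff.1 (Finsupp.ext h0))
  let S : Finset M := insert (bM.repr u i * bM.repr v j)⁻¹
    (((bM.repr u).support.image (bM.repr u)) ∪ ((bM.repr v).support.image (bM.repr v)))
  let B := Algebra.adjoin k (S : Set M)
  have hinvB : (bM.repr u i * bM.repr v j)⁻¹ ∈ B := Algebra.subset_adjoin (by simp [S])
  have huB : ∀ l, bM.repr u l ∈ B := fun l => by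
    by_cases hl : bM.repr u l = 0
    · rw [hl]; exact B.zero_mem
    · exact Algebra.subset_adjoin (by
        simp only [S, coe_insert, coe_union, coe_image]
        exact Or.inr (Or.inl ⟨l, by simpa using hl, rfl⟩))
  have hvB : ∀ l, bM.repr v l ∈ B := fun l => by
    by_cases hl : bM.repr v l = 0
    · rw [hl]; exact B.zero_mem
    · exact Algebra.subset_adjoin (by
        simp only [S, coe_insert, coe_union, coe_image]
        exact Or.inr (Or.inr ⟨l, by simpa using hl, rfl⟩))
  let lft : (w : M ⊗[k] E) → (∀ l, bM.repr w l ∈ B) → B ⊗[k] E := fun w hw =>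
    ∑ l ∈ (bM.repr w).support, (⟨_, hw l⟩ : B) ⊗ₜ bE l
  let ι : B ⊗[k] E →ₐ[k] M ⊗[k] E := Algebra.TensorProduct.map B.val (AlgHom.id k E)
  have hι : Function.Injective ι :=
    Module.Flat.rTensor_preserves_injective_linearMap (M := E) B.val.toLinearMap Subtype.val_injective
  have hlft : ∀ w hw, ι (lft w hw) = w := fun w hw => by
    simp only [lft, map_sum, ι, Algebra.TensorProduct.map_tmul]
    conv_rhs => rw [← bM.linearCombination_repr w, Finsupp.linearCombination_apply, Finsupp.sum]
    refine sum_congr rfl fun l _ => ?_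
    simp [bM, TensorProduct.smul_tmul']
  have hmul : lft u huB * lft v hvB = 0 := hι (by rw [map_mul, hlft, hlft, huv, map_zero])
  obtain ⟨k', _, _, ψ, hfd, hψ⟩ := exists_finite_specialization B ⟨S, rfl⟩
    (⟨_, huB i⟩ * ⟨_, hvB j⟩) (IsUnit.of_mul_eq_one ⟨_, hinvB⟩
      (Subtype.ext (mul_inv_cancel₀ (mul_ne_zero hi hj))))
  rw [map_mul] at hψ
  let Φ : B ⊗[k] E →ₐ[k] k' ⊗[k] E := Algebra.TensorProduct.map ψ (AlgHom.id k E)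
  have hΦ : ∀ w hw l, Φ (lft w hw) = 0 → ψ ⟨_, hw l⟩ = 0 := fun w hw l h0 => by
    have h1 : Φ (lft w hw) = ∑ i ∈ (bM.repr w).support, ψ ⟨_, hw i⟩ ⊗ₜ[k] bE i := by
      simp only [lft, map_sum, Φ, Algebra.TensorProduct.map_tmul, AlgHom.coe_id, id_eq]
    have h2 := basis_repr_sum_tmul bE (bM.repr w).support (fun i => ψ ⟨_, hw i⟩) l
    rw [← h1, h0, map_zero, Finsupp.zero_apply] at h2
    split_ifs at h2 with hl
    · exact h2.symm
    · have : (⟨_, hw l⟩ : B) = 0 := Subtype.ext (by simpa using hl)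
      rw [this, map_zero]
  have hdom : IsDomain (k' ⊗[k] E) := by
    have := isDomain_tensorProduct_of_finite (k' := k') h
    exact (Algebra.TensorProduct.comm k k' E).toMulEquiv.isDomain
  have h0 := congrArg Φ hmul
  rw [map_mul, map_zero] at h0
  rcases mul_eq_zero.1 h0 with h0 | h0
  · exact left_ne_zero_of_mul hψ (hΦ u huB i h0)
  · exact right_ne_zero_of_mul hψ (hΦ v hvB j h0)

end EDescent

namespace EDescent

open Finset PowerSeries

/-- The ring of power series converging absolutely on all of `ℂ`. -/
def entireSeries : Subring ℂ⟦X⟧ where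
  carrier := {f | ∀ z : ℂ, Summable fun n => ‖coeff n f * z ^ n‖}
  zero_mem' := fun z => by simp
  one_mem' := fun z => summable_of_ne_finset_zero (s := {0}) fun n hn => by
    rw [coeff_one, if_neg (by simpa using hn)]; simp
  add_mem' := fun {f g} hf hg z => by
    refine Summable.of_nonneg_of_le (fun _ => norm_nonneg _) (fun n => ?_) ((hf z).add (hg z))
    rw [map_add, add_mul]
    exact norm_add_le _ _
  neg_mem' := fun {f} hf z => by simpa using hf z
  mul_mem' := fun {f g} hf hg z => by
    refine (summable_norm_sum_mul_antidiagonal_of_summable_norm (hf z) (hg z)).congr fun n => ?_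
    rw [coeff_mul, sum_mul]
    congr 1
    refine sum_congr rfl fun q hq => ?_
    rw [← mem_antidiagonal.1 hq, pow_add]
    ring

theorem mem_entireSeries {f : ℂ⟦X⟧} :
    f ∈ entireSeries ↔ ∀ z : ℂ, Summable fun n => ‖coeff n f * z ^ n‖ := Iff.rfl

theorem coe_mem_entireSeries (p : Polynomial ℂ) : (p : ℂ⟦X⟧) ∈ entireSeries := fun z =>
  summable_of_ne_finset_zero (s := p.support) fun n hn => by
    rw [Polynomial.coeff_coe, Polynomial.notMem_support_iff.1 hn]; simp

/-- Evaluation of an everywhere convergent power series. -/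
def evalEntire (z : ℂ) : entireSeries →+* ℂ where
  toFun f := ∑' n, coeff n (f : ℂ⟦X⟧) * z ^ n
  map_zero' := by simp
  map_one' := by
    rw [tsum_eq_single 0 fun n hn => by rw [OneMemClass.coe_one, coeff_one, if_neg hn, zero_mul]]
    simp
  map_add' f g := by
    rw [← (f.2 z).of_norm.tsum_add (g.2 z).of_norm]
    exact tsum_congr fun n => by rw [AddMemClass.coe_add, map_add, add_mul]
  map_mul' f g := by
    rw [tsum_mul_tsum_eq_tsum_sum_antidiagonal_of_summable_norm (f.2 z) (g.2 z)]
    refine tsum_congr fun n => ?_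
    rw [MulMemClass.coe_mul, coeff_mul, sum_mul]
    refine sum_congr rfl fun q hq => ?_
    rw [← mem_antidiagonal.1 hq, pow_add]
    ring

theorem evalEntire_apply (z : ℂ) (f : entireSeries) :
    evalEntire z f = ∑' n, coeff n (f : ℂ⟦X⟧) * z ^ n := rfl

theorem evalEntire_coe (z : ℂ) (p : Polynomial ℂ) :
    evalEntire z ⟨p, coe_mem_entireSeries p⟩ = p.eval z := by
  rw [evalEntire_apply, tsum_eq_sum (s := p.support) fun n hn => by
    rw [Polynomial.coeff_coe, Polynomial.notMem_support_iff.1 hn, zero_mul], Polynomial.eval_eq_sum,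
    Polynomial.sum]
  simp

theorem hasFPowerSeriesOnBall_evalEntire (f : entireSeries) :
    HasFPowerSeriesOnBall (fun z => evalEntire z f)
      (FormalMultilinearSeries.ofScalars ℂ fun n => coeff n (f : ℂ⟦X⟧)) 0 ⊤ where
  r_le := by
    refine top_le_iff.2 (FormalMultilinearSeries.radius_eq_top_of_summable_norm _ fun r => ?_)
    refine (f.2 (r : ℝ)).congr fun n => ?_
    rw [FormalMultilinearSeries.ofScalars_norm]
    simp
  r_pos := ENNReal.zero_lt_top
  hasSum := fun {y} _ => by
    have := (f.2 y).of_norm.hasSum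
    rw [zero_add]
    refine this.congr_fun fun n => ?_
    rw [FormalMultilinearSeries.ofScalars_apply_eq]
    simp

theorem differentiable_evalEntire (f : entireSeries) : Differentiable ℂ fun z => evalEntire z f :=
  fun z => (hasFPowerSeriesOnBall_evalEntire f).differentiableOn.differentiableAt
    (by simp)

theorem eq_zero_of_evalEntire_eq_zero (f : entireSeries) (h : ∀ z, evalEntire z f = 0) : f = 0 := by
  have h1 := (hasFPowerSeriesOnBall_evalEntire f).hasFPowerSeriesAt
  have h2 : HasFPowerSeriesAt (fun _ => (0 : ℂ))
      (FormalMultilinearSeries.ofScalars ℂ fun n => coeff n (f : ℂ⟦X⟧)) 0 := by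
    simpa only [h] using h1
  have h3 := h2.eq_zero
  rw [FormalMultilinearSeries.ofScalars_series_eq_zero] at h3
  exact Subtype.ext (PowerSeries.ext fun n => congrFun h3 n)

theorem map_mem_entireSeries {g : ℚ⟦X⟧} (hg : g ∈ EQ) : PowerSeries.map (algebraMap ℚ ℂ) g ∈ entireSeries := by
  obtain ⟨C, d, hC, H⟩ := hg
  intro z
  refine Summable.of_nonneg_of_le (fun _ => norm_nonneg _) (fun n => ?_)
    ((Real.summable_pow_div_factorial (C * ‖z‖)).mul_left (C : ℝ))
  have h2 : |coeff n g| ≤ (C : ℚ) ^ (n + 1) / n.factorial := by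
    rw [coeff_eq_ecoeff_div, abs_div, Nat.abs_cast]
    have := (H n).2.2.1
    gcongr
  have h1 : |((coeff n g : ℚ) : ℝ)| ≤ (C : ℝ) ^ (n + 1) / n.factorial := by
    have := (Rat.cast_le (K := ℝ)).2 h2
    push_cast at this
    exact this
  rw [norm_mul, norm_pow, coeff_map]
  have h3 : ‖algebraMap ℚ ℂ (coeff n g)‖ = |((coeff n g : ℚ) : ℝ)| :=
    (norm_ratCast _).trans (Rat.cast_abs _)
  rw [h3]
  calc |((coeff n g : ℚ) : ℝ)| * ‖z‖ ^ n ≤ (C : ℝ) ^ (n + 1) / n.factorial * ‖z‖ ^ n := by gcongr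
    _ = _ := by rw [mul_pow, pow_succ]; ring

/-- Evaluation of a rational E-series at a complex point. -/
def evalEQ (z : ℂ) : EQ →+* ℂ :=
  (evalEntire z).comp (((PowerSeries.map (algebraMap ℚ ℂ)).comp EQ.val.toRingHom).codRestrict entireSeries
    fun g => map_mem_entireSeries g.2)

theorem evalEQ_apply (z : ℂ) (g : EQ) :
    evalEQ z g = evalEntire z ⟨PowerSeries.map (algebraMap ℚ ℂ) g, map_mem_entireSeries g.2⟩ := rfl

theorem evalEQ_one (g : EQ) : evalEQ 1 g = coeff 0 (taylorOne (g : ℚ⟦X⟧)) := by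
  rw [evalEQ_apply, evalEntire_apply, coeff_taylorOne]
  exact tsum_congr fun n => by simp

end EDescent

namespace EDescent

open Finset PowerSeries Filter Topology

/-- An entire function of polynomial growth is a polynomial. -/
theorem exists_polynomial_of_growth (f : ℂ → ℂ) (hf : Differentiable ℂ f) (K : ℝ) (N : ℕ)
    (hb : ∀ z, ‖f z‖ ≤ K * (1 + ‖z‖) ^ N) : ∃ P : Polynomial ℂ, ∀ z, f z = P.eval z := by
  have hK : 0 ≤ K := by
    have := (norm_nonneg _).trans (hb 0)
    simpa using this
  have hzero : ∀ n, N < n → iteratedDeriv n f 0 = 0 := fun n hn => by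
    have h1 : ∀ R : ℝ, 1 ≤ R → ‖iteratedDeriv n f 0‖ ≤ n.factorial * K * 2 ^ N * R⁻¹ := fun R hR => by
      have hR0 : 0 < R := by linarith
      refine (Complex.norm_iteratedDeriv_le_of_forall_mem_sphere_norm_le n hR0 hf.diffContOnCl
        (C := K * (2 * R) ^ N) fun z hz => ?_).trans ?_
      · refine (hb z).trans ?_
        rw [mem_sphere_zero_iff_norm.1 hz]
        gcongr
        linarith
      · rw [div_le_iff₀ (by positivity)]
        obtain ⟨m, rfl⟩ := Nat.exists_eq_add_of_lt hn
        have h2 : R⁻¹ * R ^ (N + m + 1) = R ^ N * R ^ m := by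
          rw [pow_succ, pow_add]
          field_simp
        have h3 : (1 : ℝ) ≤ R ^ m := one_le_pow₀ hR
        calc ((N + m + 1).factorial : ℝ) * (K * (2 * R) ^ N)
            = (N + m + 1).factorial * K * 2 ^ N * (R ^ N * 1) := by rw [mul_pow]; ring
          _ ≤ (N + m + 1).factorial * K * 2 ^ N * (R ^ N * R ^ m) := by gcongr
          _ = _ := by rw [← h2]; ring
    have h4 : Tendsto (fun R : ℝ => n.factorial * K * 2 ^ N * R⁻¹) atTop (𝓝 0) := by
      simpa using (tendsto_inv_atTop_zero (𝕜 := ℝ)).const_mul (n.factorial * K * 2 ^ N)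
    have h5 := ge_of_tendsto h4 ((eventually_ge_atTop 1).mono h1)
    exact norm_le_zero_iff.1 h5
  refine ⟨∑ n ∈ range (N + 1), Polynomial.C ((n.factorial : ℂ)⁻¹ * iteratedDeriv n f 0) * Polynomial.X ^ n,
    fun z => ?_⟩
  have h6 := Complex.taylorSeries_eq_of_entire' 0 z hf
  rw [← h6, tsum_eq_sum (s := range (N + 1)) fun n hn => by
    rw [hzero n (by simpa using hn)]; ring, Polynomial.eval_finsetSum]
  refine sum_congr rfl fun n _ => ?_
  simp

/-- If `A` is bounded by a polynomial times `B`, both entire, then `A / B` is a polynomial. -/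
theorem exists_polynomial_mul_eq (A B : ℂ → ℂ) (hA : Differentiable ℂ A) (hB : Differentiable ℂ B)
    (hB0 : ∃ z, B z ≠ 0) (K : ℝ) (hK : 0 ≤ K) (N : ℕ) (hb : ∀ z, ‖A z‖ ≤ K * (1 + ‖z‖) ^ N * ‖B z‖) :
    ∃ P : Polynomial ℂ, ∀ z, A z = P.eval z * B z := by
  have hBne : ∀ c, ∀ᶠ w in 𝓝[≠] c, B w ≠ 0 := fun c => by
    by_contra hfr
    rw [not_eventually] at hfr
    obtain ⟨z, hz⟩ := hB0
    have h1 : ∃ᶠ w in 𝓝[≠] c, B w = 0 := hfr.mono fun w hw => not_not.1 hw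
    exact hz ((hB.differentiableOn.analyticOnNhd isOpen_univ).eqOn_zero_of_preconnected_of_frequently_eq_zero
      isPreconnected_univ (Set.mem_univ c) h1 (Set.mem_univ z))
  let h : ℂ → ℂ := fun w => A w / B w
  have hh : ∀ w, ‖h w‖ ≤ K * (1 + ‖w‖) ^ N := fun w => by
    by_cases hw : B w = 0
    · simp only [h, hw, div_zero, norm_zero]
      positivity
    · rw [norm_div, div_le_iff₀ (norm_pos_iff.2 hw)]
      exact hb w
  have hhd : ∀ w, B w ≠ 0 → DifferentiableAt ℂ h w := fun w hw => (hA w).div (hB w) hw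
  let f : ℂ → ℂ := fun z => limUnder (𝓝[≠] z) h
  have hlim : ∀ c, Tendsto h (𝓝[≠] c) (𝓝 (f c)) := fun c => by
    refine Complex.tendsto_limUnder_of_differentiable_on_punctured_nhds_of_bounded_under
      ((hBne c).mono hhd) ⟨K * (1 + (‖c‖ + 1)) ^ N + ‖h c‖, ?_⟩
    rw [eventually_map]
    have h1 : ∀ᶠ w in 𝓝[≠] c, ‖w‖ < ‖c‖ + 1 :=
      nhdsWithin_le_nhds (continuous_norm.continuousAt.eventually_lt continuousAt_const (by simp))
    filter_upwards [h1] with w hw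
    refine (norm_sub_le _ _).trans ?_
    have := hh w
    have h3 : K * (1 + ‖w‖) ^ N ≤ K * (1 + (‖c‖ + 1)) ^ N := by gcongr
    linarith
  have hfh : ∀ w, B w ≠ 0 → f w = h w := fun w hw =>
    tendsto_nhds_unique (hlim w) ((hhd w hw).continuousAt.tendsto.mono_left nhdsWithin_le_nhds)
  have hfd : Differentiable ℂ f := fun c => by
    refine (Complex.analyticAt_of_differentiable_on_punctured_nhds_of_continuousAt ?_ ?_).differentiableAt
    · filter_upwards [hBne c] with w hw
      refine (hhd w hw).congr_of_eventuallyEq ?_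
      filter_upwards [(hB w).continuousAt.eventually_ne hw] with v hv
      exact hfh v hv
    · rw [continuousAt_iff_punctured_nhds]
      refine (hlim c).congr' ?_
      filter_upwards [hBne c] with w hw
      exact (hfh w hw).symm
  have hfb : ∀ c, ‖f c‖ ≤ K * (1 + ‖c‖) ^ N := fun c => by
    refine le_of_tendsto_of_tendsto' (hlim c).norm
      (Tendsto.mono_left (Continuous.tendsto (f := fun w => K * (1 + ‖w‖) ^ N) (by fun_prop) c)
        nhdsWithin_le_nhds) hh
  obtain ⟨P, hP⟩ := exists_polynomial_of_growth f hfd K N hfb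
  refine ⟨P, fun z => ?_⟩
  by_cases hz : B z = 0
  · have := hb z
    rw [hz, norm_zero, mul_zero] at this
    rw [hz, mul_zero]
    exact norm_le_zero_iff.1 this
  · rw [← hP, hfh z hz]
    exact (div_mul_cancel₀ _ hz).symm

/-- Polynomials grow polynomially. -/
theorem exists_polynomial_norm_bound (p : Polynomial ℂ) :
    ∃ K : ℝ, 0 ≤ K ∧ ∀ z : ℂ, ∀ M, p.natDegree ≤ M → ‖p.eval z‖ ≤ K * (1 + ‖z‖) ^ M := by
  refine ⟨∑ n ∈ range (p.natDegree + 1), ‖p.coeff n‖, sum_nonneg fun _ _ => norm_nonneg _, fun z M hM => ?_⟩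
  rw [Polynomial.eval_eq_sum_range, sum_mul]
  refine (norm_sum_le _ _).trans (sum_le_sum fun n hn => ?_)
  rw [norm_mul, norm_pow]
  have h1 : (1 : ℝ) ≤ 1 + ‖z‖ := by linarith [norm_nonneg z]
  have : ‖z‖ ^ n ≤ (1 + ‖z‖) ^ M :=
    (pow_le_pow_left₀ (norm_nonneg _) (by linarith) n).trans
      (pow_le_pow_right₀ h1 ((Nat.lt_succ_iff.1 (mem_range.1 hn)).trans hM))
  gcongr

/-- If `A` is integral over `ℂ[z]` relative to `B`, then `A` is bounded by a polynomial times `B`. -/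
theorem exists_bound_of_integral (A B : ℂ → ℂ) (d : ℕ) (p : ℕ → Polynomial ℂ)
    (h : ∀ z, A z ^ d + ∑ i ∈ range d, (p i).eval z * A z ^ i * B z ^ (d - i) = 0) :
    ∃ (K : ℝ) (N : ℕ), 0 ≤ K ∧ ∀ z, ‖A z‖ ≤ K * (1 + ‖z‖) ^ N * ‖B z‖ := by
  choose K hK hKb using fun i => exists_polynomial_norm_bound (p i)
  let N := ∑ i ∈ range d, (p i).natDegree
  refine ⟨1 + ∑ i ∈ range d, K i, N, by linarith [sum_nonneg fun i (_ : i ∈ range d) => hK i], fun z => ?_⟩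
  have hd : d ≠ 0 := by
    rintro rfl
    simpa using h 0
  have h1 : (1 : ℝ) ≤ (1 + ‖z‖) ^ N := one_le_pow₀ (by linarith [norm_nonneg z])
  by_contra! hlt
  set Q := (1 + ∑ i ∈ range d, K i) * (1 + ‖z‖) ^ N with hQ
  have hQ1 : 1 ≤ Q := by
    have : (1 : ℝ) ≤ 1 + ∑ i ∈ range d, K i := by linarith [sum_nonneg fun i (_ : i ∈ range d) => hK i]
    nlinarith
  have hA0 : 0 < ‖A z‖ := lt_of_le_of_lt (by positivity) hlt
  have hBA : ‖B z‖ ≤ ‖A z‖ := by nlinarith [norm_nonneg (B z)]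
  have h2 : ‖A z‖ ^ d = ‖∑ i ∈ range d, (p i).eval z * A z ^ i * B z ^ (d - i)‖ := by
    rw [← norm_pow, eq_neg_of_add_eq_zero_left (h z), norm_neg]
  have h3 : ‖∑ i ∈ range d, (p i).eval z * A z ^ i * B z ^ (d - i)‖
      ≤ ∑ i ∈ range d, K i * (1 + ‖z‖) ^ N * (‖A z‖ ^ (d - 1) * ‖B z‖) := by
    refine (norm_sum_le _ _).trans (sum_le_sum fun i hi => ?_)
    have hi' := mem_range.1 hi
    rw [norm_mul, norm_mul, norm_pow, norm_pow, mul_assoc]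
    have h4 : ‖A z‖ ^ i * ‖B z‖ ^ (d - i) ≤ ‖A z‖ ^ (d - 1) * ‖B z‖ := by
      obtain ⟨m, hm⟩ : ∃ m, d = i + m + 1 := ⟨d - i - 1, by omega⟩
      rw [show d - i = m + 1 by omega, show d - 1 = i + m by omega, pow_succ, pow_add, mul_assoc]
      gcongr
    exact mul_le_mul (hKb i z N (single_le_sum (f := fun i => (p i).natDegree) (fun _ _ => Nat.zero_le _) hi))
      h4 (by positivity) (by have := hK i; positivity)
  rw [← sum_mul, ← sum_mul] at h3
  have h5 : ‖A z‖ ^ d = ‖A z‖ ^ (d - 1) * ‖A z‖ := by rw [← pow_succ]; congr 1; omega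
  have h6 : (∑ i ∈ range d, K i) * (1 + ‖z‖) ^ N ≤ Q := by rw [hQ]; nlinarith
  have h7 : ‖A z‖ ^ (d - 1) * ‖A z‖ ≤ ‖A z‖ ^ (d - 1) * (Q * ‖B z‖) := by
    rw [← h5, h2]
    refine h3.trans ?_
    calc _ ≤ Q * (‖A z‖ ^ (d - 1) * ‖B z‖) := by gcongr
      _ = _ := by ring
  have h8 := le_of_mul_le_mul_left h7 (by positivity)
  linarith

end EDescent

namespace EDescent

open Finset PowerSeries

/-- The fraction field of `EQ` inside the field of Laurent series. -/
def eSubfield : Subfield (LS ℚ) where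
  carrier := {x | ∃ a ∈ EQ, ∃ b ∈ EQ, b ≠ 0 ∧ x * LS.ofPS ℚ b = LS.ofPS ℚ a}
  zero_mem' := ⟨0, EQ.zero_mem, 1, EQ.one_mem, one_ne_zero, by simp⟩
  one_mem' := ⟨1, EQ.one_mem, 1, EQ.one_mem, one_ne_zero, by simp⟩
  add_mem' := by
    rintro x y ⟨a, ha, b, hb, hb0, h⟩ ⟨a', ha', b', hb', hb0', h'⟩
    refine ⟨a * b' + b * a', EQ.add_mem (EQ.mul_mem ha hb') (EQ.mul_mem hb ha'), b * b', EQ.mul_mem hb hb',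
      mul_ne_zero hb0 hb0', ?_⟩
    rw [map_mul, map_add, map_mul, map_mul, ← h, ← h']
    ring
  neg_mem' := by
    rintro x ⟨a, ha, b, hb, hb0, h⟩
    exact ⟨-a, EQ.neg_mem ha, b, hb, hb0, by rw [map_neg, ← h, neg_mul]⟩
  mul_mem' := by
    rintro x y ⟨a, ha, b, hb, hb0, h⟩ ⟨a', ha', b', hb', hb0', h'⟩
    refine ⟨a * a', EQ.mul_mem ha ha', b * b', EQ.mul_mem hb hb', mul_ne_zero hb0 hb0', ?_⟩
    rw [map_mul, map_mul, ← h, ← h']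
    ring
  inv_mem' := by
    rintro x ⟨a, ha, b, hb, hb0, h⟩
    by_cases hx : x = 0
    · exact ⟨0, EQ.zero_mem, 1, EQ.one_mem, one_ne_zero, by simp [hx]⟩
    · have hb1 : LS.ofPS ℚ b ≠ 0 := (map_ne_zero_iff _ LS.ofPS_injective).2 hb0
      refine ⟨b, hb, a, ha, fun h0 => ?_, by rw [← h, inv_mul_cancel_left₀ hx]⟩
      rw [h0, map_zero] at h
      exact mul_ne_zero hx hb1 h

/-- The fraction field of `EQ`. -/
def EField : Type := eSubfield

namespace EField

instance : Field EField := inferInstanceAs (Field eSubfield)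

/-- The inclusion of the fraction field of `EQ` in the field of Laurent series. -/
def toLS : EField →+* LS ℚ := eSubfield.subtype

theorem toLS_injective : Function.Injective toLS := toLS.injective

/-- The embedding of `EQ` in its fraction field. -/
def ofEQ : EQ →+* EField :=
  ((LS.ofPS ℚ).comp EQ.val.toRingHom).codRestrict eSubfield
    fun g => ⟨g, g.2, 1, EQ.one_mem, one_ne_zero, by simp⟩

theorem toLS_ofEQ (g : EQ) : toLS (ofEQ g) = LS.ofPS ℚ (g : ℚ⟦X⟧) := rfl

theorem ofEQ_injective : Function.Injective ofEQ := fun g h hgh =>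
  Subtype.ext (LS.ofPS_injective (by rw [← toLS_ofEQ, hgh, toLS_ofEQ]))

theorem exists_mul_eq (x : EField) : ∃ a b : EQ, b ≠ 0 ∧ x * ofEQ b = ofEQ a := by
  obtain ⟨a, ha, b, hb, hb0, h⟩ := x.2
  exact ⟨⟨a, ha⟩, ⟨b, hb⟩, fun h0 => hb0 (congrArg Subtype.val h0), toLS_injective h⟩

/-- The derivation of the fraction field of `EQ`. -/
def deriv : EField →+ EField where
  toFun x := ⟨lsDeriv ℚ (toLS x), by
    obtain ⟨a, ha, b, hb, hb0, h⟩ := x.2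
    refine ⟨d⁄dX ℚ a * b - a * d⁄dX ℚ b, EQ.sub_mem (EQ.mul_mem (derivative_mem_EQ ha) hb)
      (EQ.mul_mem ha (derivative_mem_EQ hb)), b * b, EQ.mul_mem hb hb, mul_ne_zero hb0 hb0, ?_⟩
    have h1 := congrArg (lsDeriv ℚ) h
    rw [(lsDeriv ℚ).leibniz, lsDeriv_ofPS, lsDeriv_ofPS, smul_eq_mul, smul_eq_mul] at h1
    rw [map_sub, map_mul, map_mul, map_mul, ← h1, ← h]
    change lsDeriv ℚ (x : eSubfield).1 * _ = _
    ring⟩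
  map_zero' := Subtype.ext ((lsDeriv ℚ).map_zero)
  map_add' x y := Subtype.ext ((lsDeriv ℚ).map_add _ _)

theorem toLS_deriv (x : EField) : toLS (deriv x) = lsDeriv ℚ (toLS x) := rfl

theorem deriv_mul (x y : EField) : deriv (x * y) = deriv x * y + x * deriv y :=
  toLS_injective (by
    rw [toLS_deriv, map_mul, (lsDeriv ℚ).leibniz, map_add, map_mul, map_mul, toLS_deriv, toLS_deriv,
      smul_eq_mul, smul_eq_mul]
    ring)

theorem deriv_ofEQ (g : EQ) :
    deriv (ofEQ g) = ofEQ ⟨d⁄dX ℚ (g : ℚ⟦X⟧), derivative_mem_EQ g.2⟩ :=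
  toLS_injective (by rw [toLS_deriv, toLS_ofEQ, lsDeriv_ofPS, toLS_ofEQ])

/-- Polynomials as elements of the fraction field of `EQ`. -/
def ofPoly : Polynomial ℚ →+* EField :=
  ofEQ.comp ((Polynomial.coeToPowerSeries.ringHom (R := ℚ)).codRestrict EQ coe_mem_EQ)

theorem ofPoly_apply (p : Polynomial ℚ) : ofPoly p = ofEQ ⟨p, coe_mem_EQ p⟩ := rfl

theorem ofPoly_injective : Function.Injective ofPoly := fun p q h => by
  rw [ofPoly_apply, ofPoly_apply] at h
  exact Polynomial.coe_inj.1 (congrArg Subtype.val (ofEQ_injective h))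

instance : Algebra (RatFunc ℚ) EField := (IsFractionRing.lift ofPoly_injective).toAlgebra

theorem algebraMap_algebraMap (p : Polynomial ℚ) :
    algebraMap (RatFunc ℚ) EField (algebraMap _ _ p) = ofPoly p :=
  IsFractionRing.lift_algebraMap ofPoly_injective p

end EField

theorem evalEQ_coe (z : ℂ) (p : Polynomial ℚ) :
    evalEQ z ⟨p, coe_mem_EQ p⟩ = (p.map (algebraMap ℚ ℂ)).eval z := by
  rw [← evalEntire_coe, evalEQ_apply]
  refine congrArg _ (Subtype.ext (PowerSeries.ext fun n => ?_))
  change coeff n (PowerSeries.map (algebraMap ℚ ℂ) (p : ℚ⟦X⟧)) = coeff n ((p.map (algebraMap ℚ ℂ) : Polynomial ℂ) : ℂ⟦X⟧)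
  simp

/-- The coefficient field is relatively algebraically closed in the fraction field of `EQ`: an element integral
over polynomials is a polynomial. -/
theorem EField.mem_range_ofPoly_of_integral (x : EField) (d : ℕ) (p : ℕ → Polynomial ℚ)
    (h : x ^ d + ∑ i ∈ range d, ofPoly (p i) * x ^ i = 0) : ∃ q, x = ofPoly q := by
  obtain ⟨a, b, hb, hab⟩ := exists_mul_eq x
  have h1 : a ^ d + ∑ i ∈ range d, (⟨p i, coe_mem_EQ _⟩ : EQ) * a ^ i * b ^ (d - i) = 0 := by
    refine ofEQ_injective ?_
    rw [map_zero, map_add, map_sum, map_pow, ← hab]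
    have := congrArg (· * ofEQ b ^ d) h
    beta_reduce at this
    rw [zero_mul, add_mul, sum_mul] at this
    rw [← this, mul_pow]
    congr 1
    refine sum_congr rfl fun i hi => ?_
    rw [map_mul, map_mul, map_pow, map_pow, ← hab, ← ofPoly_apply, mul_pow,
      ← Nat.add_sub_cancel' (mem_range.1 hi).le, pow_add (ofEQ b)]
    simp only [Nat.add_sub_cancel_left]
    ring
  obtain ⟨K, N, hK, hb2⟩ := exists_bound_of_integral (fun z => evalEQ z a) (fun z => evalEQ z b) d
    (fun i => (p i).map (algebraMap ℚ ℂ)) fun z => by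
      have h2 := congrArg (evalEQ z) h1
      rw [map_zero, map_add, map_sum, map_pow] at h2
      rw [← h2]
      congr 1
      refine sum_congr rfl fun i _ => ?_
      rw [map_mul, map_mul, map_pow, map_pow]
      rw [evalEQ_coe]
  have hb0 : ∃ z, evalEQ z b ≠ 0 := by
    by_contra! h0
    have h2 : PowerSeries.map (algebraMap ℚ ℂ) (b : ℚ⟦X⟧) = 0 :=
      congrArg Subtype.val (eq_zero_of_evalEntire_eq_zero _ h0)
    refine hb (Subtype.ext (PowerSeries.ext fun n => ?_))
    have h3 := congrArg (coeff n) h2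
    rw [coeff_map, map_zero, _root_.map_eq_zero] at h3
    rw [h3]
    simp
  obtain ⟨P, hP⟩ := exists_polynomial_mul_eq _ _ (differentiable_evalEntire _) (differentiable_evalEntire _)
    hb0 K hK N hb2
  have h3 : PowerSeries.map (algebraMap ℚ ℂ) (a : ℚ⟦X⟧) = PowerSeries.map (algebraMap ℚ ℂ) (b : ℚ⟦X⟧) * P := by
    have h4 := eq_zero_of_evalEntire_eq_zero
      (⟨_, map_mem_entireSeries a.2⟩ - ⟨_, map_mem_entireSeries b.2⟩ * ⟨_, coe_mem_entireSeries P⟩) fun z => by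
        rw [map_sub, map_mul, evalEntire_coe, mul_comm, sub_eq_zero]
        exact hP z
    exact sub_eq_zero.1 (congrArg Subtype.val h4)
  obtain ⟨c, hc⟩ := exists_dual_functionals (s := 1) (fun _ => (1 : ℂ))
    (LinearIndependent.of_subsingleton 0 one_ne_zero)
  have hc1 : ∀ r : ℚ, c 0 (algebraMap ℚ ℂ r) = r := fun r => by
    rw [Algebra.algebraMap_eq_smul_one, map_smul, hc 0 0]
    simp
  have h5 := congrArg (coeffMap (c 0)) h3
  rw [coeffMap_map_mul] at h5
  have h6 : coeffMap (c 0) (PowerSeries.map (algebraMap ℚ ℂ) (a : ℚ⟦X⟧)) = a :=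
    PowerSeries.ext fun n => by rw [coeff_coeffMap, coeff_map, hc1]
  have h7 : coeffMap (c 0) (P : ℂ⟦X⟧) = ((∑ n ∈ range (P.natDegree + 1),
      Polynomial.monomial n (c 0 (P.coeff n)) : Polynomial ℚ) : ℚ⟦X⟧) := PowerSeries.ext fun n => by
    rw [coeff_coeffMap, Polynomial.coeff_coe, Polynomial.coeff_coe, Polynomial.finsetSum_coeff]
    simp only [Polynomial.coeff_monomial]
    rw [sum_ite_eq']
    split_ifs with hn
    · rfl
    · rw [Polynomial.coeff_eq_zero_of_natDegree_lt (by simpa using hn), map_zero]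
  rw [h6, h7] at h5
  refine ⟨∑ n ∈ range (P.natDegree + 1), Polynomial.monomial n (c 0 (P.coeff n)),
    mul_right_cancel₀ ((map_ne_zero_iff _ ofEQ_injective).2 hb) (hab.trans ?_)⟩
  rw [ofPoly_apply, ← map_mul]
  exact congrArg ofEQ (Subtype.ext (h5.trans (mul_comm _ _)))

theorem EField.mem_range_of_isAlgebraic (x : EField) (hx : IsAlgebraic (RatFunc ℚ) x) :
    x ∈ (algebraMap (RatFunc ℚ) EField).range := by
  let _ : Algebra (Polynomial ℚ) EField := ofPoly.toAlgebra
  have : IsScalarTower (Polynomial ℚ) (RatFunc ℚ) EField :=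
    IsScalarTower.of_algebraMap_eq fun p => (algebraMap_algebraMap p).symm
  have h1 : IsAlgebraic (Polynomial ℚ) x := (IsFractionRing.isAlgebraic_iff (Polynomial ℚ) (RatFunc ℚ) EField).2 hx
  obtain ⟨s, hs, hInt⟩ := h1.exists_integral_multiple
  obtain ⟨f, hf, hf0⟩ := hInt
  obtain ⟨q, hq⟩ := mem_range_ofPoly_of_integral (s • x) f.natDegree (fun i => f.coeff i) (by
    rw [Polynomial.eval₂_eq_sum_range, sum_range_succ, hf.coeff_natDegree, map_one, one_mul, add_comm] at hf0
    exact hf0)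
  have hs' : ofPoly s ≠ 0 := (map_ne_zero_iff _ ofPoly_injective).2 hs
  refine ⟨algebraMap _ _ q / algebraMap _ _ s, ?_⟩
  rw [map_div₀, algebraMap_algebraMap, algebraMap_algebraMap, ← hq, div_eq_iff hs', mul_comm]
  exact Algebra.smul_def _ _

end EDescent

namespace EDescent

open Finset PowerSeries
open scoped TensorProduct

/-- Rational power series as complex Laurent series. -/
def iota : ℚ⟦X⟧ →+* LS ℂ := (LS.ofPS ℂ).comp (PowerSeries.map (algebraMap ℚ ℂ))

theorem iota_injective : Function.Injective iota :=
  fun _ _ h => PowerSeries.map_injective (algebraMap ℚ ℂ) (algebraMap ℚ ℂ).injective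
    (LS.ofPS_injective (K := ℂ) h)

theorem lsDeriv_iota (f : ℚ⟦X⟧) : lsDeriv ℂ (iota f) = iota (d⁄dX ℚ f) := by
  change lsDeriv ℂ (LS.ofPS ℂ _) = LS.ofPS ℂ _
  rw [lsDeriv_ofPS]
  congr 1
  ext n
  simp [coeff_derivative]

theorem iota_tau_injective : Function.Injective (iota.comp (tau (1 : ℚ))) :=
  iota_injective.comp (tau_injective 1)

/-- Rational functions expanded at `1`. -/
instance : Algebra (RatFunc ℚ) (LS ℂ) := (IsFractionRing.lift iota_tau_injective).toAlgebra

theorem algebraMap_algebraMap_LS (p : Polynomial ℚ) :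
    algebraMap (RatFunc ℚ) (LS ℂ) (algebraMap _ _ p) = iota (tau 1 p) :=
  IsFractionRing.lift_algebraMap iota_tau_injective p

theorem exists_deriv_ratFunc (a : RatFunc ℚ) : ∃ a' : RatFunc ℚ,
    lsDeriv ℂ (algebraMap _ _ a) = algebraMap _ _ a' ∧ EField.deriv (algebraMap _ _ a) = algebraMap _ _ a' := by
  obtain ⟨p, q, hq, rfl⟩ := IsFractionRing.div_surjective (A := Polynomial ℚ) a
  have hq0 : q ≠ 0 := nonZeroDivisors.ne_zero hq
  refine ⟨algebraMap _ _ (p.derivative * q - p * q.derivative) / algebraMap _ _ (q * q), ?_, ?_⟩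
  · have h1 : iota (tau 1 q) ≠ 0 := (map_ne_zero_iff _ iota_tau_injective).2 hq0
    rw [map_div₀ (algebraMap _ _), map_div₀ (algebraMap _ _), algebraMap_algebraMap_LS, algebraMap_algebraMap_LS, algebraMap_algebraMap_LS,
      algebraMap_algebraMap_LS, eq_div_iff (by rw [map_mul, map_mul]; exact mul_ne_zero h1 h1)]
    have h2 := congrArg (lsDeriv ℂ) (div_mul_cancel₀ (iota (tau 1 p)) h1)
    rw [(lsDeriv ℂ).leibniz, lsDeriv_iota, lsDeriv_iota, derivative_tau, derivative_tau, smul_eq_mul, smul_eq_mul] at h2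
    rw [map_sub, map_mul, map_mul, map_mul, map_sub, map_mul, map_mul, map_mul, ← h2]
    field_simp
    ring
  · have h1 : EField.ofPoly q ≠ 0 := (map_ne_zero_iff _ EField.ofPoly_injective).2 hq0
    have hd : ∀ r : Polynomial ℚ, EField.deriv (EField.ofPoly r) = EField.ofPoly r.derivative := fun r => by
      rw [EField.ofPoly_apply, EField.deriv_ofEQ, EField.ofPoly_apply]
      exact congrArg _ (Subtype.ext (derivative_coe r))
    rw [map_div₀ (algebraMap _ _), map_div₀ (algebraMap _ _), EField.algebraMap_algebraMap, EField.algebraMap_algebraMap, EField.algebraMap_algebraMap,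
      EField.algebraMap_algebraMap, eq_div_iff (by rw [map_mul]; exact mul_ne_zero h1 h1)]
    have h2 := congrArg EField.deriv (div_mul_cancel₀ (EField.ofPoly p) h1)
    rw [EField.deriv_mul, hd, hd] at h2
    rw [map_sub, map_mul, map_mul, map_mul, ← h2]
    field_simp
    ring

/-- The tensor product of the field of local Laurent series at `1` with the fraction field of `EQ`. -/
abbrev TT : Type := LS ℂ ⊗[RatFunc ℚ] EField

instance : SMulCommClass (RatFunc ℚ) ℂ (LS ℂ) := ⟨fun a b c => by
  rw [Algebra.smul_def, Algebra.smul_def, Algebra.smul_def, Algebra.smul_def, mul_left_comm]⟩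

/-- The derivation of the tensor product. -/
def tensorDeriv : TT →+ TT :=
  TensorProduct.liftAddHom
    (AddMonoidHom.mk' (fun m => AddMonoidHom.mk' (fun e => lsDeriv ℂ m ⊗ₜ[RatFunc ℚ] e + m ⊗ₜ EField.deriv e)
      fun e e' => by simp only [TensorProduct.tmul_add, map_add]; abel)
      fun m m' => by ext e; simp only [TensorProduct.add_tmul, map_add, AddMonoidHom.mk'_apply, AddMonoidHom.add_apply]; abel)
    fun r m e => by
      obtain ⟨r', h1, h2⟩ := exists_deriv_ratFunc r
      simp only [AddMonoidHom.mk'_apply]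
      rw [Algebra.smul_def r m, (lsDeriv ℂ).leibniz, h1, smul_eq_mul, smul_eq_mul, Algebra.smul_def r e,
        EField.deriv_mul, h2, mul_comm m]
      simp only [← Algebra.smul_def]
      simp only [TensorProduct.add_tmul, TensorProduct.tmul_add, TensorProduct.smul_tmul', TensorProduct.tmul_smul]
      abel

theorem tensorDeriv_tmul (m : LS ℂ) (e : EField) :
    tensorDeriv (m ⊗ₜ e) = lsDeriv ℂ m ⊗ₜ e + m ⊗ₜ EField.deriv e := rfl

theorem tensorDeriv_mul (u v : TT) : tensorDeriv (u * v) = tensorDeriv u * v + u * tensorDeriv v := by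
  induction u using TensorProduct.induction_on with
  | zero => simp
  | add a b ha hb => rw [add_mul, map_add, ha, hb, map_add]; ring
  | tmul m e =>
    induction v using TensorProduct.induction_on with
    | zero => simp
    | add a b ha hb => rw [mul_add, map_add, ha, hb, map_add]; ring
    | tmul m' e' =>
      rw [Algebra.TensorProduct.tmul_mul_tmul, tensorDeriv_tmul, tensorDeriv_tmul, tensorDeriv_tmul,
        (lsDeriv ℂ).leibniz, EField.deriv_mul, smul_eq_mul, smul_eq_mul]
      simp only [add_mul, mul_add, Algebra.TensorProduct.tmul_mul_tmul, TensorProduct.add_tmul, TensorProduct.tmul_add,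
        mul_comm m']
      abel

theorem tensorDeriv_smul (m : LS ℂ) (v : TT) :
    tensorDeriv (m • v) = lsDeriv ℂ m • v + m • tensorDeriv v := by
  have h : ∀ (a : LS ℂ) (w : TT), a • w = (a ⊗ₜ 1) * w := fun a w => by
    rw [Algebra.smul_def]; rfl
  rw [h, h, h, tensorDeriv_mul, tensorDeriv_tmul]
  have h1 : EField.deriv 1 = 0 := by
    have := EField.deriv_mul 1 1
    simpa using this
  rw [h1, TensorProduct.tmul_zero, add_zero]

end EDescent

namespace EDescent

open Finset PowerSeries
open scoped TensorProduct

/-- Finite-dimensional spaces over `ℚ(z)`, stable under derivation and spanned by elements of `EQ`. -/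
structure IsDiffSpace (W : Submodule (RatFunc ℚ) EField) : Prop where
  fg : W.FG
  deriv_mem : ∀ w ∈ W, EField.deriv w ∈ W
  le_span : W ≤ Submodule.span (RatFunc ℚ) {x | x ∈ W ∧ ∃ g, x = EField.ofEQ g}

theorem exists_common_denominator {ι κ : Type*} [Fintype ι] [Fintype κ] (w : ι → EField) (G : κ → EField)
    (h : ∀ i, w i ∈ Submodule.span (RatFunc ℚ) (Set.range G)) :
    ∃ T : Polynomial ℚ, T ≠ 0 ∧ ∃ B : ι → κ → Polynomial ℚ,
      ∀ i, EField.ofPoly T * w i = ∑ j, EField.ofPoly (B i j) * G j := by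
  simp only [Submodule.mem_span_range_iff_exists_fun] at h
  choose A hA using h
  obtain ⟨b, hb⟩ := IsLocalization.exist_integer_multiples_of_finite (nonZeroDivisors (Polynomial ℚ))
    (fun q : ι × κ => A q.1 q.2)
  choose B hB using hb
  refine ⟨b, nonZeroDivisors.ne_zero b.2, fun i j => B (i, j), fun i => ?_⟩
  rw [← hA, mul_sum]
  refine sum_congr rfl fun j _ => ?_
  rw [← EField.algebraMap_algebraMap, ← EField.algebraMap_algebraMap, hB, Algebra.smul_def (A i j), Algebra.smul_def (b : Polynomial ℚ),
    map_mul, mul_assoc]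

theorem linearIndependent_poly {H : ℕ} (G : Fin H → EQ)
    (hG : LinearIndependent (RatFunc ℚ) fun i => EField.ofEQ (G i)) (P : Fin H → Polynomial ℚ)
    (hP : pairing (tau 0) P (fun i => (G i : ℚ⟦X⟧)) = 0) : P = 0 := by
  have h1 : ∑ i, algebraMap (Polynomial ℚ) (RatFunc ℚ) (P i) • EField.ofEQ (G i) = 0 := by
    simp only [Algebra.smul_def, EField.algebraMap_algebraMap, EField.ofPoly_apply, ← map_mul, ← map_sum]
    rw [map_eq_zero_iff _ EField.ofEQ_injective]
    refine Subtype.ext ?_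
    rw [pairing] at hP
    simp only [tau_zero_apply] at hP
    rw [AddSubmonoidClass.coe_finsetSum]
    exact hP
  funext i
  exact (map_eq_zero_iff _ (IsFractionRing.injective (Polynomial ℚ) (RatFunc ℚ))).1
    (Fintype.linearIndependent_iff.1 hG _ h1 i)

theorem ofPoly_mul_eq_sum {H : ℕ} (q : Polynomial ℚ) (w : EQ) (p : Fin H → Polynomial ℚ) (G : Fin H → EQ)
    (h : EField.ofPoly q * EField.ofEQ w = ∑ j, EField.ofPoly (p j) * EField.ofEQ (G j)) :
    (q : ℚ⟦X⟧) * w = ∑ j, (p j : ℚ⟦X⟧) * G j := by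
  simp only [EField.ofPoly_apply, ← map_mul, ← map_sum] at h
  have := congrArg Subtype.val (EField.ofEQ_injective h)
  rw [AddSubmonoidClass.coe_finsetSum] at this
  exact this

theorem taylorOne_mul_eq_sum {H : ℕ} (q : Polynomial ℚ) (w : EQ) (p : Fin H → Polynomial ℚ) (G : Fin H → EQ)
    (h : (q : ℚ⟦X⟧) * w = ∑ j, (p j : ℚ⟦X⟧) * G j) :
    PowerSeries.map (algebraMap ℚ ℂ) (tau 1 q) * taylorOne w =
      ∑ j, PowerSeries.map (algebraMap ℚ ℂ) (tau 1 (p j)) * taylorOne (G j) := by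
  have h1 := congrArg taylorOne h
  rw [taylorOne_coe_mul _ w.2, taylorOne_sum _ _ fun j _ => EQ.mul_mem (coe_mem_EQ _) (G j).2] at h1
  rw [h1]
  exact sum_congr rfl fun j _ => taylorOne_coe_mul _ (G j).2

theorem iota_tau_smul_tmul (p : Polynomial ℚ) (x : EField) :
    iota (tau 1 p) • ((1 : LS ℂ) ⊗ₜ[RatFunc ℚ] x) = (1 : LS ℂ) ⊗ₜ[RatFunc ℚ] (EField.ofPoly p * x) := by
  rw [← algebraMap_algebraMap_LS, ← EField.algebraMap_algebraMap, ← Algebra.smul_def, TensorProduct.smul_tmul',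
    smul_eq_mul, mul_one, TensorProduct.tmul_smul, TensorProduct.smul_tmul', Algebra.smul_def, mul_one]

theorem tensorDeriv_one_tmul (x : EField) :
    tensorDeriv ((1 : LS ℂ) ⊗ₜ x) = (1 : LS ℂ) ⊗ₜ EField.deriv x := by
  rw [tensorDeriv_tmul, (lsDeriv ℂ).map_one_eq_zero, TensorProduct.zero_tmul, zero_add]

theorem taylorOne_one : taylorOne 1 = 1 := by
  ext l
  rw [coeff_taylorOne, tsum_eq_single 0 fun j hj => by simp [coeff_one, hj]]
  rcases l with _ | l <;> simp [coeff_one]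

theorem sum_smul_sum_smul {R V ι : Type*} [CommRing R] [AddCommGroup V] [Module R V] [Fintype ι] (A B : Matrix ι ι R)
    (u : ι → V) (i : ι) : ∑ j, A i j • ∑ k, B j k • u k = ∑ k, (A * B) i k • u k := by
  simp only [smul_sum, smul_smul, Matrix.mul_apply, sum_smul]
  exact sum_comm

theorem sum_one_smul {R V ι : Type*} [CommRing R] [AddCommGroup V] [Module R V] [Fintype ι] [DecidableEq ι]
    (u : ι → V) (i : ι) : ∑ k, (1 : Matrix ι ι R) i k • u k = u i := by
  simp [Matrix.one_apply, ite_smul]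

theorem exists_constant_frame (W : Submodule (RatFunc ℚ) EField) (hW : IsDiffSpace W) (h1 : (1 : EField) ∈ W) :
    ∃ (H : ℕ) (γ : Fin H → ℂ) (e : Fin H → TT), LinearIndependent ℚ γ ∧ (∀ j, tensorDeriv (e j) = 0) ∧
      LinearIndependent (LS ℂ) e ∧ ∀ w : EQ, EField.ofEQ w ∈ W → ∃ φ : Fin H → ℚ⟦X⟧,
        (1 : LS ℂ) ⊗ₜ EField.ofEQ w = ∑ j, iota (φ j) • e j ∧
        evalEQ 1 w = ∑ j, γ j * ((coeff 0 (φ j) : ℚ) : ℂ) := by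
  have hfin : Module.Finite (RatFunc ℚ) W := Module.Finite.iff_fg.2 hW.fg
  have hspan : Submodule.span (RatFunc ℚ) {x | x ∈ W ∧ ∃ g, x = EField.ofEQ g} = W :=
    le_antisymm (Submodule.span_le.2 fun x hx => hx.1) hW.le_span
  have hfin' : FiniteDimensional (RatFunc ℚ) (Submodule.span (RatFunc ℚ) {x | x ∈ W ∧ ∃ g, x = EField.ofEQ g}) := by
    rw [hspan]; exact hfin
  obtain ⟨f, hfs, hfspan, hfli⟩ := Submodule.exists_fun_fin_finrank_span_eq (RatFunc ℚ)
    {x | x ∈ W ∧ ∃ g, x = EField.ofEQ g}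
  replace hfspan := hfspan.trans hspan
  revert f
  generalize Module.finrank (RatFunc ℚ) (Submodule.span (RatFunc ℚ) {x | x ∈ W ∧ ∃ g, x = EField.ofEQ g}) = H
  intro f hfs hfli hfspan
  choose hfW G hG using hfs
  have hfG : f = fun i => EField.ofEQ (G i) := funext hG
  subst hfG
  obtain ⟨T, hT, B, hB⟩ := exists_common_denominator (fun i => EField.deriv (EField.ofEQ (G i)))
    (fun i => EField.ofEQ (G i)) fun i => by rw [hfspan]; exact hW.deriv_mem _ (hfW i)
  have hrel : ∀ w : EQ, EField.ofEQ w ∈ W → ∃ q : Polynomial ℚ, q ≠ 0 ∧ ∃ p : Fin H → Polynomial ℚ,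
      EField.ofPoly q * EField.ofEQ w = ∑ j, EField.ofPoly (p j) * EField.ofEQ (G j) := fun w hw => by
    obtain ⟨q, hq, p, hp⟩ := exists_common_denominator (fun _ : Unit => EField.ofEQ w)
      (fun i => EField.ofEQ (G i)) fun i => by rw [hfspan]; exact hw
    exact ⟨q, hq, p (), hp ()⟩
  obtain ⟨γ, Y, hγ, hY, hYd, hYG⟩ := exists_rational_fundamental_matrix T hT B (fun i => (G i : ℚ⟦X⟧))
    (fun i => (G i).2) (fun i => by
      have := hB i
      rw [EField.deriv_ofEQ] at this
      simp only [tau_zero_apply]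
      exact ofPoly_mul_eq_sum _ _ _ _ this) (linearIndependent_poly G hfli) (by
      by_contra! h0
      obtain ⟨q, hq, p, hp⟩ := hrel 1 (by rwa [map_one])
      have h2 := taylorOne_mul_eq_sum _ _ _ _ (ofPoly_mul_eq_sum _ _ _ _ hp)
      simp only [h0, mul_zero, sum_const_zero] at h2
      rw [OneMemClass.coe_one, taylorOne_one, mul_one] at h2
      refine hq (tau_injective 1 (PowerSeries.map_injective _ (algebraMap ℚ ℂ).injective ?_))
      rw [h2, map_zero, map_zero])
  obtain ⟨c, hc⟩ := exists_dual_functionals γ hγ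
  let Z : Matrix (Fin H) (Fin H) (LS ℂ) := Y.map iota
  have hZ : IsUnit Z.det := by
    rw [isUnit_iff_ne_zero]
    change (iota.mapMatrix Y).det ≠ 0
    rw [← RingHom.map_det]
    exact (map_ne_zero_iff _ iota_injective).2 hY
  let v : Fin H → TT := fun i => (1 : LS ℂ) ⊗ₜ EField.ofEQ (G i)
  have hv : LinearIndependent (LS ℂ) v := Module.Flat.linearIndependent_one_tmul hfli
  let e : Fin H → TT := fun j => ∑ i, Z⁻¹ j i • v i
  have hve : ∀ i, v i = ∑ j, iota (Y i j) • e j := fun i => by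
    have := sum_smul_sum_smul Z Z⁻¹ v i
    rw [Matrix.mul_nonsing_inv _ hZ, sum_one_smul] at this
    exact this.symm
  have hcancel : ∀ u : Fin H → TT, (∀ i, ∑ j, iota (Y i j) • u j = 0) → ∀ j, u j = 0 := fun u hu j => by
    have := sum_smul_sum_smul Z⁻¹ Z u j
    rw [Matrix.nonsing_inv_mul _ hZ, sum_one_smul] at this
    rw [← this]
    exact sum_eq_zero fun i _ => by rw [show ∑ k, Z i k • u k = 0 from hu i, smul_zero]
  have hTne : iota (tau 1 T) ≠ 0 := (map_ne_zero_iff _ iota_tau_injective).2 hT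
  refine ⟨H, γ, e, hγ, hcancel _ fun i => ?_, ?_, fun w hw => ?_⟩
  · have h2 : tensorDeriv (v i) = ∑ k, iota (d⁄dX ℚ (Y i k)) • e k + ∑ k, iota (Y i k) • tensorDeriv (e k) := by
      rw [hve, map_sum, ← sum_add_distrib]
      exact sum_congr rfl fun k _ => by rw [tensorDeriv_smul, lsDeriv_iota]
    have h3 : iota (tau 1 T) • tensorDeriv (v i) = iota (tau 1 T) • ∑ k, iota (d⁄dX ℚ (Y i k)) • e k := by
      rw [tensorDeriv_one_tmul, iota_tau_smul_tmul, hB, TensorProduct.tmul_sum, smul_sum]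
      simp only [← iota_tau_smul_tmul, smul_smul, ← map_mul, hYd]
      have h4 : ∀ j, (1 : LS ℂ) ⊗ₜ EField.ofEQ (G j) = ∑ j_1, iota (Y j j_1) • e j_1 := hve
      simp only [h4, smul_sum, smul_smul, map_sum, sum_smul, map_mul]
      exact sum_comm
    rw [smul_right_injective _ hTne h3] at h2
    exact left_eq_add.1 h2
  · rw [Fintype.linearIndependent_iff] at hv ⊢
    intro a ha
    have h2 : ∑ i, (Matrix.vecMul a Z⁻¹) i • v i = 0 := by
      rw [← ha]
      simp only [e, Matrix.vecMul, dotProduct, sum_smul, smul_sum, smul_smul]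
      exact sum_comm
    have h3 : Matrix.vecMul a Z⁻¹ = 0 := funext (hv _ h2)
    have h4 := congrArg (fun x => Matrix.vecMul x Z) h3
    beta_reduce at h4
    rw [Matrix.vecMul_vecMul, Matrix.nonsing_inv_mul _ hZ, Matrix.vecMul_one, Matrix.zero_vecMul] at h4
    exact congrFun h4
  · obtain ⟨q, hq, p, hp⟩ := hrel w hw
    have hqne : iota (tau 1 q) ≠ 0 := (map_ne_zero_iff _ iota_tau_injective).2 hq
    have h2 := taylorOne_mul_eq_sum _ _ _ _ (ofPoly_mul_eq_sum _ _ _ _ hp)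
    have h3 : ∀ j, tau 1 q * coeffMap (c j) (taylorOne w) = ∑ i, tau 1 (p i) * Y i j := fun j => by
      have h4 := congrArg (coeffMap (c j)) h2
      rw [coeffMap_map_mul, coeffMap_sum] at h4
      rw [h4]
      refine sum_congr rfl fun i _ => ?_
      rw [coeffMap_map_mul, hYG, coeffMap_sum]
      simp only [mul_comm (C _), coeffMap_map_mul]
      congr 1
      have h5 : ∀ k, coeffMap (c j) (C (γ k)) = if k = j then 1 else 0 := fun k => by
        ext l
        rw [coeff_coeffMap, coeff_C]
        split_ifs with hl hkj hkj <;> simp [hc, hkj, hl, coeff_one]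
      simp [h5]
    refine ⟨fun j => coeffMap (c j) (taylorOne w), smul_right_injective _ hqne ?_, ?_⟩
    · beta_reduce
      rw [iota_tau_smul_tmul, hp, TensorProduct.tmul_sum, smul_sum]
      have h4 : ∀ j, (1 : LS ℂ) ⊗ₜ EField.ofEQ (G j) = ∑ j_1, iota (Y j j_1) • e j_1 := hve
      simp only [← iota_tau_smul_tmul, smul_smul, ← map_mul, h3, h4, smul_sum, map_sum, sum_smul]
      exact sum_comm
    · have h4 : taylorOne (w : ℚ⟦X⟧) = ∑ j, C (γ j) * PowerSeries.map (algebraMap ℚ ℂ) (coeffMap (c j) (taylorOne w)) := by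
        refine mul_left_cancel₀ (a := PowerSeries.map (algebraMap ℚ ℂ) (tau 1 q)) ?_ ?_
        · exact fun h0 => hq (tau_injective 1 (PowerSeries.map_injective _ (algebraMap ℚ ℂ).injective
            (by rw [h0, map_zero, map_zero])))
        · rw [h2, mul_sum]
          simp only [mul_left_comm _ (C _), ← map_mul, h3, hYG, mul_sum, map_sum]
          rw [sum_comm]
      rw [evalEQ_one]
      conv_lhs => rw [h4]
      rw [map_sum]
      exact sum_congr rfl fun j _ => by rw [coeff_C_mul, coeff_map]; rfl

end EDescent

namespace EDescent

open Finset PowerSeries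
open scoped TensorProduct

namespace IsDiffSpace

theorem one : IsDiffSpace 1 where
  fg := ⟨{1}, by rw [coe_singleton, Submodule.one_eq_span]⟩
  deriv_mem w hw := by
    obtain ⟨a, rfl⟩ := Submodule.mem_one.1 hw
    obtain ⟨a', -, h⟩ := exists_deriv_ratFunc a
    rw [h]
    exact Submodule.mem_one.2 ⟨a', rfl⟩
  le_span := by
    rw [Submodule.one_eq_span]
    exact Submodule.span_mono (Set.singleton_subset_iff.2
      ⟨Submodule.mem_span_singleton_self 1, 1, (map_one _).symm⟩)

theorem sup {V W : Submodule (RatFunc ℚ) EField} (hV : IsDiffSpace V) (hW : IsDiffSpace W) : IsDiffSpace (V ⊔ W) where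
  fg := hV.fg.sup hW.fg
  deriv_mem w hw := by
    obtain ⟨x, hx, y, hy, rfl⟩ := Submodule.mem_sup.1 hw
    rw [map_add]
    exact add_mem (Submodule.mem_sup_left (hV.deriv_mem x hx)) (Submodule.mem_sup_right (hW.deriv_mem y hy))
  le_span := sup_le
    (hV.le_span.trans (Submodule.span_mono fun _ hx => ⟨Submodule.mem_sup_left hx.1, hx.2⟩))
    (hW.le_span.trans (Submodule.span_mono fun _ hx => ⟨Submodule.mem_sup_right hx.1, hx.2⟩))

theorem mul {V W : Submodule (RatFunc ℚ) EField} (hV : IsDiffSpace V) (hW : IsDiffSpace W) : IsDiffSpace (V * W) where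
  fg := hV.fg.mul hW.fg
  deriv_mem w hw := by
    refine Submodule.mul_induction_on hw (fun x hx y hy => ?_) fun x y hx hy => ?_
    · rw [EField.deriv_mul]
      exact add_mem (Submodule.mul_mem_mul (hV.deriv_mem x hx) hy) (Submodule.mul_mem_mul hx (hW.deriv_mem y hy))
    · rw [map_add]
      exact add_mem hx hy
  le_span := by
    refine (mul_le_mul' hV.le_span hW.le_span).trans ?_
    rw [Submodule.span_mul_span]
    refine Submodule.span_mono ?_
    rintro _ ⟨x, ⟨hx, g, rfl⟩, y, ⟨hy, g', rfl⟩, rfl⟩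
    exact ⟨Submodule.mul_mem_mul hx hy, g * g', (map_mul _ _ _).symm⟩

theorem pow {W : Submodule (RatFunc ℚ) EField} (hW : IsDiffSpace W) : ∀ n : ℕ, IsDiffSpace (W ^ n)
  | 0 => by rw [pow_zero]; exact one
  | n + 1 => by rw [pow_succ]; exact (hW.pow n).mul hW

end IsDiffSpace

/-- Multiples of constants by power series. -/
def constSubmonoid : Submonoid TT where
  carrier := {u | ∃ (a : ℂ⟦X⟧) (c : TT), tensorDeriv c = 0 ∧ u = LS.ofPS ℂ a • c}
  one_mem' := ⟨1, 1, by
    have := tensorDeriv_mul 1 1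
    simpa using this, by rw [map_one, one_smul]⟩
  mul_mem' := by
    rintro _ _ ⟨a, c, hc, rfl⟩ ⟨a', c', hc', rfl⟩
    exact ⟨a * a', c * c', by rw [tensorDeriv_mul, hc, hc', zero_mul, mul_zero, add_zero], by
      rw [map_mul, smul_mul_smul_comm]⟩

/-- The ring generated by constants and power series. -/
def constRing : Subring TT := Subring.closure constSubmonoid

theorem smul_mem_constRing (a : ℂ⟦X⟧) {c : TT} (hc : tensorDeriv c = 0) : LS.ofPS ℂ a • c ∈ constRing :=
  Subring.subset_closure ⟨a, c, hc, rfl⟩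

theorem constant_mem_constRing {c : TT} (hc : tensorDeriv c = 0) : c ∈ constRing := by
  have := smul_mem_constRing 1 hc
  rwa [map_one, one_smul] at this

theorem tensorDeriv_one : tensorDeriv 1 = 0 := by
  have := tensorDeriv_mul 1 1
  simpa using this

/-- The local parameter in the ring generated by constants and power series. -/
def constRingX : constRing := ⟨LS.ofPS ℂ X • 1, smul_mem_constRing X tensorDeriv_one⟩

/-- The space of constants. -/
def constants : Submodule ℂ TT where
  carrier := {c | tensorDeriv c = 0}
  add_mem' {a b} ha hb := by
    change tensorDeriv (a + b) = 0
    rw [map_add, show tensorDeriv a = 0 from ha, show tensorDeriv b = 0 from hb, add_zero]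
  zero_mem' := map_zero _
  smul_mem' r c hc := by
    change tensorDeriv (r • c) = 0
    rw [← algebraMap_smul (LS ℂ) r c, tensorDeriv_smul, show tensorDeriv c = 0 from hc, smul_zero, add_zero,
      ← LS.ofPS_C, lsDeriv_ofPS, derivative_C, map_zero, zero_smul]

theorem exists_functional_constants {c : TT} (hc : tensorDeriv c = 0) (hc0 : c ≠ 0) :
    ∃ l : TT →ₗ[LS ℂ] LS ℂ, l c ≠ 0 ∧ ∀ c', tensorDeriv c' = 0 → ∃ z : ℂ, l c' = algebraMap ℂ (LS ℂ) z := by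
  let b := Module.Basis.ofVectorSpace ℂ constants
  have hli : LinearIndependent (LS ℂ) fun i => (b i : TT) :=
    linearIndependent_of_constants (C := ℂ) (lsDeriv ℂ : LS ℂ →+ LS ℂ) (lsDeriv_eq_zero (K := ℂ)) tensorDeriv
      tensorDeriv_smul _ (fun i => (b i).2) (b.linearIndependent.map' constants.subtype constants.ker_subtype)
  have hrep : b.repr ⟨c, hc⟩ ≠ 0 := fun h => hc0 (congrArg Subtype.val ((map_eq_zero_iff _ b.repr.injective).1 h))
  obtain ⟨i, hi⟩ := Finsupp.ne_iff.1 hrep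
  obtain ⟨l, hl⟩ := LinearMap.exists_extend ((Finsupp.lapply i).comp hli.repr)
  have hlb : ∀ j, l (b j) = algebraMap ℂ (LS ℂ) (b.coord i (b j)) := fun j => by
    have h1 := congrArg (fun f => f ⟨(b j : TT), Submodule.subset_span ⟨j, rfl⟩⟩) hl
    beta_reduce at h1
    rw [LinearMap.comp_apply, LinearMap.comp_apply] at h1
    refine h1.trans ?_
    rw [hli.repr_eq_single j _ rfl, Module.Basis.coord_apply, Module.Basis.repr_self, Finsupp.lapply_apply]
    by_cases hij : j = i
    · subst hij; simp
    · simp [hij]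
  have hlc : ∀ c' : constants, l c' = algebraMap ℂ (LS ℂ) (b.coord i c') := fun c' => by
    have h2 : (l.restrictScalars ℂ).comp constants.subtype = (Algebra.linearMap ℂ (LS ℂ)).comp (b.coord i) :=
      b.ext hlb
    exact LinearMap.congr_fun h2 c'
  refine ⟨l, ?_, fun c' hc' => ⟨_, hlc ⟨c', hc'⟩⟩⟩
  rw [hlc ⟨c, hc⟩, Ne, map_eq_zero_iff _ (algebraMap ℂ (LS ℂ)).injective]
  exact hi

theorem eq_zero_of_mem_span_X (c : constRing) (hc : tensorDeriv c = 0) (h : c ∈ Ideal.span {constRingX}) : c = 0 := by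
  by_contra hc0
  obtain ⟨l, hl, hlc⟩ := exists_functional_constants hc fun h0 => hc0 (Subtype.ext h0)
  have hmem : ∀ u ∈ constRing, ∃ f : ℂ⟦X⟧, l u = LS.ofPS ℂ f := fun u hu => by
    rw [constRing, Subring.mem_closure_iff, Submonoid.closure_eq] at hu
    refine AddSubgroup.closure_induction (fun x hx => ?_) ⟨0, by rw [map_zero, map_zero]⟩ (fun x y _ _ hx hy => ?_)
      (fun x _ hx => ?_) hu
    · obtain ⟨a, c', hc', rfl⟩ := hx
      obtain ⟨z, hz⟩ := hlc c' hc'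
      exact ⟨a * C z, by rw [map_smul, hz, map_mul, LS.ofPS_C, smul_eq_mul]⟩
    · obtain ⟨f, hf⟩ := hx
      obtain ⟨g, hg⟩ := hy
      exact ⟨f + g, by rw [map_add, hf, hg, map_add]⟩
    · obtain ⟨f, hf⟩ := hx
      exact ⟨-f, by rw [map_neg, hf, map_neg]⟩
  obtain ⟨u, rfl⟩ := Ideal.mem_span_singleton'.1 h
  obtain ⟨f, hf⟩ := hmem u u.2
  obtain ⟨z, hz⟩ := hlc _ hc
  have h1 : l ((u * constRingX : constRing) : TT) = LS.ofPS ℂ (X * f) := by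
    change l ((u : TT) * (LS.ofPS ℂ X • 1)) = _
    rw [mul_smul_comm, mul_one, map_smul, hf, map_mul, smul_eq_mul]
  rw [h1, ← LS.ofPS_C] at hz
  have h2 := congrArg (coeff 0) (LS.ofPS_injective (K := ℂ) hz)
  rw [coeff_zero_X_mul, coeff_zero_C] at h2
  rw [h1, hz, ← h2, map_zero, map_zero] at hl
  exact hl rfl

end EDescent

namespace EDescent

open Finset PowerSeries
open scoped TensorProduct

section normMatrix
variable {L ι : Type*} [Field L] [Algebra ℚ L] [Fintype ι] [DecidableEq ι] (b : Module.Basis ι ℚ L)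

/-- The matrix of multiplication by the generic element `∑ h j ⊗ b j`. -/
def normMatrix {R : Type*} [CommRing R] (r : ℚ →+* R) (h : ι → R) : Matrix ι ι R :=
  Matrix.of fun k l => ∑ j, r (Algebra.leftMulMatrix b (b j) k l) * h j

theorem map_normMatrix {R R' : Type*} [CommRing R] [CommRing R'] (r : ℚ →+* R) (r' : ℚ →+* R') (f : R →+* R')
    (h : ι → R) : f (normMatrix b r h).det = (normMatrix b r' fun j => f (h j)).det := by
  rw [RingHom.map_det]
  congr 1
  ext k l
  rw [RingHom.mapMatrix_apply, Matrix.map_apply, normMatrix, normMatrix, Matrix.of_apply, Matrix.of_apply, map_sum]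
  refine sum_congr rfl fun j _ => ?_
  rw [map_mul, ← Subsingleton.elim (f.comp r) r', RingHom.comp_apply]

theorem det_normMatrix [FiniteDimensional ℚ L] {R : Type*} [CommRing R] [Algebra ℂ R] (r : ℚ →+* R)
    (e : ι ≃ (L →ₐ[ℚ] ℂ)) (h : ι → R) :
    (normMatrix b r h).det = ∏ i, ∑ j, algebraMap ℂ R (e i (b j)) * h j := by
  let S : Matrix ι ι ℂ := (Algebra.embeddingsMatrixReindex ℚ ℂ b e).transpose
  have hS : IsUnit (S.map (algebraMap ℂ R)).det := by
    change IsUnit ((algebraMap ℂ R).mapMatrix S).det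
    rw [← RingHom.map_det]
    refine IsUnit.map _ (isUnit_iff_ne_zero.2 fun h0 => ?_)
    have h1 := Algebra.discr_eq_det_embeddingsMatrixReindex_pow_two ℚ ℂ b e
    rw [Matrix.det_transpose] at h0
    rw [h0, zero_pow two_ne_zero, _root_.map_eq_zero] at h1
    exact Algebra.discr_not_zero_of_basis ℚ b h1
  have hSM : S.map (algebraMap ℂ R) * normMatrix b r h =
      Matrix.diagonal (fun i => ∑ j, algebraMap ℂ R (e i (b j)) * h j) * S.map (algebraMap ℂ R) := by
    ext i l
    rw [Matrix.mul_apply, Matrix.diagonal_mul, Matrix.map_apply]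
    simp only [normMatrix, Matrix.of_apply, Matrix.map_apply, mul_sum, sum_mul]
    rw [sum_comm]
    refine sum_congr rfl fun j _ => ?_
    have h1 : ∀ k, S i k = e i (b k) := fun k => rfl
    have h2 : ∑ k, e i (b k) * ((Algebra.leftMulMatrix b (b j) k l : ℚ) : ℂ) = e i (b j) * e i (b l) := by
      rw [← map_mul, ← b.sum_repr (b j * b l), map_sum]
      refine sum_congr rfl fun k _ => ?_
      rw [map_smul, Algebra.leftMulMatrix_eq_repr_mul, Algebra.smul_def, mul_comm]
      rfl
    rw [h1, mul_right_comm, ← map_mul, ← h2, map_sum, sum_mul]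
    refine sum_congr rfl fun k _ => ?_
    rw [h1, ← mul_assoc, map_mul, ← Subsingleton.elim ((algebraMap ℂ R).comp (algebraMap ℚ ℂ)) r]
    rfl
  have h3 := congrArg Matrix.det hSM
  rw [Matrix.det_mul, Matrix.det_mul, Matrix.det_diagonal, mul_comm] at h3
  exact hS.mul_right_cancel h3

end normMatrix

theorem TT.eq_zero_or_eq_zero (u v : TT) (h : u * v = 0) : u = 0 ∨ v = 0 :=
  tensorProduct_eq_zero_or_eq_zero EField.mem_range_of_isAlgebraic u v h

/-- Complex numbers in the ring generated by constants and power series. -/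
def complexToConstRing : ℂ →+* constRing :=
  (algebraMap ℂ TT).codRestrict constRing fun z => constant_mem_constRing (by
    rw [Algebra.algebraMap_eq_smul_one]
    exact constants.smul_mem z tensorDeriv_one)

theorem constant_sum {ι : Type*} (s : Finset ι) (z : ι → ℂ) (e : ι → TT) (he : ∀ i, tensorDeriv (e i) = 0) :
    tensorDeriv (∑ i ∈ s, z i • e i) = 0 :=
  constants.sum_mem fun i _ => constants.smul_mem _ (he i)

theorem exists_reduction {H : ℕ} (φ : Fin H → ℚ⟦X⟧) (e : Fin H → TT) (he : ∀ i, tensorDeriv (e i) = 0) :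
    ∃ u c : constRing, (u : TT) = ∑ i, iota (φ i) • e i ∧ (c : TT) = ∑ i, ((coeff 0 (φ i) : ℚ) : ℂ) • e i ∧
      u - c ∈ Ideal.span {constRingX} := by
  have hu : ∑ i, iota (φ i) • e i ∈ constRing := constRing.sum_mem fun i _ => smul_mem_constRing _ (he i)
  refine ⟨⟨_, hu⟩, ⟨_, constant_mem_constRing (constant_sum univ _ e he)⟩, rfl, rfl, ?_⟩
  have hψ : ∀ i, ∃ ψ : ℂ⟦X⟧, PowerSeries.map (algebraMap ℚ ℂ) (φ i) = C ((coeff 0 (φ i) : ℚ) : ℂ) + X * ψ := fun i => by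
    have : X ∣ PowerSeries.map (algebraMap ℚ ℂ) (φ i) - C ((coeff 0 (φ i) : ℚ) : ℂ) := by
      rw [X_dvd_iff, ← coeff_zero_eq_constantCoeff_apply, map_sub, coeff_map, coeff_zero_C]
      exact sub_self _
    obtain ⟨ψ, h⟩ := this
    exact ⟨ψ, by rw [← h]; ring⟩
  choose ψ hψ using hψ
  have hv : ∑ i, LS.ofPS ℂ (ψ i) • e i ∈ constRing := constRing.sum_mem fun i _ => smul_mem_constRing _ (he i)
  refine Ideal.mem_span_singleton'.2 ⟨⟨_, hv⟩, Subtype.ext ?_⟩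
  change (∑ i, LS.ofPS ℂ (ψ i) • e i) * (LS.ofPS ℂ X • 1) = ∑ i, iota (φ i) • e i - ∑ i, ((coeff 0 (φ i) : ℚ) : ℂ) • e i
  rw [mul_smul_comm, mul_one, smul_sum, ← sum_sub_distrib]
  refine sum_congr rfl fun i _ => ?_
  change _ = LS.ofPS ℂ (PowerSeries.map (algebraMap ℚ ℂ) (φ i)) • e i - _
  rw [hψ, map_add, LS.ofPS_C, add_smul, algebraMap_smul, add_sub_cancel_left, smul_smul, map_mul]

/-- A number field relation between values at `1` of E-functions with rational coefficients is trivial. -/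
theorem evalEQ_eq_zero_of_basis_sum {L ι : Type*} [Field L] [Algebra ℚ L] [FiniteDimensional ℚ L] [Fintype ι]
    (b : Module.Basis ι ℚ L) (s : L →ₐ[ℚ] ℂ) (W : Submodule (RatFunc ℚ) EField) (hW : IsDiffSpace W)
    (h1 : (1 : EField) ∈ W) (F : ι → EQ) (hF : ∀ j, EField.ofEQ (F j) ∈ W)
    (h0 : ∑ j, s (b j) * evalEQ 1 (F j) = 0) (j : ι) : evalEQ 1 (F j) = 0 := by
  classical
  obtain ⟨H, γ, e, hγ, he, heli, hframe⟩ := exists_constant_frame W hW h1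
  choose φ hφ hφγ using fun j => hframe (F j) (hF j)
  have hcard : Fintype.card ι = Fintype.card (L →ₐ[ℚ] ℂ) := by
    rw [AlgHom.card, Module.finrank_eq_card_basis b]
  let σ : ι ≃ (L →ₐ[ℚ] ℂ) := Fintype.equivOfCardEq hcard
  let g : EQ := (normMatrix b (algebraMap ℚ EQ) F).det
  have hg1 : evalEQ 1 g = 0 := by
    rw [map_normMatrix b _ (algebraMap ℚ ℂ), det_normMatrix b _ σ]
    refine prod_eq_zero (mem_univ (σ.symm s)) ?_
    rw [Equiv.apply_symm_apply]
    exact h0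
  have hgW : EField.ofEQ g ∈ W ^ Fintype.card ι := by
    rw [map_normMatrix b _ ((algebraMap (RatFunc ℚ) EField).comp (algebraMap ℚ (RatFunc ℚ)))]
    refine det_mem_pow_card _ _ fun k l => ?_
    rw [normMatrix, Matrix.of_apply]
    refine sum_mem fun i _ => ?_
    rw [RingHom.comp_apply, ← Algebra.smul_def]
    exact W.smul_mem _ (hF i)
  have h1W : (1 : EField) ∈ W ^ Fintype.card ι := by
    have := Submodule.pow_mem_pow W h1 (Fintype.card ι)
    rwa [one_pow] at this
  obtain ⟨H', γ', e', hγ', he', -, hframe'⟩ := exists_constant_frame _ (hW.pow (Fintype.card ι)) h1W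
  obtain ⟨φ', hφ', hφγ'⟩ := hframe' g hgW
  rw [hg1] at hφγ'
  have hφ'0 : ∀ i, coeff 0 (φ' i) = 0 := by
    refine Fintype.linearIndependent_iff.1 hγ' _ ?_
    rw [hφγ']
    exact sum_congr rfl fun i _ => by rw [Algebra.smul_def, mul_comm]; rfl
  obtain ⟨u', c', hu', hc', huc'⟩ := exists_reduction φ' e' he'
  have hc'0 : c' = 0 := Subtype.ext (hc'.trans (sum_eq_zero fun i _ => by rw [hφ'0, Rat.cast_zero, zero_smul]))
  rw [hc'0, sub_zero] at huc'
  choose u c hu hc huc using fun j => exists_reduction (φ j) e he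
  let r : ℚ →+* constRing := complexToConstRing.comp (algebraMap ℚ ℂ)
  have hdetu : (normMatrix b r u).det = u' := by
    refine Subtype.ext ?_
    rw [hu', ← hφ']
    have h2 := map_normMatrix b r ((algebraMap ℂ TT).comp (algebraMap ℚ ℂ)) constRing.subtype u
    have h3 := map_normMatrix b (algebraMap ℚ EQ) ((algebraMap ℂ TT).comp (algebraMap ℚ ℂ))
      ((Algebra.TensorProduct.includeRight (R := RatFunc ℚ) (A := LS ℂ) (B := EField)).toRingHom.comp EField.ofEQ) F
    refine h2.trans (Eq.trans ?_ h3.symm)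
    congr 2
    funext j
    exact (hu j).trans (hφ j).symm
  have hdetc : (normMatrix b r c).det ∈ Ideal.span {constRingX} := by
    rw [← Ideal.Quotient.eq_zero_iff_mem, map_normMatrix b r ((Ideal.Quotient.mk _).comp r)]
    have h2 : ∀ j, Ideal.Quotient.mk (Ideal.span {constRingX}) (c j) = Ideal.Quotient.mk (Ideal.span {constRingX}) (u j) :=
      fun j => (Ideal.Quotient.eq.2 (huc j)).symm
    simp only [h2]
    rw [← map_normMatrix b r, hdetu, Ideal.Quotient.eq_zero_iff_mem]
    exact huc'
  have hcD : ∀ j, tensorDeriv (c j) = 0 := fun j => by rw [hc]; exact constant_sum _ _ _ he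
  have hprod : ((normMatrix b r c).det : TT) = ∏ i, ∑ j, σ i (b j) • (c j : TT) := by
    have h2 := map_normMatrix b r ((algebraMap ℂ TT).comp (algebraMap ℚ ℂ)) constRing.subtype c
    refine h2.trans ?_
    rw [det_normMatrix b _ σ]
    simp only [Algebra.smul_def]
    rfl
  have hprod0 : ∏ i, ∑ j, σ i (b j) • (c j : TT) = 0 := by
    rw [← hprod, eq_zero_of_mem_span_X _ ?_ hdetc, ZeroMemClass.coe_zero]
    rw [hprod]
    refine prod_induction _ (fun v => tensorDeriv v = 0) (fun v w hv hw => ?_) tensorDeriv_one fun i _ =>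
      constant_sum _ _ _ hcD
    rw [tensorDeriv_mul, hv, hw, zero_mul, mul_zero, add_zero]
  have : NoZeroDivisors TT := ⟨fun h => TT.eq_zero_or_eq_zero _ _ h⟩
  have : Nontrivial TT := inferInstance
  obtain ⟨i, -, hi⟩ := prod_eq_zero_iff.1 hprod0
  have ht : ∀ k, ∑ j, (coeff 0 (φ j k)) • b j = 0 := fun k => by
    have h2 : ∑ k, algebraMap ℂ (LS ℂ) (∑ j, σ i (b j) * ((coeff 0 (φ j k) : ℚ) : ℂ)) • e k = 0 := by
      rw [← hi]
      simp only [hc, algebraMap_smul, sum_smul, smul_sum, mul_smul]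
      exact sum_comm
    have h3 := Fintype.linearIndependent_iff.1 heli _ h2 k
    rw [_root_.map_eq_zero] at h3
    refine (map_eq_zero_iff (σ i) (σ i).injective).1 ?_
    rw [map_sum, ← h3]
    refine sum_congr rfl fun j _ => ?_
    rw [map_smul, Algebra.smul_def, mul_comm]
    rfl
  rw [hφγ]
  refine sum_eq_zero fun k _ => ?_
  rw [Fintype.linearIndependent_iff.1 b.linearIndependent _ (ht k) j, Rat.cast_zero, mul_zero]

end EDescent

namespace EDescent

open Finset PowerSeries

theorem psD_eq_derivative (f : ℂ⟦X⟧) : psD f = d⁄dX ℂ f := by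
  ext n
  rw [psD, coeff_mk, coeff_derivative, mul_comm]

theorem coeff_ePS (a : ℕ → ℂ) (n : ℕ) : coeff n (ePS a) = a n / (n.factorial : ℂ) := coeff_mk _ _

theorem factorial_mul_coeff_ePS (a : ℕ → ℂ) (n : ℕ) : (n.factorial : ℂ) * coeff n (ePS a) = a n := by
  rw [coeff_ePS, mul_div_cancel₀]
  exact_mod_cast n.factorial_ne_zero

theorem sum_polyPS_mul_psD (m : ℕ) (p : ℕ → Polynomial ℂ) (f : ℂ⟦X⟧) :
    ∑ i ∈ range (m + 1), polyPS (p i) * psD^[i] f = ∑ i ∈ range (m + 1), (p i : ℂ⟦X⟧) * (d⁄dX ℂ)^[i] f := by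
  rw [show psD = ⇑(d⁄dX ℂ) from funext psD_eq_derivative]
  rfl

theorem finiteDimensional_adjoin_of_finite {s : Set ℂ} (hs : s.Finite) (h : ∀ x ∈ s, IsAlgebraic ℚ x) :
    FiniteDimensional ℚ (IntermediateField.adjoin ℚ s) := by
  have := hs.to_subtype
  exact IntermediateField.finiteDimensional_adjoin fun x hx => (h x hx).isIntegral

/-- The Taylor coefficients of an E-function lie in a number field. -/
theorem exists_numberField {a : ℕ → ℂ} (ha : IsE a) :
    ∃ L : IntermediateField ℚ ℂ, FiniteDimensional ℚ L ∧ ∀ n, a n ∈ L := by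
  obtain ⟨halg, ⟨m, p, hp, ⟨i0, hi0, hpi0⟩, hsum⟩, -⟩ := ha
  rw [sum_polyPS_mul_psD] at hsum
  let s : Set ℂ := ⋃ i ∈ range (m + 1), ((p i).coeffs : Set ℂ)
  have hs : s.Finite := (range (m + 1)).finite_toSet.biUnion fun i _ => finite_toSet _
  let F := IntermediateField.adjoin ℚ s
  have hF : FiniteDimensional ℚ F := finiteDimensional_adjoin_of_finite hs fun x hx => by
    simp only [s, Set.mem_iUnion] at hx
    obtain ⟨i, -, hi⟩ := hx
    obtain ⟨k, -, rfl⟩ := Polynomial.mem_coeffs_iff.1 (mem_coe.1 hi)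
    exact hp i k
  have hlift : ∀ i, ∃ q : Polynomial F, i ∈ range (m + 1) → q.map (algebraMap F ℂ) = p i := fun i => by
    by_cases hi : i ∈ range (m + 1)
    · have : p i ∈ Polynomial.lifts (algebraMap F ℂ) := by
        rw [Polynomial.lifts_iff_coeff_lifts]
        intro k
        by_cases h0 : (p i).coeff k = 0
        · exact ⟨0, by rw [h0, map_zero]⟩
        · exact ⟨⟨_, IntermediateField.subset_adjoin ℚ s (Set.mem_biUnion hi
            (Polynomial.coeff_mem_coeffs h0))⟩, rfl⟩
      obtain ⟨q, hq⟩ := Polynomial.mem_lifts _ |>.1 this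
      exact ⟨q, fun _ => hq⟩
    · exact ⟨0, fun h => absurd h hi⟩
  choose q hq using hlift
  obtain ⟨m0, hm0⟩ := exists_coeff_determined m q ⟨i0, hi0, fun h => hpi0 (by
    rw [← hq i0 (mem_range.2 (by omega)), h, Polynomial.map_zero])⟩ (ePS a) (by
    rw [← hsum]
    exact sum_congr rfl fun i hi => by rw [hq i hi])
  let t : Set ℂ := (fun k => coeff k (ePS a)) '' (range m0 : Set ℕ)
  have ht : t.Finite := (finite_toSet _).image _
  have htalg : ∀ x ∈ t, IsAlgebraic ℚ x := by
    rintro _ ⟨k, -, rfl⟩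
    beta_reduce
    rw [coeff_ePS, div_eq_mul_inv]
    refine (halg k).mul (IsAlgebraic.inv ?_)
    exact_mod_cast isAlgebraic_natCast k.factorial
  let S := IntermediateField.adjoin F t
  have hS : FiniteDimensional F S := by
    have := ht.to_subtype
    exact IntermediateField.finiteDimensional_adjoin fun x hx => ((htalg x hx).isIntegral).tower_top
  refine ⟨S.restrictScalars ℚ, ?_, fun n => ?_⟩
  · exact Module.Finite.trans (R := ℚ) F S
  · have h1 : coeff n (ePS a) ∈ S := hm0 S (fun k hk => IntermediateField.subset_adjoin F t
      ⟨k, mem_coe.2 (mem_range.2 hk), rfl⟩) n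
    rw [← factorial_mul_coeff_ePS a n]
    exact S.mul_mem (natCast_mem S _) h1

end EDescent

namespace EDescent

open Finset PowerSeries

/-- Every rational functional on `ℂ` is given on a number field by the trace. -/
theorem exists_trace_eq (L : IntermediateField ℚ ℂ) [FiniteDimensional ℚ L] (c : ℂ →ₗ[ℚ] ℚ) :
    ∃ u : L, ∀ x : L, c x = Algebra.trace ℚ L (u * x) := by
  let B := Algebra.traceForm ℚ L
  have hB : B.Nondegenerate := traceForm_nondegenerate ℚ L
  refine ⟨(B.toDual hB).symm (c ∘ₗ L.val.toLinearMap), fun x => ?_⟩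
  have h := LinearMap.BilinForm.apply_toDual_symm_apply (B := B) (hB := hB) (c ∘ₗ L.val.toLinearMap) x
  rw [← Algebra.traceForm_apply]
  exact h.symm

/-- Embeddings of a number field extend to the field of algebraic numbers. -/
theorem exists_extension_integralClosure (L : IntermediateField ℚ ℂ) [FiniteDimensional ℚ L] (s : L →ₐ[ℚ] ℂ) :
    ∃ σ : (integralClosure ℚ ℂ) →+* ℂ, ∀ (x : L) (h : (x : ℂ) ∈ integralClosure ℚ ℂ), σ ⟨x, h⟩ = s x := by
  have hInt : ∀ x : L, (x : ℂ) ∈ integralClosure ℚ ℂ := fun x =>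
    (IsIntegral.of_finite ℚ x).map L.val
  let j : L →+* integralClosure ℚ ℂ := L.val.toRingHom.codRestrict _ hInt
  let _ : Algebra L (integralClosure ℚ ℂ) := j.toAlgebra
  let _ : Algebra L ℂ := s.toRingHom.toAlgebra
  have : IsScalarTower ℚ L (integralClosure ℚ ℂ) := IsScalarTower.of_algebraMap_eq fun q => by
    apply Subtype.ext
    simp
    rfl
  have halg : Algebra.IsAlgebraic L (integralClosure ℚ ℂ) :=
    ⟨fun x => ((integralClosure.isIntegral x).isAlgebraic).tower_top L⟩
  have htf : Module.IsTorsionFree L (integralClosure ℚ ℂ) :=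
    Module.isTorsionFree_iff_algebraMap_injective.2 j.injective
  refine ⟨(IsAlgClosed.lift : integralClosure ℚ ℂ →ₐ[L] ℂ).toRingHom, fun x h => ?_⟩
  exact AlgHom.commutes (IsAlgClosed.lift : integralClosure ℚ ℂ →ₐ[L] ℂ) x

theorem ecoeff_coeffMap_ePS (c : ℂ →ₗ[ℚ] ℚ) (a : ℕ → ℂ) (n : ℕ) : ecoeff (coeffMap c (ePS a)) n = c (a n) := by
  rw [ecoeff, coeff_coeffMap, ← smul_eq_mul, ← map_smul, Algebra.smul_def, map_natCast, factorial_mul_coeff_ePS]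

theorem exists_integral_natCast_mul (L : IntermediateField ℚ ℂ) [FiniteDimensional ℚ L] (u : L) :
    ∃ N : ℕ, 0 < N ∧ IsIntegral ℤ ((N : L) * u) := by
  have hu : IsAlgebraic ℤ u := (IsFractionRing.isAlgebraic_iff ℤ ℚ L).2 (IsIntegral.of_finite ℚ u).isAlgebraic
  obtain ⟨y, hy, hi⟩ := hu.exists_integral_multiple
  refine ⟨y.natAbs, Int.natAbs_pos.2 hy, ?_⟩
  rcases Int.natAbs_eq y with h | h
  · rw [h] at hi
    simpa [zsmul_eq_mul] using hi
  · rw [h] at hi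
    simpa [zsmul_eq_mul] using hi

theorem norm_trace_le (L : IntermediateField ℚ ℂ) [FiniteDimensional ℚ L] (u : L) :
    ∃ A : ℝ, 0 ≤ A ∧ ∀ (x : L) (D : ℝ), (∀ s : L →ₐ[ℚ] ℂ, ‖s x‖ ≤ D) →
      ((|Algebra.trace ℚ L (u * x)| : ℚ) : ℝ) ≤ A * D := by
  refine ⟨∑ s : L →ₐ[ℚ] ℂ, ‖s u‖, sum_nonneg fun _ _ => norm_nonneg _, fun x D hD => ?_⟩
  have h := trace_eq_sum_embeddings ℂ (K := ℚ) (x := u * x)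
  rw [eq_ratCast] at h
  rw [Rat.cast_abs, ← Complex.norm_ratCast, h, sum_mul]
  refine (norm_sum_le _ _).trans (sum_le_sum fun s _ => ?_)
  rw [map_mul, norm_mul]
  exact mul_le_mul_of_nonneg_left (hD s) (norm_nonneg _)

theorem coeffMap_ePS_mem_EQ {a : ℕ → ℂ} (ha : IsE a) (c : ℂ →ₗ[ℚ] ℚ) : coeffMap c (ePS a) ∈ EQ := by
  obtain ⟨L, hL, haL⟩ := exists_numberField ha
  obtain ⟨u, hu⟩ := exists_trace_eq L c
  obtain ⟨N, hN, hNu⟩ := exists_integral_natCast_mul L u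
  obtain ⟨A, hA, hAle⟩ := norm_trace_le L u
  obtain ⟨-, -, C, hC, d, H⟩ := ha
  have hca : ∀ n, c (a n) = Algebra.trace ℚ L (u * ⟨a n, haL n⟩) := fun n => hu ⟨a n, haL n⟩
  let N' := N * (c (a 0)).den
  have hN' : 0 < N' := Nat.mul_pos hN (Rat.den_pos _)
  obtain ⟨C', hC'⟩ := exists_nat_ge (C + A + N' + ((|c (a 0)| : ℚ) : ℝ) + 1)
  have hc0 : (0 : ℝ) ≤ ((|c (a 0)| : ℚ) : ℝ) := by exact_mod_cast abs_nonneg _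
  have hN0 : (0 : ℝ) ≤ N' := Nat.cast_nonneg _
  have hC'pos : 0 < C' := by
    have : (0 : ℝ) < C' := by linarith
    exact_mod_cast this
  have hpow : ∀ n, C ^ n ≤ (C' : ℝ) ^ n := fun n => pow_le_pow_left₀ hC.le (by linarith) n
  refine ⟨C', fun n => if n = 0 then N' else N' * d n, hC'pos, fun n => ?_⟩
  simp only [ecoeff_coeffMap_ePS]
  have hint0 : ∃ z : ℤ, (N' : ℚ) * c (a 0) = z := ⟨N * (c (a 0)).num, by
    have h1 := Rat.mul_den_eq_num (c (a 0))
    simp only [N']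
    push_cast
    linear_combination (N : ℚ) * h1⟩
  rcases Nat.eq_zero_or_pos n with rfl | hn
  · refine ⟨by simpa using hN', ?_, ?_, fun i hi => ?_⟩
    · have : (N' : ℝ) ≤ C' := by linarith
      rw [if_pos rfl, zero_add, pow_one]
      exact_mod_cast this
    · have : ((|c (a 0)| : ℚ) : ℝ) ≤ C' := by linarith
      rw [zero_add, pow_one]
      exact_mod_cast this
    · obtain rfl : i = 0 := by omega
      simpa using hint0
  · obtain ⟨hd, hdle, hσ, hInt⟩ := H n hn
    rw [if_neg hn.ne']
    refine ⟨Nat.mul_pos hN' hd, ?_, ?_, fun i hi => ?_⟩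
    · have h1 : (N' : ℝ) * d n ≤ C' * (C' : ℝ) ^ n :=
        mul_le_mul (by linarith) (hdle.trans (hpow n)) (Nat.cast_nonneg _) (Nat.cast_nonneg _)
      rw [pow_succ']
      exact_mod_cast h1
    · have h1 : ((|c (a n)| : ℚ) : ℝ) ≤ A * C ^ n := by
        rw [hca]
        refine hAle _ _ fun s => ?_
        obtain ⟨σ, hσs⟩ := exists_extension_integralClosure L s
        have hmem : a n ∈ integralClosure ℚ ℂ :=
          (IsIntegral.of_finite ℚ (⟨a n, haL n⟩ : L)).map L.val
        rw [← hσs ⟨a n, haL n⟩ hmem]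
        exact hσ σ hmem
      have h2 : ((|c (a n)| : ℚ) : ℝ) ≤ C' * (C' : ℝ) ^ n :=
        h1.trans (mul_le_mul (by linarith) (hpow n) (by positivity) (Nat.cast_nonneg _))
      rw [pow_succ']
      exact_mod_cast h2
    · rcases Nat.eq_zero_or_pos i with rfl | hi0
      · obtain ⟨z, hz⟩ := hint0
        exact ⟨d n * z, by push_cast; linear_combination (d n : ℚ) * hz⟩
      · have h1 : IsIntegral ℤ ((d n : L) * ⟨a i, haL i⟩) := by
          rw [← isIntegral_algHom_iff (L.val.restrictScalars ℤ) L.val.injective]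
          simpa using hInt i hi0 hi
        have h2 : IsIntegral ℤ (Algebra.trace ℚ L (((N : L) * u) * ((d n : L) * ⟨a i, haL i⟩))) :=
          Algebra.isIntegral_trace (hNu.mul h1)
        obtain ⟨z, hz⟩ := IsIntegrallyClosed.isIntegral_iff.1 h2
        refine ⟨(c (a 0)).den * z, ?_⟩
        have h3 : ((N : L) * u) * ((d n : L) * ⟨a i, haL i⟩) = ((N * d n : ℕ) : ℚ) • (u * ⟨a i, haL i⟩) := by
          rw [Algebra.smul_def, map_natCast]; push_cast; ring
        rw [h3, map_smul, ← hca, smul_eq_mul] at hz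
        simp only [eq_intCast] at hz
        push_cast at hz ⊢
        rw [hz]
        simp only [N']
        push_cast
        ring

end EDescent

namespace EDescent

open Finset PowerSeries

/-- The coordinates with respect to a basis of a number field extend to rational functionals on `ℂ`. -/
theorem exists_coordinates (L : IntermediateField ℚ ℂ) {s : ℕ} (b : Module.Basis (Fin s) ℚ L) :
    ∃ e : Fin s → (ℂ →ₗ[ℚ] ℚ), ∀ x ∈ L, x = ∑ j, e j x • (b j : ℂ) := by
  obtain ⟨g, hg⟩ := LinearMap.exists_leftInverse_of_injective L.val.toLinearMap
    (LinearMap.ker_eq_bot.2 L.val.injective)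
  refine ⟨fun j => b.coord j ∘ₗ g, fun x hx => ?_⟩
  have h1 : ∀ j, (b.coord j ∘ₗ g) x = b.repr ⟨x, hx⟩ j := fun j =>
    congrArg (b.coord j) (LinearMap.congr_fun hg ⟨x, hx⟩)
  have h2 := congrArg L.val (b.sum_repr ⟨x, hx⟩)
  rw [map_sum] at h2
  simp only [← h1] at h2
  exact h2.symm

theorem coeffMap_eq_sum {s : ℕ} {γ : Fin s → ℂ} {e : Fin s → (ℂ →ₗ[ℚ] ℚ)} (c : ℂ →ₗ[ℚ] ℚ) (f : ℂ⟦X⟧)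
    (hf : ∀ n, coeff n f = ∑ j, e j (coeff n f) • γ j) :
    coeffMap c f = ∑ j, c (γ j) • coeffMap (e j) f := by
  ext n
  rw [coeff_coeffMap, map_sum]
  conv_lhs => rw [hf n]
  rw [map_sum]
  refine sum_congr rfl fun j _ => ?_
  rw [map_smul, map_smul, coeff_coeffMap, smul_eq_mul, smul_eq_mul, mul_comm]

theorem coeffMap_C_mul (c : ℂ →ₗ[ℚ] ℚ) (r : ℂ) (f : ℂ⟦X⟧) :
    coeffMap c (C r * f) = coeffMap (c ∘ₗ LinearMap.mulLeft ℚ r) f := by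
  ext n
  rw [coeff_coeffMap, coeff_coeffMap, coeff_C_mul]
  rfl

theorem coeffMap_coe_mul (c : ℂ →ₗ[ℚ] ℚ) (p : Polynomial ℂ) (f : ℂ⟦X⟧) :
    coeffMap c (p * f) =
      ∑ k ∈ p.support, X ^ k * coeffMap (c ∘ₗ LinearMap.mulLeft ℚ (p.coeff k)) f := by
  have hp : (p : ℂ⟦X⟧) = ∑ k ∈ p.support, PowerSeries.map (algebraMap ℚ ℂ) (X ^ k) * C (p.coeff k) := by
    conv_lhs => rw [p.as_sum_support_C_mul_X_pow]
    rw [← Polynomial.coeToPowerSeries.ringHom_apply, map_sum]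
    refine sum_congr rfl fun k _ => ?_
    rw [Polynomial.coeToPowerSeries.ringHom_apply, Polynomial.coe_mul, Polynomial.coe_C, Polynomial.coe_pow,
      Polynomial.coe_X, map_pow, map_X, mul_comm]
  rw [hp, sum_mul, coeffMap_sum]
  exact sum_congr rfl fun k _ => by rw [mul_assoc, coeffMap_map_mul, coeffMap_C_mul]

theorem isAlgebraic_of_isRoot {F E : Type*} [Field F] [Field E] [Algebra F E] {p : Polynomial E} (hp0 : p ≠ 0)
    (hp : ∀ k, IsAlgebraic F (p.coeff k)) {x : E} (hx : p.IsRoot x) : IsAlgebraic F x := by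
  have hl : p ∈ Polynomial.lifts (algebraMap (algebraicClosure F E) E) :=
    (Polynomial.lifts_iff_coeff_lifts _).2 fun k => ⟨⟨_, mem_algebraicClosure_iff.2 (hp k)⟩, rfl⟩
  obtain ⟨q, hq⟩ := (Polynomial.mem_lifts _).1 hl
  have h1 : IsAlgebraic (algebraicClosure F E) x := by
    refine ⟨q, fun h => hp0 (by rw [← hq, h, Polynomial.map_zero]), ?_⟩
    rw [Polynomial.aeval_def, ← Polynomial.eval_map, hq]
    exact hx
  exact h1.restrictScalars F

/-- A nonzero polynomial with algebraic coefficients divides a nonzero rational one. -/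
theorem exists_dvd_map {p : Polynomial ℂ} (hp0 : p ≠ 0) (hp : ∀ k, IsAlgebraic ℚ (p.coeff k)) :
    ∃ q : Polynomial ℚ, q ≠ 0 ∧ p ∣ q.map (algebraMap ℚ ℂ) := by
  have hroot : ∀ x ∈ p.roots, IsIntegral ℚ x := fun x hx =>
    (isAlgebraic_of_isRoot hp0 hp (Polynomial.isRoot_of_mem_roots hx)).isIntegral
  refine ⟨(p.roots.map fun x => minpoly ℚ x).prod, ?_, ?_⟩
  · refine Multiset.prod_ne_zero fun h => ?_
    obtain ⟨x, hx, h0⟩ := Multiset.mem_map.1 h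
    exact minpoly.ne_zero (hroot x hx) h0
  · have h1 : (p.roots.map fun x => Polynomial.X - Polynomial.C x).prod ∣
        (p.roots.map fun x => (minpoly ℚ x).map (algebraMap ℚ ℂ)).prod :=
      Multiset.prod_dvd_prod_of_dvd _ _ fun x _ => by
        rw [Polynomial.dvd_iff_isRoot, Polynomial.IsRoot.def, Polynomial.eval_map, ← Polynomial.aeval_def,
          minpoly.aeval]
    rw [← Polynomial.coe_mapRingHom, map_multiset_prod, Multiset.map_map]
    conv_lhs => rw [(IsAlgClosed.splits p).eq_prod_roots]
    rw [IsUnit.mul_left_dvd (Polynomial.isUnit_C.2 (isUnit_iff_ne_zero.2 (Polynomial.leadingCoeff_ne_zero.2 hp0)))]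
    exact h1

/-- A linear differential equation with algebraic polynomial coefficients can be solved for the
highest derivative after multiplication by a nonzero rational polynomial. -/
theorem exists_rational_leading {f : ℂ⟦X⟧} {M : ℕ} {p : ℕ → Polynomial ℂ}
    (hp : ∀ i k, IsAlgebraic ℚ ((p i).coeff k)) (hp0 : ∃ i, i ≤ M ∧ p i ≠ 0)
    (hsum : ∑ i ∈ range (M + 1), (p i : ℂ⟦X⟧) * (d⁄dX ℂ)^[i] f = 0) :
    ∃ (m : ℕ) (q : Polynomial ℚ) (u : ℕ → Polynomial ℂ), q ≠ 0 ∧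
      PowerSeries.map (algebraMap ℚ ℂ) q * (d⁄dX ℂ)^[m] f = ∑ i ∈ range m, (u i : ℂ⟦X⟧) * (d⁄dX ℂ)^[i] f := by
  let m := Nat.findGreatest (fun i => p i ≠ 0) M
  have hm : p m ≠ 0 := by
    obtain ⟨i, hi, h⟩ := hp0
    exact Nat.findGreatest_spec (P := fun i => p i ≠ 0) hi h
  have hmM : m ≤ M := Nat.findGreatest_le M
  obtain ⟨q, hq, v, hv⟩ := exists_dvd_map hm (hp m)
  refine ⟨m, q, fun i => -(v * p i), hq, ?_⟩
  have hs : ∑ i ∈ range (m + 1), (p i : ℂ⟦X⟧) * (d⁄dX ℂ)^[i] f = 0 := by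
    rw [← hsum]
    refine sum_subset (range_subset_range.2 (by omega)) fun i hi hi' => ?_
    rw [mem_range] at hi hi'
    have h0 : p i = 0 := by
      by_contra h
      exact hi' (Nat.lt_succ_of_le (Nat.le_findGreatest (by omega) h))
    rw [h0, Polynomial.coe_zero, zero_mul]
  rw [sum_range_succ] at hs
  have hqv : PowerSeries.map (algebraMap ℚ ℂ) q = (v : ℂ⟦X⟧) * p m := by
    rw [← Polynomial.polynomial_map_coe, hv, Polynomial.coe_mul, mul_comm]
  have h3 : ∑ i ∈ range m, ((-(v * p i) : Polynomial ℂ) : ℂ⟦X⟧) * (d⁄dX ℂ)^[i] f =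
      -(v * ∑ i ∈ range m, (p i : ℂ⟦X⟧) * (d⁄dX ℂ)^[i] f) := by
    rw [mul_sum, ← sum_neg_distrib]
    refine sum_congr rfl fun i _ => ?_
    rw [Polynomial.coe_neg, Polynomial.coe_mul]
    ring
  rw [h3, hqv]
  linear_combination (v : ℂ⟦X⟧) * hs

end EDescent

namespace EDescent

open Finset PowerSeries

theorem isDiffSpace_span {ι : Type*} [Finite ι] (G : ι → EQ)
    (h : ∀ i, EField.deriv (EField.ofEQ (G i)) ∈ Submodule.span (RatFunc ℚ) (Set.range fun i => EField.ofEQ (G i))) :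
    IsDiffSpace (Submodule.span (RatFunc ℚ) (Set.range fun i => EField.ofEQ (G i))) where
  fg := Submodule.fg_span (Set.finite_range _)
  deriv_mem w hw := by
    induction hw using Submodule.span_induction with
    | mem x hx =>
      obtain ⟨i, rfl⟩ := hx
      exact h i
    | zero => rw [map_zero]; exact zero_mem _
    | add x y _ _ hx hy => rw [map_add]; exact add_mem hx hy
    | smul a x hx' hx =>
      obtain ⟨a', -, h'⟩ := exists_deriv_ratFunc a
      rw [Algebra.smul_def, EField.deriv_mul, h', ← Algebra.smul_def, ← Algebra.smul_def]
      exact add_mem (Submodule.smul_mem _ _ hx') (Submodule.smul_mem _ _ hx)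
  le_span := Submodule.span_le.2 fun x hx => Submodule.subset_span ⟨Submodule.subset_span hx, by
    obtain ⟨i, rfl⟩ := hx
    exact ⟨G i, rfl⟩⟩

theorem coeff_iterate_derivative_mem (L : IntermediateField ℚ ℂ) {f : ℂ⟦X⟧} (hf : ∀ n, coeff n f ∈ L) (i n : ℕ) :
    coeff n ((d⁄dX ℂ)^[i] f) ∈ L := by
  induction i generalizing n with
  | zero => exact hf n
  | succ i ih =>
    rw [Function.iterate_succ_apply', coeff_derivative]
    exact L.mul_mem (ih _) (L.add_mem (natCast_mem L n) L.one_mem)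

theorem ofPoly_mul_mem {W : Submodule (RatFunc ℚ) EField} {x : EField} (p : Polynomial ℚ) (hx : x ∈ W) :
    EField.ofPoly p * x ∈ W := by
  rw [← EField.algebraMap_algebraMap, ← Algebra.smul_def]
  exact W.smul_mem _ hx

theorem mem_of_ofPoly_mul_mem {W : Submodule (RatFunc ℚ) EField} {x : EField} {p : Polynomial ℚ} (hp : p ≠ 0)
    (hx : EField.ofPoly p * x ∈ W) : x ∈ W := by
  rw [← EField.algebraMap_algebraMap, ← Algebra.smul_def] at hx
  exact (W.smul_mem_iff (by simpa using hp)).1 hx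

section

variable {a : ℕ → ℂ} (ha : IsE a)

/-- The coordinates of the derivatives of an E-function. -/
def coordDeriv (i : ℕ) (c : ℂ →ₗ[ℚ] ℚ) : EQ := ⟨coeffMap c ((d⁄dX ℂ)^[i] (ePS a)), by
  induction i with
  | zero => exact coeffMap_ePS_mem_EQ ha c
  | succ i ih =>
    rw [Function.iterate_succ_apply', coeffMap_derivative]
    exact derivative_mem_EQ ih⟩

theorem coe_coordDeriv (i : ℕ) (c : ℂ →ₗ[ℚ] ℚ) :
    (coordDeriv ha i c : ℚ⟦X⟧) = coeffMap c ((d⁄dX ℂ)^[i] (ePS a)) := rfl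

theorem deriv_coordDeriv (i : ℕ) (c : ℂ →ₗ[ℚ] ℚ) :
    EField.deriv (EField.ofEQ (coordDeriv ha i c)) = EField.ofEQ (coordDeriv ha (i + 1) c) := by
  rw [EField.deriv_ofEQ]
  congr 1
  apply Subtype.ext
  change d⁄dX ℚ (coeffMap c ((d⁄dX ℂ)^[i] (ePS a))) = coeffMap c ((d⁄dX ℂ)^[i + 1] (ePS a))
  rw [Function.iterate_succ_apply', coeffMap_derivative]

/-- The coordinates of an E-function lie in a finite-dimensional differential space. -/
theorem exists_isDiffSpace :
    ∃ W : Submodule (RatFunc ℚ) EField, IsDiffSpace W ∧ ∀ c, EField.ofEQ (coordDeriv ha 0 c) ∈ W := by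
  obtain ⟨L, hL, haL⟩ := exists_numberField ha
  obtain ⟨e, he⟩ := exists_coordinates L (Module.finBasis ℚ L)
  obtain ⟨m, q, u, hq, hmain⟩ : ∃ (m : ℕ) (q : Polynomial ℚ) (u : ℕ → Polynomial ℂ), q ≠ 0 ∧
      PowerSeries.map (algebraMap ℚ ℂ) q * (d⁄dX ℂ)^[m] (ePS a) =
        ∑ i ∈ range m, (u i : ℂ⟦X⟧) * (d⁄dX ℂ)^[i] (ePS a) := by
    obtain ⟨-, ⟨M, p, hp, hp0, hsum⟩, -⟩ := ha
    rw [sum_polyPS_mul_psD] at hsum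
    exact exists_rational_leading hp hp0 hsum
  let G : Fin m × Fin (Module.finrank ℚ L) → EQ := fun k => coordDeriv ha k.1 (e k.2)
  let W := Submodule.span (RatFunc ℚ) (Set.range fun k => EField.ofEQ (G k))
  have hfL : ∀ n, coeff n (ePS a) ∈ L := fun n => by
    rw [coeff_ePS]
    exact L.div_mem (haL n) (natCast_mem L _)
  have hlt : ∀ i < m, ∀ c, EField.ofEQ (coordDeriv ha i c) ∈ W := fun i hi c => by
    have h1 : coordDeriv ha i c =
        ∑ j, (⟨_, coe_mem_EQ (Polynomial.C (c (Module.finBasis ℚ L j)))⟩ : EQ) * coordDeriv ha i (e j) := by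
      apply Subtype.ext
      rw [AddSubmonoidClass.coe_finsetSum]
      refine (coeffMap_eq_sum c _ fun n => he _ (coeff_iterate_derivative_mem L hfL i n)).trans
        (sum_congr rfl fun j _ => ?_)
      rw [smul_eq_C_mul, ← Polynomial.coe_C]
      rfl
    rw [h1, map_sum]
    refine sum_mem fun j _ => ?_
    rw [map_mul, ← EField.ofPoly_apply]
    exact ofPoly_mul_mem _ (Submodule.subset_span ⟨(⟨i, hi⟩, j), rfl⟩)
  have hm : ∀ c, EField.ofEQ (coordDeriv ha m c) ∈ W := fun c => by
    refine mem_of_ofPoly_mul_mem hq ?_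
    have h1 : (⟨q, coe_mem_EQ q⟩ : EQ) * coordDeriv ha m c =
        ∑ i ∈ range m, ∑ k ∈ (u i).support, (⟨_, coe_mem_EQ (Polynomial.X ^ k)⟩ : EQ) *
          coordDeriv ha i (c ∘ₗ LinearMap.mulLeft ℚ ((u i).coeff k)) := by
      apply Subtype.ext
      have h2 := congrArg (coeffMap c) hmain
      rw [coeffMap_map_mul, coeffMap_sum] at h2
      simp only [AddSubmonoidClass.coe_finsetSum]
      refine h2.trans (sum_congr rfl fun i _ => ?_)
      rw [coeffMap_coe_mul]
      refine sum_congr rfl fun k _ => ?_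
      rw [← Polynomial.coe_X, ← Polynomial.coe_pow]
      rfl
    rw [EField.ofPoly_apply, ← map_mul, h1, map_sum]
    refine sum_mem fun i hi => ?_
    rw [map_sum]
    refine sum_mem fun k _ => ?_
    rw [map_mul, ← EField.ofPoly_apply]
    exact ofPoly_mul_mem _ (hlt i (mem_range.1 hi) _)
  have hle : ∀ i ≤ m, ∀ c, EField.ofEQ (coordDeriv ha i c) ∈ W := fun i hi c =>
    hi.lt_or_eq.elim (fun h => hlt i h c) fun h => by rw [h]; exact hm c
  refine ⟨W, isDiffSpace_span G fun k => ?_, hle 0 (Nat.zero_le _)⟩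
  rw [deriv_coordDeriv]
  exact hle _ k.1.2 _

end

end EDescent

namespace EDescent

open Finset PowerSeries

theorem hasSum_evalEQ_one (g : EQ) : HasSum (fun n => ((coeff n (g : ℚ⟦X⟧) : ℚ) : ℂ)) (evalEQ 1 g) := by
  have h1 : Summable fun n => coeff n (PowerSeries.map (algebraMap ℚ ℂ) (g : ℚ⟦X⟧)) * (1 : ℂ) ^ n :=
    (mem_entireSeries.1 (map_mem_entireSeries g.2) 1).of_norm
  have h2 : HasSum _ (evalEQ 1 g) := h1.hasSum
  simpa only [one_pow, mul_one, coeff_map, eq_ratCast] using h2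

theorem hasSum_evalE_one {a : ℕ → ℂ} (ha : IsE a) : HasSum (fun n => coeff n (ePS a)) (evalE a 1) := by
  obtain ⟨L, hL, haL⟩ := exists_numberField ha
  obtain ⟨e, he⟩ := exists_coordinates L (Module.finBasis ℚ L)
  have h1 : HasSum (fun n => ∑ j, ((coeff n (coordDeriv ha 0 (e j) : ℚ⟦X⟧) : ℚ) : ℂ) * (Module.finBasis ℚ L j : ℂ))
      (∑ j, evalEQ 1 (coordDeriv ha 0 (e j)) * (Module.finBasis ℚ L j : ℂ)) :=
    hasSum_sum fun j _ => (hasSum_evalEQ_one _).mul_right _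
  have h2 : Summable fun n => coeff n (ePS a) := by
    refine h1.summable.congr fun n => ?_
    have hn : coeff n (ePS a) ∈ L := by
      rw [coeff_ePS]
      exact L.div_mem (haL n) (natCast_mem L _)
    conv_rhs => rw [he _ hn]
    refine sum_congr rfl fun j _ => ?_
    rw [coe_coordDeriv, coeff_coeffMap, Rat.smul_def]
    rfl
  have h3 := h2.hasSum
  have h4 : evalE a 1 = ∑' n, coeff n (ePS a) := tsum_congr fun n => by rw [coeff_ePS, one_pow, mul_one]
  rwa [← h4] at h3

theorem exists_isDiffSpace_ge {r : ℕ} (W : Fin r → Submodule (RatFunc ℚ) EField) (hW : ∀ i, IsDiffSpace (W i)) :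
    ∃ V, IsDiffSpace V ∧ (1 : EField) ∈ V ∧ ∀ i, W i ≤ V := by
  have h : ∀ s : Finset (Fin r), IsDiffSpace (s.sup W ⊔ 1) := fun s => by
    induction s using Finset.induction_on with
    | empty => rw [sup_empty, bot_sup_eq]; exact IsDiffSpace.one
    | insert i s _ ih => rw [sup_insert, sup_assoc]; exact (hW i).sup ih
  exact ⟨_, h univ, Submodule.mem_sup_right (Submodule.mem_one.2 ⟨1, map_one _⟩),
    fun i => (le_sup (mem_univ i)).trans le_sup_left⟩

theorem exists_common_numberField {r : ℕ} (a : Fin r → ℕ → ℂ) (ha : ∀ i, IsE (a i)) (c : Fin r → ℂ)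
    (hc : ∀ i, IsAlgebraic ℚ (c i)) :
    ∃ L : IntermediateField ℚ ℂ, FiniteDimensional ℚ L ∧ (∀ i n, a i n ∈ L) ∧ ∀ i, c i ∈ L := by
  choose L hL haL using fun i => exists_numberField (ha i)
  have h1 : FiniteDimensional ℚ (IntermediateField.adjoin ℚ (Set.range c)) :=
    finiteDimensional_adjoin_of_finite (Set.finite_range c) (Set.forall_mem_range.2 hc)
  have h2 : FiniteDimensional ℚ (⨆ i, L i : IntermediateField ℚ ℂ) :=
    IntermediateField.finiteDimensional_iSup_of_finite
  exact ⟨(⨆ i, L i) ⊔ IntermediateField.adjoin ℚ (Set.range c), IntermediateField.finiteDimensional_sup _ _,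
    fun i n => (le_iSup L i |>.trans le_sup_left) (haL i n),
    fun i => SetLike.le_def.1 le_sup_right (IntermediateField.subset_adjoin ℚ _ ⟨i, rfl⟩)⟩

/-- An algebraic relation between values of E-functions is preserved by every additive map that is
linear over a field containing their Taylor coefficients. -/
theorem sum_map_mul_evalE_eq_zero {r : ℕ} (a : Fin r → ℕ → ℂ) (ha : ∀ i, IsE (a i)) (c : Fin r → ℂ)
    (hc : ∀ i, IsAlgebraic ℚ (c i)) (hrel : ∑ i, c i * evalE (a i) 1 = 0) (t : ℂ →+ ℂ)
    (ht : ∀ i n, t (c i * coeff n (ePS (a i))) = t (c i) * coeff n (ePS (a i))) :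
    ∑ i, t (c i) * evalE (a i) 1 = 0 := by
  obtain ⟨L, hL, haL, hcL⟩ := exists_common_numberField a ha c hc
  let b := Module.finBasis ℚ L
  obtain ⟨e, he⟩ := exists_coordinates L b
  choose W hW hWmem using fun i => exists_isDiffSpace (ha i)
  obtain ⟨V, hV, h1V, hWV⟩ := exists_isDiffSpace_ge W hW
  let F : Fin (Module.finrank ℚ L) → EQ := fun j =>
    ∑ i, coordDeriv (ha i) 0 (e j ∘ₗ LinearMap.mulLeft ℚ (c i))
  have hF : ∀ j, EField.ofEQ (F j) ∈ V := fun j => by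
    rw [map_sum]
    exact sum_mem fun i _ => hWV i (hWmem i _)
  have hcoeff : ∀ j n, coeff n (F j : ℚ⟦X⟧) = e j (∑ i, c i * coeff n (ePS (a i))) := fun j n => by
    rw [AddSubmonoidClass.coe_finsetSum, map_sum, map_sum]
    exact sum_congr rfl fun i _ => coeff_coeffMap _ _ _
  have key : ∀ t : ℂ →+ ℂ, (∀ i n, t (c i * coeff n (ePS (a i))) = t (c i) * coeff n (ePS (a i))) →
      ∑ i, t (c i) * evalE (a i) 1 = ∑ j, t (b j) * evalEQ 1 (F j) := fun t ht => by
    have h1 : HasSum (fun n => ∑ i, t (c i) * coeff n (ePS (a i))) (∑ i, t (c i) * evalE (a i) 1) :=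
      hasSum_sum fun i _ => (hasSum_evalE_one (ha i)).mul_left _
    have h2 : HasSum (fun n => ∑ j, t (b j) * ((coeff n (F j : ℚ⟦X⟧) : ℚ) : ℂ))
        (∑ j, t (b j) * evalEQ 1 (F j)) :=
      hasSum_sum fun j _ => (hasSum_evalEQ_one (F j)).mul_left _
    refine h1.unique (h2.congr_fun fun n => ?_)
    have hn : ∑ i, c i * coeff n (ePS (a i)) ∈ L := sum_mem fun i _ => by
      rw [coeff_ePS]
      exact L.mul_mem (hcL i) (L.div_mem (haL i n) (natCast_mem L _))
    have h3 := congrArg t (he _ hn)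
    rw [map_sum, map_sum] at h3
    simp only [ht] at h3
    rw [h3]
    refine sum_congr rfl fun j _ => ?_
    rw [hcoeff, map_rat_smul, Rat.smul_def, mul_comm]
  have h0 := key (AddMonoidHom.id ℂ) fun _ _ => rfl
  rw [key t ht]
  refine sum_eq_zero fun j _ => ?_
  rw [evalEQ_eq_zero_of_basis_sum b L.val V hV h1V F hF (h0.symm.trans hrel) j, mul_zero]

end EDescent

/-- For a subfield `K` of `ℚ̄`, elements of `E_K` that are linearly
dependent over `ℚ̄` are linearly dependent over `K`. -/
theorem E_linear_descent
    (K : Subfield ℂ) (hKalg : ∀ x ∈ K, IsAlgebraic ℚ x)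
    (r : ℕ) (ξ : Fin r → ℂ) (hξ : ∀ i, ξ i ∈ Eset (K : Set ℂ))
    (c : Fin r → ℂ) (hcalg : ∀ i, IsAlgebraic ℚ (c i)) (hc0 : c ≠ 0)
    (hrel : ∑ i, c i * ξ i = 0) :
    ∃ c' : Fin r → ℂ, (∀ i, c' i ∈ K) ∧ c' ≠ 0 ∧ ∑ i, c' i * ξ i = 0 := by
  choose a ha haK hξa using hξ
  obtain ⟨i₀, hi₀⟩ := Function.ne_iff.1 hc0
  obtain ⟨φ, hφ⟩ : ∃ φ : Module.Dual K ℂ, φ (c i₀) ≠ 0 := by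
    by_contra! h
    exact hi₀ ((Module.forall_dual_apply_eq_zero_iff K (c i₀)).1 h)
  let t : ℂ →+ ℂ := K.subtype.toAddMonoidHom.comp φ.toAddMonoidHom
  refine ⟨fun i => t (c i), fun i => (φ (c i)).2, fun h => hφ (Subtype.ext (congrFun h i₀)), ?_⟩
  simp only [hξa] at hrel ⊢
  refine EDescent.sum_map_mul_evalE_eq_zero a ha c hcalg hrel t fun i n => ?_
  have hn : PowerSeries.coeff n (ePS (a i)) ∈ K := by
    rw [EDescent.coeff_ePS]
    exact K.div_mem (haK i n) (natCast_mem K _)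
  have h := φ.map_smul ⟨_, hn⟩ (c i)
  calc t (c i * PowerSeries.coeff n (ePS (a i))) = t ((⟨_, hn⟩ : K) • c i) := by
        rw [mul_comm]; rfl
    _ = ((φ ((⟨_, hn⟩ : K) • c i) : K) : ℂ) := rfl
    _ = t (c i) * PowerSeries.coeff n (ePS (a i)) := by
        rw [h, mul_comm]; rfl
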